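/- Let σ ∈ C³_b(W², L(ℝ^d, W)), 1/3 < β < γ ≤ 1/2, and let 𝐗 be a delayed γ-rough path with delay r > 0. The solution map ξ ↦ y^ξ of the rough delay equation dy_t = σ(y_t, y_{t−r}) d𝐗_t, as a map 𝒟_X^β([−r,0], W) → 𝒟_X^β([0,r], W), is Fréchet differentiable, and for every ξ, ξ̃ ∈ 𝒟_X^β([−r,0], W) the directional derivative Z := Dy^ξ[ξ̃] satisfies the linear rough delay equation Z_t = ξ̃_0 + ∫_0^t [σ_x(y^ξ_τ, ξ_{τ−r}) Z_τ + σ_y(y^ξ_τ, ξ_{τ−r}) ξ̃_{τ−r}] d𝐗_τ for t ∈ [0,r] and Z_t = ξ̃_t for t ∈ [−r,0], where Z has Gubinelli derivative Z'_τ = σ_x(y^ξ_τ, ξ_{τ−r}) Z_τ + σ_y(y^ξ_τ, ξ_{τ−r}) ξ̃_{τ−r} and the integrand is regarded as a delayed β-controlled path whose components ζ⁰, ζ¹ are obtained from the controlled structures of y^ξ, ξ, Z and ξ̃ by the Leibniz rule. -/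

import Mathlib

noncomputable section

namespace SDDE

open Set

variable {E E₁ E₂ : Type*}

/-- `f` is `γ`-Hölder continuous on `I`. -/
def HolderOn [NormedAddCommGroup E] (γ : ℝ) (I : Set ℝ) (f : ℝ → E) : Prop :=
  ∃ C : ℝ, ∀ s ∈ I, ∀ t ∈ I, ‖f t - f s‖ ≤ C * |t - s| ^ γ

/-- The `γ`-Hölder seminorm of `f` on `I`. -/
def holderNorm [NormedAddCommGroup E] (γ : ℝ) (I : Set ℝ) (f : ℝ → E) : ℝ :=
  sInf {C : ℝ | 0 ≤ C ∧ ∀ s ∈ I, ∀ t ∈ I, ‖f t - f s‖ ≤ C * |t - s| ^ γ}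

/-- A two-parameter function has finite `γ`-Hölder seminorm on `I`. -/
def Holder2On [NormedAddCommGroup E] (γ : ℝ) (I : Set ℝ) (F : ℝ → ℝ → E) : Prop :=
  ∃ C : ℝ, ∀ s ∈ I, ∀ t ∈ I, ‖F s t‖ ≤ C * |t - s| ^ γ

/-- The `γ`-Hölder seminorm of a two-parameter function on `I`. -/
def holder2Norm [NormedAddCommGroup E] (γ : ℝ) (I : Set ℝ) (F : ℝ → ℝ → E) : ℝ :=
  sInf {C : ℝ | 0 ≤ C ∧ ∀ s ∈ I, ∀ t ∈ I, ‖F s t‖ ≤ C * |t - s| ^ γ}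

/-- A delayed `γ`-rough path with delay `r`: a path `X : ℝ → ℝ^d` together with a
Lévy area `XX` and a delayed Lévy area `XXd`, satisfying Chen's identities and
Hölder bounds.  The tensor `a ⊗ b ∈ ℝ^d ⊗ ℝ^d` is represented by the matrix
`fun i j => a i * b j`. -/
structure DelayedRoughPath (d : ℕ) (r γ : ℝ) : Type where
  X : ℝ → Fin d → ℝ
  XX : ℝ → ℝ → Fin d → Fin d → ℝ
  XXd : ℝ → ℝ → Fin d → Fin d → ℝ
  holX : ∀ a b : ℝ, HolderOn γ (Icc a b) X
  contXX : Continuous fun p : ℝ × ℝ => XX p.1 p.2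
  contXXd : Continuous fun p : ℝ × ℝ => XXd p.1 p.2
  chen : ∀ s u t : ℝ, XX s t = XX s u + XX u t + fun i j => (X u i - X s i) * (X t j - X u j)
  chend : ∀ s u t : ℝ,
    XXd s t = XXd s u + XXd u t + fun i j => (X (u - r) i - X (s - r) i) * (X t j - X u j)
  holXX : ∀ a b : ℝ, Holder2On (2 * γ) (Icc a b) XX
  holXXd : ∀ a b : ℝ, Holder2On (2 * γ) (Icc a b) XXd

variable {d : ℕ} {r γ : ℝ}

/-- The rough path "norm" `‖RP‖_{γ;[a,b]}`. -/
def DelayedRoughPath.hnorm (RP : DelayedRoughPath d r γ) (a b : ℝ) : ℝ :=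
  holderNorm γ (Icc a b) RP.X + holderNorm γ (Icc (a - r) (b - r)) RP.X +
    Real.sqrt (holder2Norm (2 * γ) (Icc a b) RP.XX) +
    Real.sqrt (holder2Norm (2 * γ) (Icc a b) RP.XXd)

section Controlled

variable [NormedAddCommGroup E] [NormedSpace ℝ E]

/-- `(m, m')` is a `β`-controlled path based on `X` on `I`: `m'` is `β`-Hölder and the
remainder `m_{s,t} - m'_s X_{s,t}` has finite `2β`-Hölder seminorm. -/
def IsControlled (β : ℝ) (X : ℝ → Fin d → ℝ) (I : Set ℝ)
    (m : ℝ → E) (m' : ℝ → (Fin d → ℝ) →L[ℝ] E) : Prop :=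
  HolderOn β I m' ∧
    ∃ C : ℝ, ∀ s ∈ I, ∀ t ∈ I, ‖m t - m s - m' s (X t - X s)‖ ≤ C * |t - s| ^ (2 * β)

/-- The norm of the controlled path `(m, m')` in `𝒟_X^β([a,b])`. -/
def cpNorm (β : ℝ) (X : ℝ → Fin d → ℝ) (a b : ℝ)
    (m : ℝ → E) (m' : ℝ → (Fin d → ℝ) →L[ℝ] E) : ℝ :=
  ‖m a‖ + ‖m' a‖ + holderNorm β (Icc a b) m' +
    sInf {C : ℝ | 0 ≤ C ∧ ∀ s ∈ Icc a b, ∀ t ∈ Icc a b,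
      ‖m t - m s - m' s (X t - X s)‖ ≤ C * |t - s| ^ (2 * β)}

/-- `(m, ζ0, ζ1)` is a delayed `(α, β, θ)`-controlled path based on `X` on `[a,b]`
(with delay `rr`). -/
def IsDelayedControlled (rr α β θ : ℝ) (X : ℝ → Fin d → ℝ) (a b : ℝ)
    (m : ℝ → E) (ζ0 ζ1 : ℝ → (Fin d → ℝ) →L[ℝ] E) : Prop :=
  HolderOn α (Icc a b) m ∧ HolderOn β (Icc a b) ζ0 ∧ HolderOn β (Icc a b) ζ1 ∧
    ∃ C : ℝ, ∀ s ∈ Icc a b, ∀ t ∈ Icc a b,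
      ‖m t - m s - ζ0 s (X t - X s) - ζ1 s (X (t - rr) - X (s - rr))‖ ≤ C * |t - s| ^ θ

/-- The norm on the space `𝒟_X^{α,β,θ}([a,b])` of delayed controlled paths. -/
def dcpNorm (rr α β θ : ℝ) (X : ℝ → Fin d → ℝ) (a b : ℝ)
    (m : ℝ → E) (ζ0 ζ1 : ℝ → (Fin d → ℝ) →L[ℝ] E) : ℝ :=
  ‖m a‖ + ‖ζ0 a‖ + ‖ζ1 a‖ + holderNorm α (Icc a b) m + holderNorm β (Icc a b) ζ0 +
    holderNorm β (Icc a b) ζ1 +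
    sInf {C : ℝ | 0 ≤ C ∧ ∀ s ∈ Icc a b, ∀ t ∈ Icc a b,
      ‖m t - m s - ζ0 s (X t - X s) - ζ1 s (X (t - rr) - X (s - rr))‖ ≤ C * |t - s| ^ θ}

/-- Application of a bilinear-map-valued coefficient to a tensor (matrix). -/
def apply2 (ζ : (Fin d → ℝ) →L[ℝ] ((Fin d → ℝ) →L[ℝ] E)) (M : Fin d → Fin d → ℝ) : E :=
  ∑ i : Fin d, ∑ j : Fin d, M i j • ζ (Pi.single i 1) (Pi.single j 1)

/-- A partition of the interval `[s,t]`. -/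
structure Partition (s t : ℝ) : Type where
  n : ℕ
  pts : ℕ → ℝ
  h0 : pts 0 = s
  hn : pts n = t
  mono : ∀ i < n, pts i ≤ pts (i + 1)

/-- The mesh of the partition is at most `δ`. -/
def Partition.MeshLE {s t : ℝ} (P : Partition s t) (δ : ℝ) : Prop :=
  ∀ i < P.n, P.pts (i + 1) - P.pts i ≤ δ

/-- The compensated Riemann sum of a delayed controlled integrand along a partition. -/
def riemannSum (RP : DelayedRoughPath d r γ) (m : ℝ → (Fin d → ℝ) →L[ℝ] E)
    (ζ0 ζ1 : ℝ → (Fin d → ℝ) →L[ℝ] ((Fin d → ℝ) →L[ℝ] E)) {s t : ℝ} (P : Partition s t) : E :=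
  ∑ i ∈ Finset.range P.n,
    (m (P.pts i) (RP.X (P.pts (i + 1)) - RP.X (P.pts i)) +
      apply2 (ζ0 (P.pts i)) (RP.XX (P.pts i) (P.pts (i + 1))) +
      apply2 (ζ1 (P.pts i)) (RP.XXd (P.pts i) (P.pts (i + 1))))

/-- `v` is the rough delay integral `∫_s^t m dX` of the delayed controlled path
`(m, ζ0, ζ1)` against `RP`: the compensated Riemann sums converge to `v` as the mesh
tends to zero. -/
def HasRoughIntegral (RP : DelayedRoughPath d r γ) (m : ℝ → (Fin d → ℝ) →L[ℝ] E)
    (ζ0 ζ1 : ℝ → (Fin d → ℝ) →L[ℝ] ((Fin d → ℝ) →L[ℝ] E)) (s t : ℝ) (v : E) : Prop :=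
  ∀ ε > (0:ℝ), ∃ δ > (0:ℝ), ∀ P : Partition s t, P.MeshLE δ → ‖riemannSum RP m ζ0 ζ1 P - v‖ ≤ ε

/-- Compensated Riemann sum for the (non-delayed) forward rough integral. -/
def riemannSumFwd (X : ℝ → Fin d → ℝ) (XX : ℝ → ℝ → Fin d → Fin d → ℝ)
    (m : ℝ → (Fin d → ℝ) →L[ℝ] E) (m' : ℝ → (Fin d → ℝ) →L[ℝ] ((Fin d → ℝ) →L[ℝ] E))
    {s t : ℝ} (P : Partition s t) : E :=
  ∑ i ∈ Finset.range P.n,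
    (m (P.pts i) (X (P.pts (i + 1)) - X (P.pts i)) +
      apply2 (m' (P.pts i)) (XX (P.pts i) (P.pts (i + 1))))

/-- The forward rough integral of a controlled path, via left-point compensated sums. -/
def HasFwdIntegral (X : ℝ → Fin d → ℝ) (XX : ℝ → ℝ → Fin d → Fin d → ℝ)
    (m : ℝ → (Fin d → ℝ) →L[ℝ] E) (m' : ℝ → (Fin d → ℝ) →L[ℝ] ((Fin d → ℝ) →L[ℝ] E))
    (s t : ℝ) (v : E) : Prop :=
  ∀ ε > (0:ℝ), ∃ δ > (0:ℝ), ∀ P : Partition s t, P.MeshLE δ →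
    ‖riemannSumFwd X XX m m' P - v‖ ≤ ε

/-- Compensated Riemann sum for the backward rough integral (right endpoints). -/
def riemannSumBwd (X : ℝ → Fin d → ℝ) (XX : ℝ → ℝ → Fin d → Fin d → ℝ)
    (m : ℝ → (Fin d → ℝ) →L[ℝ] E) (m' : ℝ → (Fin d → ℝ) →L[ℝ] ((Fin d → ℝ) →L[ℝ] E))
    {s t : ℝ} (P : Partition s t) : E :=
  ∑ i ∈ Finset.range P.n,
    (m (P.pts (i + 1)) (X (P.pts (i + 1)) - X (P.pts i)) +
      apply2 (m' (P.pts (i + 1))) (XX (P.pts i) (P.pts (i + 1))))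

/-- The backward rough integral, via right-point compensated sums. -/
def HasBwdIntegral (X : ℝ → Fin d → ℝ) (XX : ℝ → ℝ → Fin d → Fin d → ℝ)
    (m : ℝ → (Fin d → ℝ) →L[ℝ] E) (m' : ℝ → (Fin d → ℝ) →L[ℝ] ((Fin d → ℝ) →L[ℝ] E))
    (s t : ℝ) (v : E) : Prop :=
  ∀ ε > (0:ℝ), ∃ δ > (0:ℝ), ∀ P : Partition s t, P.MeshLE δ →
    ‖riemannSumBwd X XX m m' P - v‖ ≤ ε

end Controlled

section Smooth

variable [NormedAddCommGroup E₁] [NormedSpace ℝ E₁] [NormedAddCommGroup E₂] [NormedSpace ℝ E₂]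

/-- `f ∈ C^n_b`: `f` is `n` times continuously differentiable with bounded derivatives
(up to order `n`). -/
def CnBounded (n : ℕ) (f : E₁ → E₂) : Prop :=
  ContDiff ℝ n f ∧ ∀ i : ℕ, i ≤ n → ∃ C : ℝ, ∀ x, ‖iteratedFDeriv ℝ i f x‖ ≤ C

/-- `f ∈ 𝒞^{m+κ}`: derivatives up to order `m` are bounded and continuous and the
`m`-th derivative is `κ`-Hölder. -/
def CHolderClass (m : ℕ) (κ : ℝ) (f : E₁ → E₂) : Prop :=
  ContDiff ℝ m f ∧ (∀ i : ℕ, i ≤ m → ∃ C : ℝ, ∀ x, ‖iteratedFDeriv ℝ i f x‖ ≤ C) ∧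
    ∃ C : ℝ, ∀ x y, ‖iteratedFDeriv ℝ m f x - iteratedFDeriv ℝ m f y‖ ≤ C * ‖x - y‖ ^ κ

end Smooth

section CNdelta

variable {F₁ F₂ : Type*} [AddCommGroup F₁] [Module ℝ F₁] [AddCommGroup F₂] [Module ℝ F₂]

/-- A map `F` between (semi-)normed spaces (seminorms `N₁`, `N₂`) is of class `𝒞^{n+δ}`
on `U`: there exist multilinear derivative maps `D j`, `j ≤ n`, bounded with respect
to the seminorms, where `D (j+1)` is the Fréchet derivative of `D j` on `U` and `D n`
is `δ`-Hölder on `U`. -/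
def IsCNdeltaOn (N₁ : F₁ → ℝ) (N₂ : F₂ → ℝ) (F : F₁ → F₂) (U : Set F₁) (n : ℕ) (δ : ℝ) :
    Prop :=
  ∃ D : (j : ℕ) → F₁ → ((Fin j → F₁) → F₂),
    (∀ x ∈ U, ∀ v : Fin 0 → F₁, D 0 x v = F x) ∧
    (∀ j : ℕ, j ≤ n → ∀ x ∈ U, ∀ (v : Fin j → F₁) (i : Fin j) (a b : F₁) (c : ℝ),
      D j x (Function.update v i (a + b)) =
          D j x (Function.update v i a) + D j x (Function.update v i b) ∧
        D j x (Function.update v i (c • a)) = c • D j x (Function.update v i a)) ∧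
    (∀ j : ℕ, j ≤ n → ∀ x ∈ U, ∃ C : ℝ, ∀ v : Fin j → F₁,
      N₂ (D j x v) ≤ C * ∏ i : Fin j, N₁ (v i)) ∧
    (∀ j : ℕ, j < n → ∀ x ∈ U, ∀ ε > (0:ℝ), ∃ ρ > (0:ℝ), ∀ h : F₁, N₁ h ≤ ρ → x + h ∈ U →
      ∀ v : Fin j → F₁,
        N₂ (D j (x + h) v - D j x v - D (j + 1) x (Fin.cons h v)) ≤
          ε * N₁ h * ∏ i : Fin j, N₁ (v i)) ∧
    ∃ C : ℝ, ∀ x ∈ U, ∀ y ∈ U, ∀ v : Fin n → F₁,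
      N₂ (D n x v - D n y v) ≤ C * N₁ (x - y) ^ δ * ∏ i : Fin n, N₁ (v i)

/-- `F` is locally of class `𝒞^{n+δ}` on `S`. -/
def IsLocallyCNdeltaOn (N₁ : F₁ → ℝ) (N₂ : F₂ → ℝ) (F : F₁ → F₂) (S : Set F₁) (n : ℕ)
    (δ : ℝ) : Prop :=
  ∀ x ∈ S, ∃ ρ > (0:ℝ), IsCNdeltaOn N₁ N₂ F (S ∩ {y | N₁ (y - x) < ρ}) n δ

end CNdelta

section Equation

variable {W : Type*} [NormedAddCommGroup W] [NormedSpace ℝ W]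

/-- The partial derivative `σ_x` of `σ` in the first variable. -/
def sigmaX (σ : W × W → (Fin d → ℝ) →L[ℝ] W) : W × W → W →L[ℝ] ((Fin d → ℝ) →L[ℝ] W) :=
  fun p => (fderiv ℝ σ p).comp (ContinuousLinearMap.inl ℝ W W)

/-- The partial derivative `σ_y` of `σ` in the second variable. -/
def sigmaY (σ : W × W → (Fin d → ℝ) →L[ℝ] W) : W × W → W →L[ℝ] ((Fin d → ℝ) →L[ℝ] W) :=
  fun p => (fderiv ℝ σ p).comp (ContinuousLinearMap.inr ℝ W W)

/-- The Gubinelli derivative of a solution: `ξ'` on `[-r,0)`, `σ(y_t, y_{t-r})` for `t ≥ 0`. -/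
def solDeriv (σ : W × W → (Fin d → ℝ) →L[ℝ] W) (rr : ℝ)
    (ξ' : ℝ → (Fin d → ℝ) →L[ℝ] W) (y : ℝ → W) : ℝ → (Fin d → ℝ) →L[ℝ] W :=
  fun t => if t < 0 then ξ' t else σ (y t, y (t - rr))

/-- `ζ⁰` component of the integrand `τ ↦ σ(y_τ, y_{τ-r})`:  `σ_x(y_τ, y_{τ-r}) y'_τ`. -/
def zeta0 (σ : W × W → (Fin d → ℝ) →L[ℝ] W) (rr : ℝ) (y : ℝ → W)
    (y' : ℝ → (Fin d → ℝ) →L[ℝ] W) : ℝ → (Fin d → ℝ) →L[ℝ] ((Fin d → ℝ) →L[ℝ] W) :=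
  fun τ => (sigmaX σ (y τ, y (τ - rr))).comp (y' τ)

/-- `ζ¹` component of the integrand `τ ↦ σ(y_τ, y_{τ-r})`:  `σ_y(y_τ, y_{τ-r}) y'_{τ-r}`. -/
def zeta1 (σ : W × W → (Fin d → ℝ) →L[ℝ] W) (rr : ℝ) (y : ℝ → W)
    (y' : ℝ → (Fin d → ℝ) →L[ℝ] W) : ℝ → (Fin d → ℝ) →L[ℝ] ((Fin d → ℝ) →L[ℝ] W) :=
  fun τ => (sigmaY σ (y τ, y (τ - rr))).comp (y' (τ - rr))

/-- `y` solves `dy_t = B(y_t, y_{t-r}) dt + σ(y_t, y_{t-r}) dRP_t` on `[0,T]` with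
initial condition `(ξ, ξ')` on `[-r,0]`:  `y = ξ` on `[-r,0]`, on each interval
`[kr, (k+1)r] ∩ [0,T]` the path is `β`-controlled with Gubinelli derivative
`y'_t = σ(y_t, y_{t-r})`, and the integral identity holds for `0 ≤ s ≤ t ≤ T`. -/
def IsSolOnT (RP : DelayedRoughPath d r γ) (σ : W × W → (Fin d → ℝ) →L[ℝ] W)
    (B : W × W →ₗ[ℝ] W) (β : ℝ) (ξ : ℝ → W) (ξ' : ℝ → (Fin d → ℝ) →L[ℝ] W)
    (T : ℝ) (y : ℝ → W) : Prop :=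
  (∀ t ∈ Icc (-r) 0, y t = ξ t) ∧
    (∀ k : ℕ, (k : ℝ) * r ≤ T →
      IsControlled β RP.X (Icc ((k : ℝ) * r) (min (((k : ℝ) + 1) * r) T)) y
        (solDeriv σ r ξ' y)) ∧
    ∀ s t : ℝ, 0 ≤ s → s ≤ t → t ≤ T →
      HasRoughIntegral RP (fun τ => σ (y τ, y (τ - r)))
        (zeta0 σ r y (solDeriv σ r ξ' y)) (zeta1 σ r y (solDeriv σ r ξ' y)) s t
        (y t - y s - ∫ τ in s..t, B (y τ, y (τ - r)))

/-- `y` solves `dy_t = B(y_t, y_{t-r}) dt + σ(y_t, y_{t-r}) dRP_t` on `[0,r]` with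
initial condition `(ξ, ξ')` on `[-r,0]`. -/
def IsSolOn (RP : DelayedRoughPath d r γ) (σ : W × W → (Fin d → ℝ) →L[ℝ] W)
    (B : W × W →ₗ[ℝ] W) (β : ℝ) (ξ : ℝ → W) (ξ' : ℝ → (Fin d → ℝ) →L[ℝ] W)
    (y : ℝ → W) : Prop :=
  (∀ t ∈ Icc (-r) 0, y t = ξ t) ∧
    IsControlled β RP.X (Icc 0 r) y (solDeriv σ r ξ' y) ∧
    ∀ t ∈ Icc 0 r,
      HasRoughIntegral RP (fun τ => σ (y τ, y (τ - r)))
        (zeta0 σ r y (solDeriv σ r ξ' y)) (zeta1 σ r y (solDeriv σ r ξ' y)) 0 t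
        (y t - ξ 0 - ∫ τ in (0:ℝ)..t, B (y τ, y (τ - r)))

/-- The solution map `ξ ↦ y^ξ` on pairs (path, Gubinelli derivative). -/
def solMap (RP : DelayedRoughPath d r γ) (σ : W × W → (Fin d → ℝ) →L[ℝ] W)
    (B : W × W →ₗ[ℝ] W) (β : ℝ) :
    ((ℝ → W) × (ℝ → (Fin d → ℝ) →L[ℝ] W)) → ((ℝ → W) × (ℝ → (Fin d → ℝ) →L[ℝ] W)) :=
  fun p =>
    @dite _ (∃ y : ℝ → W, IsSolOn RP σ B β p.1 p.2 y) (Classical.dec _)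
      (fun h => (h.choose, solDeriv σ r p.2 h.choose)) (fun _ => 0)

/-- `D` is the Fréchet derivative of the solution map at the controlled path `p`:
`D` is a bounded linear map (w.r.t. the controlled path norms) and
`‖solMap (p+h) - solMap p - D h‖ = o(‖h‖)` on controlled directions `h`. -/
def IsSolMapDerivAt (RP : DelayedRoughPath d r γ) (σ : W × W → (Fin d → ℝ) →L[ℝ] W)
    (B : W × W →ₗ[ℝ] W) (β : ℝ) (p : (ℝ → W) × (ℝ → (Fin d → ℝ) →L[ℝ] W))
    (D : ((ℝ → W) × (ℝ → (Fin d → ℝ) →L[ℝ] W)) →ₗ[ℝ]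
      ((ℝ → W) × (ℝ → (Fin d → ℝ) →L[ℝ] W))) : Prop :=
  (∃ C : ℝ, 0 ≤ C ∧ ∀ q : (ℝ → W) × (ℝ → (Fin d → ℝ) →L[ℝ] W),
    IsControlled β RP.X (Icc (-r) 0) q.1 q.2 →
      cpNorm β RP.X 0 r (D q).1 (D q).2 ≤ C * cpNorm β RP.X (-r) 0 q.1 q.2) ∧
    ∀ ε > (0:ℝ), ∃ δ > (0:ℝ), ∀ h : (ℝ → W) × (ℝ → (Fin d → ℝ) →L[ℝ] W),
      IsControlled β RP.X (Icc (-r) 0) h.1 h.2 → cpNorm β RP.X (-r) 0 h.1 h.2 ≤ δ →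
        cpNorm β RP.X 0 r (solMap RP σ B β (p + h) - solMap RP σ B β p - D h).1
            (solMap RP σ B β (p + h) - solMap RP σ B β p - D h).2 ≤
          ε * cpNorm β RP.X (-r) 0 h.1 h.2

/-- The map `(a,b,c,e) ↦ σ_x(a,b) c + σ_y(a,b) e` appearing in the linearized equation. -/
def PhiLin (σ : W × W → (Fin d → ℝ) →L[ℝ] W) : W × W × W × W → (Fin d → ℝ) →L[ℝ] W :=
  fun p => sigmaX σ (p.1, p.2.1) p.2.2.1 + sigmaY σ (p.1, p.2.1) p.2.2.2

/-- The integrand `τ ↦ σ_x(y_τ, ξ_{τ-r}) Z_τ + σ_y(y_τ, ξ_{τ-r}) η_{τ-r}` of the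
linearized equation. -/
def linInt (σ : W × W → (Fin d → ℝ) →L[ℝ] W) (rr : ℝ) (ξ y Z ηf : ℝ → W) :
    ℝ → (Fin d → ℝ) →L[ℝ] W :=
  fun τ => sigmaX σ (y τ, ξ (τ - rr)) (Z τ) + sigmaY σ (y τ, ξ (τ - rr)) (ηf (τ - rr))

/-- The `ζ⁰` component of the linearized integrand, via the Leibniz rule. -/
def zeta0lin (σ : W × W → (Fin d → ℝ) →L[ℝ] W) (rr : ℝ) (ξ y Z ηf : ℝ → W)
    (y' Z' : ℝ → (Fin d → ℝ) →L[ℝ] W) : ℝ → (Fin d → ℝ) →L[ℝ] ((Fin d → ℝ) →L[ℝ] W) :=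
  fun τ => (fderiv ℝ (PhiLin σ) (y τ, ξ (τ - rr), Z τ, ηf (τ - rr))).comp
    ((y' τ).prod (((0 : (Fin d → ℝ) →L[ℝ] W)).prod ((Z' τ).prod (0 : (Fin d → ℝ) →L[ℝ] W))))

/-- The `ζ¹` component of the linearized integrand, via the Leibniz rule. -/
def zeta1lin (σ : W × W → (Fin d → ℝ) →L[ℝ] W) (rr : ℝ) (ξ y Z ηf : ℝ → W)
    (ξ' η' : ℝ → (Fin d → ℝ) →L[ℝ] W) : ℝ → (Fin d → ℝ) →L[ℝ] ((Fin d → ℝ) →L[ℝ] W) :=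
  fun τ => (fderiv ℝ (PhiLin σ) (y τ, ξ (τ - rr), Z τ, ηf (τ - rr))).comp
    (((0 : (Fin d → ℝ) →L[ℝ] W)).prod
      ((ξ' (τ - rr)).prod (((0 : (Fin d → ℝ) →L[ℝ] W)).prod (η' (τ - rr)))))

/-- `Z` solves the linearized rough delay equation along `y = y^ξ` in the direction
`(η, η')`, i.e. `Z_t = η_0 + ∫_0^t B(Z_τ, η_{τ-r}) dτ
 + ∫_0^t [σ_x(y_τ, ξ_{τ-r}) Z_τ + σ_y(y_τ, ξ_{τ-r}) η_{τ-r}] dRP_τ` on `[0,r]`,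
`Z = η` on `[-r,0]`, with the Gubinelli derivative given by the integrand. -/
def IsLinSolOn (RP : DelayedRoughPath d r γ) (σ : W × W → (Fin d → ℝ) →L[ℝ] W)
    (B : W × W →ₗ[ℝ] W) (β : ℝ) (ξ ηf : ℝ → W) (ξ' η' : ℝ → (Fin d → ℝ) →L[ℝ] W)
    (y : ℝ → W) (Z : ℝ → W) : Prop :=
  (∀ t ∈ Icc (-r) 0, Z t = ηf t) ∧
    IsControlled β RP.X (Icc 0 r) Z
      (fun τ => if τ < 0 then η' τ else linInt σ r ξ y Z ηf τ) ∧
    ∀ t ∈ Icc 0 r,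
      HasRoughIntegral RP (linInt σ r ξ y Z ηf)
        (zeta0lin σ r ξ y Z ηf (solDeriv σ r ξ' y)
          (fun τ => if τ < 0 then η' τ else linInt σ r ξ y Z ηf τ))
        (zeta1lin σ r ξ y Z ηf ξ' η') 0 t
        (Z t - ηf 0 - ∫ τ in (0:ℝ)..t, B (Z τ, ηf (τ - r)))

/-- `y` solves the frozen-delay equation `y_t = x + ∫_s^t σ(y_τ, ξ_{τ-r}) dRP_τ` on `[s,r]`
with Gubinelli derivative `σ(y_·, ξ_{·-r})`. -/
def IsFrozenSol (RP : DelayedRoughPath d r γ) (σ : W × W → (Fin d → ℝ) →L[ℝ] W) (β : ℝ)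
    (ξ : ℝ → W) (ξ' : ℝ → (Fin d → ℝ) →L[ℝ] W) (s : ℝ) (x : W) (y : ℝ → W) : Prop :=
  y s = x ∧
    IsControlled β RP.X (Icc s r) y (fun τ => σ (y τ, ξ (τ - r))) ∧
    ∀ t ∈ Icc s r,
      HasRoughIntegral RP (fun τ => σ (y τ, ξ (τ - r)))
        (fun τ => (sigmaX σ (y τ, ξ (τ - r))).comp (σ (y τ, ξ (τ - r))))
        (fun τ => (sigmaY σ (y τ, ξ (τ - r))).comp (ξ' (τ - r))) s t (y t - x)

/-- The solution flow `φ̄(s, ·, x)` of the frozen-delay equation. -/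
def frozenFlow (RP : DelayedRoughPath d r γ) (σ : W × W → (Fin d → ℝ) →L[ℝ] W) (β : ℝ)
    (ξ : ℝ → W) (ξ' : ℝ → (Fin d → ℝ) →L[ℝ] W) (s : ℝ) (x : W) : ℝ → W :=
  @dite _ (∃ y : ℝ → W, IsFrozenSol RP σ β ξ ξ' s x y) (Classical.dec _)
    (fun h => h.choose) (fun _ => fun _ => x)

end Equation

end SDDE

namespace SDDE
open Set Filter Topology

section PairBounds

variable {E F U V : Type*} [NormedAddCommGroup E] [NormedSpace ℝ E]
  [NormedAddCommGroup F] [NormedSpace ℝ F]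
  [NormedAddCommGroup U] [NormedSpace ℝ U] [NormedAddCommGroup V] [NormedSpace ℝ V]

/-- Pairwise increment bounds for a delayed controlled path. -/
structure DI (l : ℝ) (xa xb : V) (s t M : ℝ) (m : ℝ → E) (m0 m1 : ℝ → V →L[ℝ] E) : Prop where
  b0s : ‖m0 s‖ ≤ M
  b0t : ‖m0 t‖ ≤ M
  b1s : ‖m1 s‖ ≤ M
  b1t : ‖m1 t‖ ≤ M
  hm : ‖m t - m s‖ ≤ M * l
  h0 : ‖m0 t - m0 s‖ ≤ M * l
  h1 : ‖m1 t - m1 s‖ ≤ M * l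
  rem : ‖m t - m s - m0 s xa - m1 s xb‖ ≤ M * l ^ 2

/-- Pairwise bounds for a delayed controlled path, including its values. -/
structure DC (l : ℝ) (xa xb : V) (s t M : ℝ) (m : ℝ → E) (m0 m1 : ℝ → V →L[ℝ] E) : Prop
    extends DI l xa xb s t M m m0 m1 where
  bs : ‖m s‖ ≤ M
  bt : ‖m t‖ ≤ M

variable {l : ℝ} {xa xb : V} {s t M N : ℝ} {m n : ℝ → E} {m0 m1 n0 n1 : ℝ → V →L[ℝ] E}

theorem DC.nonneg (h : DC l xa xb s t M m m0 m1) : 0 ≤ M := (norm_nonneg _).trans h.bs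

theorem DI.nonneg (h : DI l xa xb s t M m m0 m1) : 0 ≤ M := (norm_nonneg _).trans h.b0s

theorem DI.mono (h : DI l xa xb s t M m m0 m1) (hl : 0 ≤ l) (hMN : M ≤ N) :
    DI l xa xb s t N m m0 m1 where
  b0s := h.b0s.trans hMN
  b0t := h.b0t.trans hMN
  b1s := h.b1s.trans hMN
  b1t := h.b1t.trans hMN
  hm := h.hm.trans (by gcongr)
  h0 := h.h0.trans (by gcongr)
  h1 := h.h1.trans (by gcongr)
  rem := h.rem.trans (by gcongr)

theorem DC.mono (h : DC l xa xb s t M m m0 m1) (hl : 0 ≤ l) (hMN : M ≤ N) :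
    DC l xa xb s t N m m0 m1 where
  toDI := h.toDI.mono hl hMN
  bs := h.bs.trans hMN
  bt := h.bt.trans hMN

theorem DI.congr (h : DI l xa xb s t M m m0 m1) (es : m s = n s) (et : m t = n t)
    (e0s : m0 s = n0 s) (e0t : m0 t = n0 t) (e1s : m1 s = n1 s) (e1t : m1 t = n1 t) :
    DI l xa xb s t M n n0 n1 := by
  obtain ⟨a1, a2, a3, a4, a5, a6, a7, a8⟩ := h
  rw [es, et, e0s, e1s] at a8
  rw [es, et] at a5
  rw [e0s, e0t] at a6
  rw [e1s, e1t] at a7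
  rw [e0s] at a1
  rw [e0t] at a2
  rw [e1s] at a3
  rw [e1t] at a4
  exact ⟨a1, a2, a3, a4, a5, a6, a7, a8⟩

theorem DC.congr (h : DC l xa xb s t M m m0 m1) (es : m s = n s) (et : m t = n t)
    (e0s : m0 s = n0 s) (e0t : m0 t = n0 t) (e1s : m1 s = n1 s) (e1t : m1 t = n1 t) :
    DC l xa xb s t M n n0 n1 :=
  ⟨h.toDI.congr es et e0s e0t e1s e1t, es ▸ h.bs, et ▸ h.bt⟩

theorem DI.add (h : DI l xa xb s t M m m0 m1) (k : DI l xa xb s t N n n0 n1) :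
    DI l xa xb s t (M + N) (fun τ => m τ + n τ) (fun τ => m0 τ + n0 τ)
      (fun τ => m1 τ + n1 τ) where
  b0s := norm_add_le_of_le h.b0s k.b0s
  b0t := norm_add_le_of_le h.b0t k.b0t
  b1s := norm_add_le_of_le h.b1s k.b1s
  b1t := norm_add_le_of_le h.b1t k.b1t
  hm := by
    rw [add_sub_add_comm, add_mul]; exact norm_add_le_of_le h.hm k.hm
  h0 := by
    rw [add_sub_add_comm, add_mul]; exact norm_add_le_of_le h.h0 k.h0
  h1 := by
    rw [add_sub_add_comm, add_mul]; exact norm_add_le_of_le h.h1 k.h1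
  rem := by
    have := norm_add_le_of_le h.rem k.rem
    rw [add_mul]
    refine le_trans (le_of_eq ?_) this
    congr 1
    simp only [_root_.add_apply]
    abel

theorem DC.add (h : DC l xa xb s t M m m0 m1) (k : DC l xa xb s t N n n0 n1) :
    DC l xa xb s t (M + N) (fun τ => m τ + n τ) (fun τ => m0 τ + n0 τ)
      (fun τ => m1 τ + n1 τ) where
  toDI := h.toDI.add k.toDI
  bs := norm_add_le_of_le h.bs k.bs
  bt := norm_add_le_of_le h.bt k.bt

theorem DI.smul (h : DI l xa xb s t M m m0 m1) (c : ℝ) :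
    DI l xa xb s t (|c| * M) (fun τ => c • m τ) (fun τ => c • m0 τ) (fun τ => c • m1 τ) where
  b0s := by rw [norm_smul, Real.norm_eq_abs]; gcongr; exact h.b0s
  b0t := by rw [norm_smul, Real.norm_eq_abs]; gcongr; exact h.b0t
  b1s := by rw [norm_smul, Real.norm_eq_abs]; gcongr; exact h.b1s
  b1t := by rw [norm_smul, Real.norm_eq_abs]; gcongr; exact h.b1t
  hm := by rw [← smul_sub, norm_smul, Real.norm_eq_abs, mul_assoc]; gcongr; exact h.hm
  h0 := by rw [← smul_sub, norm_smul, Real.norm_eq_abs, mul_assoc]; gcongr; exact h.h0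
  h1 := by rw [← smul_sub, norm_smul, Real.norm_eq_abs, mul_assoc]; gcongr; exact h.h1
  rem := by
    simp only [_root_.smul_apply]
    rw [← smul_sub, ← smul_sub, ← smul_sub, norm_smul, Real.norm_eq_abs, mul_assoc]
    gcongr; exact h.rem

theorem DC.smul (h : DC l xa xb s t M m m0 m1) (c : ℝ) :
    DC l xa xb s t (|c| * M) (fun τ => c • m τ) (fun τ => c • m0 τ) (fun τ => c • m1 τ) where
  toDI := h.toDI.smul c
  bs := by rw [norm_smul, Real.norm_eq_abs]; gcongr; exact h.bs
  bt := by rw [norm_smul, Real.norm_eq_abs]; gcongr; exact h.bt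

theorem DC.sub (h : DC l xa xb s t M m m0 m1) (k : DC l xa xb s t N n n0 n1) :
    DC l xa xb s t (M + N) (fun τ => m τ - n τ) (fun τ => m0 τ - n0 τ)
      (fun τ => m1 τ - n1 τ) := by
  have := h.add (k.smul (-1))
  simp only [abs_neg, abs_one, one_mul, neg_smul, one_smul, ← sub_eq_add_neg] at this
  exact this

/-- If the bounds hold along a convergent sequence of constants they hold in the limit. -/
theorem DC.lim {Ms : ℕ → ℝ} (h : ∀ i, DC l xa xb s t (Ms i) m m0 m1)
    (hM : Tendsto Ms atTop (𝓝 M)) : DC l xa xb s t M m m0 m1 where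
  b0s := ge_of_tendsto' hM fun i => (h i).b0s
  b0t := ge_of_tendsto' hM fun i => (h i).b0t
  b1s := ge_of_tendsto' hM fun i => (h i).b1s
  b1t := ge_of_tendsto' hM fun i => (h i).b1t
  hm := ge_of_tendsto' (hM.mul_const _) fun i => (h i).hm
  h0 := ge_of_tendsto' (hM.mul_const _) fun i => (h i).h0
  h1 := ge_of_tendsto' (hM.mul_const _) fun i => (h i).h1
  rem := ge_of_tendsto' (hM.mul_const _) fun i => (h i).rem
  bs := ge_of_tendsto' hM fun i => (h i).bs
  bt := ge_of_tendsto' hM fun i => (h i).bt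

/-- Mean value inequality. -/
theorem mv01 {f f' : ℝ → E} {C : ℝ} (hf : ∀ x, HasDerivAt f (f' x) x)
    (b : ∀ x ∈ Icc (0:ℝ) 1, ‖f' x‖ ≤ C) : ‖f 1 - f 0‖ ≤ C :=
  norm_image_sub_le_of_norm_deriv_le_segment_01' (fun x _ => (hf x).hasDerivWithinAt)
    fun x hx => b x (Ico_subset_Icc_self hx)

/-- Mean value inequality for pairwise bounds. -/
theorem DC.mean {p q : ℝ → ℝ → E} {p0 p1 q0 q1 : ℝ → ℝ → V →L[ℝ] E}
    (hp : ∀ τ x, HasDerivAt (fun x => p x τ) (q x τ) x)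
    (hp0 : ∀ τ x, HasDerivAt (fun x => p0 x τ) (q0 x τ) x)
    (hp1 : ∀ τ x, HasDerivAt (fun x => p1 x τ) (q1 x τ) x)
    (h : ∀ x ∈ Icc (0:ℝ) 1, DC l xa xb s t M (q x) (q0 x) (q1 x)) :
    DC l xa xb s t M (fun τ => p 1 τ - p 0 τ) (fun τ => p0 1 τ - p0 0 τ)
      (fun τ => p1 1 τ - p1 0 τ) where
  bs := mv01 (hp s) fun x hx => (h x hx).bs
  bt := mv01 (hp t) fun x hx => (h x hx).bt
  b0s := mv01 (hp0 s) fun x hx => (h x hx).b0s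
  b0t := mv01 (hp0 t) fun x hx => (h x hx).b0t
  b1s := mv01 (hp1 s) fun x hx => (h x hx).b1s
  b1t := mv01 (hp1 t) fun x hx => (h x hx).b1t
  hm := by
    have := mv01 (f := fun x => p x t - p x s) (fun x => (hp t x).sub (hp s x))
      fun x hx => (h x hx).hm
    rwa [sub_sub_sub_comm] at this
  h0 := by
    have := mv01 (f := fun x => p0 x t - p0 x s) (fun x => (hp0 t x).sub (hp0 s x))
      fun x hx => (h x hx).h0
    rwa [sub_sub_sub_comm] at this
  h1 := by
    have := mv01 (f := fun x => p1 x t - p1 x s) (fun x => (hp1 t x).sub (hp1 s x))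
      fun x hx => (h x hx).h1
    rwa [sub_sub_sub_comm] at this
  rem := by
    have := mv01 (f := fun x => p x t - p x s - p0 x s xa - p1 x s xb)
      (fun x => (((hp t x).sub (hp s x)).sub
        ((hp0 s x).clm_apply (hasDerivAt_const x xa))).sub
        ((hp1 s x).clm_apply (hasDerivAt_const x xb)))
      (C := M * l ^ 2) fun x hx => by simpa using (h x hx).rem
    refine le_trans (le_of_eq ?_) this
    congr 1
    simp only [_root_.sub_apply]
    abel

theorem clm_le {f : E →L[ℝ] F} {x : E} {p q : ℝ} (hf : ‖f‖ ≤ p) (hx : ‖x‖ ≤ q) :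
    ‖f x‖ ≤ p * q := ContinuousLinearMap.le_of_opNorm_le_of_le f hf hx

theorem comp_le {f : E →L[ℝ] F} {g : U →L[ℝ] E} {p q : ℝ} (hf : ‖f‖ ≤ p) (hg : ‖g‖ ≤ q) :
    ‖f.comp g‖ ≤ p * q :=
  (f.opNorm_comp_le g).trans (mul_le_mul hf hg (norm_nonneg _) ((norm_nonneg _).trans hf))

theorem flip_le {f : V →L[ℝ] U →L[ℝ] E} {x : U} {p q : ℝ} (hf : ‖f‖ ≤ p) (hx : ‖x‖ ≤ q) :
    ‖f.flip x‖ ≤ p * q := clm_le (by rwa [ContinuousLinearMap.opNorm_flip]) hx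

/-- Product rule. -/
theorem DC.prodRule {A : ℝ → U →L[ℝ] E} {A0 A1 : ℝ → V →L[ℝ] U →L[ℝ] E} {k : ℝ → U}
    {k0 k1 : ℝ → V →L[ℝ] U} (hl : 0 ≤ l)
    (hA : DC l xa xb s t M A A0 A1) (hk : DC l xa xb s t N k k0 k1) :
    DC l xa xb s t (4 * M * N) (fun τ => A τ (k τ))
      (fun τ => (A0 τ).flip (k τ) + (A τ).comp (k0 τ))
      (fun τ => (A1 τ).flip (k τ) + (A τ).comp (k1 τ)) := by
  have hM := hA.nonneg
  have hN := hk.nonneg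
  have hMN : 0 ≤ M * N := mul_nonneg hM hN
  have key : ∀ {B0 : ℝ → V →L[ℝ] U →L[ℝ] E} {j0 : ℝ → V →L[ℝ] U},
      ‖B0 s‖ ≤ M → ‖B0 t - B0 s‖ ≤ M * l → ‖j0 t‖ ≤ N → ‖j0 t - j0 s‖ ≤ N * l →
      ‖((B0 t).flip (k t) + (A t).comp (j0 t)) - ((B0 s).flip (k s) + (A s).comp (j0 s))‖
        ≤ 4 * M * N * l := by
    intro B0 j0 h1 h2 h3 h4
    have e : ((B0 t).flip (k t) + (A t).comp (j0 t)) - ((B0 s).flip (k s) + (A s).comp (j0 s))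
        = (B0 t - B0 s).flip (k t) + (B0 s).flip (k t - k s) + (A t - A s).comp (j0 t)
          + (A s).comp (j0 t - j0 s) := by
      ext x
      simp
      abel
    rw [e]
    have := norm_add_le_of_le (norm_add_le_of_le (norm_add_le_of_le (flip_le h2 hk.bt)
      (flip_le h1 hk.hm)) (comp_le hA.hm h3)) (comp_le hA.bs h4)
    linarith
  refine ⟨⟨?_, ?_, ?_, ?_, ?_, ?_, ?_, ?_⟩, ?_, ?_⟩
  · have := norm_add_le_of_le (flip_le hA.b0s hk.bs) (comp_le hA.bs hk.b0s)
    linarith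
  · have := norm_add_le_of_le (flip_le hA.b0t hk.bt) (comp_le hA.bt hk.b0t)
    linarith
  · have := norm_add_le_of_le (flip_le hA.b1s hk.bs) (comp_le hA.bs hk.b1s)
    linarith
  · have := norm_add_le_of_le (flip_le hA.b1t hk.bt) (comp_le hA.bt hk.b1t)
    linarith
  · have e : A t (k t) - A s (k s) = (A t - A s) (k t) + A s (k t - k s) := by simp
    show ‖A t (k t) - A s (k s)‖ ≤ _
    rw [e]
    have := norm_add_le_of_le (clm_le hA.hm hk.bt) (clm_le hA.bs hk.hm)
    nlinarith [mul_nonneg hMN hl]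
  · exact key hA.b0s hA.h0 hk.b0t hk.h0
  · exact key hA.b1s hA.h1 hk.b1t hk.h1
  · have e : A t (k t) - A s (k s) - ((A0 s).flip (k s) + (A s).comp (k0 s)) xa
        - ((A1 s).flip (k s) + (A s).comp (k1 s)) xb
        = (A t - A s - A0 s xa - A1 s xb) (k s) + A s (k t - k s - k0 s xa - k1 s xb)
          + (A t - A s) (k t - k s) := by
      simp
      abel
    show ‖A t (k t) - A s (k s) - ((A0 s).flip (k s) + (A s).comp (k0 s)) xa
        - ((A1 s).flip (k s) + (A s).comp (k1 s)) xb‖ ≤ _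
    rw [e]
    have := norm_add_le_of_le (norm_add_le_of_le (clm_le hA.rem hk.bs) (clm_le hA.bs hk.rem))
      (clm_le hA.hm hk.hm)
    nlinarith [mul_nonneg hMN (sq_nonneg l)]
  · have := clm_le hA.bs hk.bs
    show ‖A s (k s)‖ ≤ _
    linarith
  · have := clm_le hA.bt hk.bt
    show ‖A t (k t)‖ ≤ _
    linarith

/-- `G` is twice differentiable with all derivatives bounded by `B`. -/
structure C2b (B : ℝ) (G : U → E) : Prop where
  d1 : Differentiable ℝ G
  d2 : Differentiable ℝ (fderiv ℝ G)
  b0 : ∀ x, ‖G x‖ ≤ B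
  b1 : ∀ x, ‖fderiv ℝ G x‖ ≤ B
  b2 : ∀ x, ‖fderiv ℝ (fderiv ℝ G) x‖ ≤ B

variable {B : ℝ} {G : U → E}

theorem C2b.nonneg (h : C2b B G) : 0 ≤ B := (norm_nonneg _).trans (h.b0 0)

theorem C2b.lip0 (h : C2b B G) (x y : U) : ‖G y - G x‖ ≤ B * ‖y - x‖ :=
  Convex.norm_image_sub_le_of_norm_fderiv_le (𝕜 := ℝ) (fun z _ => h.d1 z) (fun z _ => h.b1 z)
    convex_univ (mem_univ x) (mem_univ y)

theorem C2b.lip1 (h : C2b B G) (x y : U) : ‖fderiv ℝ G y - fderiv ℝ G x‖ ≤ B * ‖y - x‖ :=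
  Convex.norm_image_sub_le_of_norm_fderiv_le (𝕜 := ℝ) (fun z _ => h.d2 z) (fun z _ => h.b2 z)
    convex_univ (mem_univ x) (mem_univ y)

theorem hasDerivAt_line (a x : U) (θ : ℝ) : HasDerivAt (fun θ : ℝ => a + θ • x) x θ := by
  simpa using ((hasDerivAt_id θ).smul_const x).const_add a

theorem hasDerivAt_comp_line {J : U → E} (hJ : Differentiable ℝ J) (a x : U) (θ : ℝ) :
    HasDerivAt (fun θ : ℝ => J (a + θ • x)) (fderiv ℝ J (a + θ • x) x) θ :=
  (hJ (a + θ • x)).hasFDerivAt.comp_hasDerivAt θ (hasDerivAt_line a x θ)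

theorem C2b.taylor (h : C2b B G) (a x : U) :
    ‖G (a + x) - G a - fderiv ℝ G a x‖ ≤ B * ‖x‖ * ‖x‖ := by
  have := mv01 (f := fun θ : ℝ => G (a + θ • x) - θ • fderiv ℝ G a x)
    (f' := fun θ => fderiv ℝ G (a + θ • x) x - fderiv ℝ G a x) (C := B * ‖x‖ * ‖x‖)
    (fun θ => (hasDerivAt_comp_line h.d1 a x θ).sub
      (by simpa using (hasDerivAt_id θ).smul_const (fderiv ℝ G a x)))
    (fun θ hθ => by
      rw [← _root_.sub_apply]
      refine clm_le ((h.lip1 _ _).trans ?_) le_rfl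
      rw [add_sub_cancel_left, norm_smul, Real.norm_eq_abs, abs_of_nonneg hθ.1]
      have := h.nonneg
      gcongr
      exact mul_le_of_le_one_left (norm_nonneg _) hθ.2)
  simp only [one_smul, zero_smul, add_zero, sub_zero] at this
  rwa [sub_right_comm] at this

/-- Composition with a `C²_b` function. -/
theorem DI.compose {u : ℝ → U} {u0 u1 : ℝ → V →L[ℝ] U} (hl : 0 ≤ l) (hG : C2b B G)
    (hu : DI l xa xb s t M u u0 u1) :
    DC l xa xb s t (B * (1 + M) ^ 2) (fun τ => G (u τ))
      (fun τ => (fderiv ℝ G (u τ)).comp (u0 τ)) (fun τ => (fderiv ℝ G (u τ)).comp (u1 τ)) := by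
  have hM := hu.nonneg
  have hB := hG.nonneg
  have hBM := mul_nonneg hB hM
  have hBMM := mul_nonneg hBM hM
  have key : ∀ {j0 : ℝ → V →L[ℝ] U}, ‖j0 t‖ ≤ M → ‖j0 t - j0 s‖ ≤ M * l →
      ‖(fderiv ℝ G (u t)).comp (j0 t) - (fderiv ℝ G (u s)).comp (j0 s)‖
        ≤ B * (1 + M) ^ 2 * l := by
    intro j0 h1 h2
    have e : (fderiv ℝ G (u t)).comp (j0 t) - (fderiv ℝ G (u s)).comp (j0 s)
       = (fderiv ℝ G (u t) - fderiv ℝ G (u s)).comp (j0 t)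
         + (fderiv ℝ G (u s)).comp (j0 t - j0 s) := by
      ext x; simp
    rw [e]
    have := norm_add_le_of_le (comp_le ((hG.lip1 (u s) (u t)).trans
      (mul_le_mul_of_nonneg_left hu.hm hB)) h1) (comp_le (hG.b1 (u s)) h2)
    nlinarith [mul_nonneg hB hl, mul_nonneg hBM hl, mul_nonneg hBMM hl]
  refine ⟨⟨?_, ?_, ?_, ?_, ?_, ?_, ?_, ?_⟩, ?_, ?_⟩
  · have := comp_le (hG.b1 (u s)) hu.b0s
    nlinarith
  · have := comp_le (hG.b1 (u t)) hu.b0t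
    nlinarith
  · have := comp_le (hG.b1 (u s)) hu.b1s
    nlinarith
  · have := comp_le (hG.b1 (u t)) hu.b1t
    nlinarith
  · have := (hG.lip0 (u s) (u t)).trans (mul_le_mul_of_nonneg_left hu.hm hB)
    show ‖G (u t) - G (u s)‖ ≤ _
    nlinarith [mul_nonneg hB hl, mul_nonneg hBM hl, mul_nonneg hBMM hl]
  · exact key hu.b0t hu.h0
  · exact key hu.b1t hu.h1
  · have h2 := hG.taylor (u s) (u t - u s)
    rw [add_sub_cancel] at h2
    have h3 : B * ‖u t - u s‖ * ‖u t - u s‖ ≤ B * (M * l) * (M * l) := by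
      have := hu.hm
      gcongr
    have := norm_add_le_of_le (h2.trans h3) (clm_le (hG.b1 (u s)) hu.rem)
    show ‖G (u t) - G (u s) - (fderiv ℝ G (u s)).comp (u0 s) xa
      - (fderiv ℝ G (u s)).comp (u1 s) xb‖ ≤ _
    have e : G (u t) - G (u s) - (fderiv ℝ G (u s)).comp (u0 s) xa
      - (fderiv ℝ G (u s)).comp (u1 s) xb = G (u t) - G (u s) - fderiv ℝ G (u s) (u t - u s)
        + fderiv ℝ G (u s) (u t - u s - u0 s xa - u1 s xb) := by
      simp only [map_sub, ContinuousLinearMap.comp_apply]; abel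
    rw [e]
    nlinarith [mul_nonneg hB (sq_nonneg l), mul_nonneg hBM (sq_nonneg l),
      mul_nonneg hBMM (sq_nonneg l)]
  · have := hG.b0 (u s)
    show ‖G (u s)‖ ≤ _
    nlinarith
  · have := hG.b0 (u t)
    show ‖G (u t)‖ ≤ _
    nlinarith

end PairBounds
end SDDE

namespace SDDE
open Set Filter Topology

section PairBounds2

variable {E F U V : Type*} [NormedAddCommGroup E] [NormedSpace ℝ E]
  [NormedAddCommGroup F] [NormedSpace ℝ F]
  [NormedAddCommGroup U] [NormedSpace ℝ U] [NormedAddCommGroup V] [NormedSpace ℝ V]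

theorem norm_seg_le {x y : U} {ρ θ : ℝ} (hx : ‖x‖ ≤ ρ) (hy : ‖y‖ ≤ ρ) (hθ : θ ∈ Icc (0:ℝ) 1) :
    ‖x + θ • (y - x)‖ ≤ ρ := by
  have := (convex_closedBall (0:U) ρ).add_smul_sub_mem (mem_closedBall_zero_iff.2 hx)
    (mem_closedBall_zero_iff.2 hy) hθ
  exact mem_closedBall_zero_iff.1 this

/-- Second-order difference estimate. -/
theorem hdiff {J : U → E} (hJ : Differentiable ℝ J) {ω B ρ κ : ℝ}
    (hω : ∀ x y, ‖x‖ ≤ ρ → ‖y‖ ≤ ρ → ‖y - x‖ ≤ κ → ‖fderiv ℝ J y - fderiv ℝ J x‖ ≤ ω)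
    (hB : ∀ x, ‖fderiv ℝ J x‖ ≤ B) {a a' b b' : U} (ha : ‖a‖ ≤ ρ) (ha' : ‖a'‖ ≤ ρ)
    (hab : ‖a + b‖ ≤ ρ) (hab' : ‖a' + b'‖ ≤ ρ) (hb : ‖b‖ ≤ κ) (hb' : ‖b'‖ ≤ κ) :
    ‖(J (a' + b') - J a') - (J (a + b) - J a)‖ ≤ ω * ‖a' - a‖ + B * ‖b' - b‖ := by
  have := mv01 (f := fun θ : ℝ => J (a + b + θ • (a' + b' - (a + b))) - J (a + θ • (a' - a)))
    (C := ω * ‖a' - a‖ + B * ‖b' - b‖)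
    (fun θ => (hasDerivAt_comp_line hJ (a + b) (a' + b' - (a + b)) θ).sub
      (hasDerivAt_comp_line hJ a (a' - a) θ))
    (fun θ hθ => by
      have e : fderiv ℝ J (a + b + θ • (a' + b' - (a + b))) (a' + b' - (a + b))
          - fderiv ℝ J (a + θ • (a' - a)) (a' - a)
          = (fderiv ℝ J (a + b + θ • (a' + b' - (a + b))) - fderiv ℝ J (a + θ • (a' - a))) (a' - a)
            + fderiv ℝ J (a + b + θ • (a' + b' - (a + b))) (b' - b) := by
        rw [show a' + b' - (a + b) = (a' - a) + (b' - b) by abel]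
        rw [_root_.sub_apply, map_add]
        abel
      rw [e]
      refine norm_add_le_of_le (clm_le (hω _ _ (norm_seg_le ha ha' hθ)
        (norm_seg_le hab hab' hθ) ?_) le_rfl) (clm_le (hB _) le_rfl)
      have e2 : a + b + θ • (a' + b' - (a + b)) - (a + θ • (a' - a)) = b + θ • (b' - b) := by
        module
      rw [e2]
      exact norm_seg_le hb hb' hθ)
  simp only [one_smul, zero_smul, add_zero, add_sub_cancel] at this
  rw [sub_sub_sub_comm] at this
  rw [sub_sub_sub_comm]
  convert this using 2

variable {l : ℝ} {xa xb : V} {s t M N : ℝ} {B : ℝ} {G : U → E}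

/-- Continuity of composition. -/
theorem DC.composeDiff {u q : ℝ → U} {u0 u1 q0 q1 : ℝ → V →L[ℝ] U} {ω κ : ℝ} (hl : 0 ≤ l)
    (hG : C2b B G)
    (hω : ∀ x y, ‖x‖ ≤ M + κ → ‖y‖ ≤ M + κ → ‖y - x‖ ≤ κ →
      ‖fderiv ℝ (fderiv ℝ G) y - fderiv ℝ (fderiv ℝ G) x‖ ≤ ω) (hω0 : 0 ≤ ω)
    (hu : DC l xa xb s t M u u0 u1) (hq : DC l xa xb s t κ q q0 q1) :
    DC l xa xb s t (4 * (ω + B * κ) * (1 + M + κ) ^ 2) (fun τ => G (u τ + q τ) - G (u τ))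
      (fun τ => (fderiv ℝ G (u τ + q τ)).comp (u0 τ + q0 τ) - (fderiv ℝ G (u τ)).comp (u0 τ))
      (fun τ => (fderiv ℝ G (u τ + q τ)).comp (u1 τ + q1 τ)
        - (fderiv ℝ G (u τ)).comp (u1 τ)) := by
  have hM := hu.nonneg
  have hκ := hq.nonneg
  have hB := hG.nonneg
  have hBκ := mul_nonneg hB hκ
  set Ω := ω + B * κ with hΩ
  have hΩ0 : 0 ≤ Ω := by positivity
  have hωΩ : ω ≤ Ω := by linarith
  have hBΩ : B * κ ≤ Ω := by linarith
  have hD : ∀ τ, ‖q τ‖ ≤ κ → ‖fderiv ℝ G (u τ + q τ) - fderiv ℝ G (u τ)‖ ≤ B * κ := by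
    intro τ h
    refine (hG.lip1 _ _).trans ?_
    rw [add_sub_cancel_left]
    gcongr
  have hus : ‖u s‖ ≤ M + κ := hu.bs.trans (by linarith)
  have hut : ‖u t‖ ≤ M + κ := hu.bt.trans (by linarith)
  have huqs : ‖u s + q s‖ ≤ M + κ := norm_add_le_of_le hu.bs hq.bs
  have huqt : ‖u t + q t‖ ≤ M + κ := norm_add_le_of_le hu.bt hq.bt
  have key : ∀ {j0 i0 : ℝ → V →L[ℝ] U}, ‖j0 t‖ ≤ M → ‖j0 t - j0 s‖ ≤ M * l → ‖i0 t‖ ≤ κ →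
      ‖i0 t - i0 s‖ ≤ κ * l →
      ‖((fderiv ℝ G (u t + q t)).comp (j0 t + i0 t) - (fderiv ℝ G (u t)).comp (j0 t))
        - ((fderiv ℝ G (u s + q s)).comp (j0 s + i0 s) - (fderiv ℝ G (u s)).comp (j0 s))‖
        ≤ 4 * Ω * (1 + M + κ) ^ 2 * l := by
    intro j0 i0 h1 h2 h3 h4
    have e : ((fderiv ℝ G (u t + q t)).comp (j0 t + i0 t) - (fderiv ℝ G (u t)).comp (j0 t))
        - ((fderiv ℝ G (u s + q s)).comp (j0 s + i0 s) - (fderiv ℝ G (u s)).comp (j0 s))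
       = ((fderiv ℝ G (u t + q t) - fderiv ℝ G (u t))
          - (fderiv ℝ G (u s + q s) - fderiv ℝ G (u s))).comp (j0 t)
         + (fderiv ℝ G (u s + q s) - fderiv ℝ G (u s)).comp (j0 t - j0 s)
         + (fderiv ℝ G (u t + q t) - fderiv ℝ G (u s + q s)).comp (i0 t)
         + (fderiv ℝ G (u s + q s)).comp (i0 t - i0 s) := by
      ext x; simp; abel
    rw [e]
    have a1 : ‖(fderiv ℝ G (u t + q t) - fderiv ℝ G (u t))
          - (fderiv ℝ G (u s + q s) - fderiv ℝ G (u s))‖ ≤ ω * (M * l) + B * (κ * l) := by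
      refine (hdiff hG.d2 hω hG.b2 hus hut huqs huqt hq.bs hq.bt).trans ?_
      have := hu.hm
      have := hq.hm
      gcongr
    have a2 : ‖fderiv ℝ G (u t + q t) - fderiv ℝ G (u s + q s)‖ ≤ B * (M * l + κ * l) := by
      refine (hG.lip1 _ _).trans ?_
      gcongr
      rw [add_sub_add_comm]
      exact norm_add_le_of_le hu.hm hq.hm
    have := norm_add_le_of_le (norm_add_le_of_le (norm_add_le_of_le (comp_le a1 h1)
      (comp_le (hD s hq.bs) h2)) (comp_le a2 h3)) (comp_le (hG.b1 (u s + q s)) h4)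
    refine this.trans ?_
    have e2 : (ω * (M * l) + B * (κ * l)) * M + B * κ * (M * l) + B * (M * l + κ * l) * κ
      + B * (κ * l) = (ω * M ^ 2 + B * κ * (3 * M + κ + 1)) * l := by ring
    rw [e2]
    refine mul_le_mul_of_nonneg_right ?_ hl
    nlinarith [mul_nonneg hM hκ, mul_nonneg hΩ0 hM, mul_nonneg hΩ0 hκ,
      mul_nonneg hΩ0 (mul_nonneg hM hκ), mul_nonneg hΩ0 (sq_nonneg M),
      mul_nonneg hΩ0 (sq_nonneg κ), mul_le_mul_of_nonneg_right hωΩ (sq_nonneg M),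
      mul_le_mul_of_nonneg_right hBΩ (by positivity : 0 ≤ 3 * M + κ + 1)]
  have big : ∀ x : ℝ, x ≤ B * κ * (1 + M) → x ≤ 4 * Ω * (1 + M + κ) ^ 2 := by
    intro x hx
    nlinarith [mul_nonneg hM hκ, mul_nonneg hΩ0 hM, mul_nonneg hΩ0 hκ,
      mul_nonneg hΩ0 (mul_nonneg hM hκ), mul_nonneg hΩ0 (sq_nonneg M),
      mul_nonneg hΩ0 (sq_nonneg κ), mul_le_mul_of_nonneg_right hBΩ (by positivity : 0 ≤ 1 + M)]
  have b0 : ∀ {τ} {j0 i0 : V →L[ℝ] U}, ‖q τ‖ ≤ κ → ‖j0‖ ≤ M → ‖i0‖ ≤ κ →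
      ‖(fderiv ℝ G (u τ + q τ)).comp (j0 + i0) - (fderiv ℝ G (u τ)).comp j0‖ ≤
        4 * Ω * (1 + M + κ) ^ 2 := by
    intro τ j0 i0 h1 h2 h3
    apply big
    have e : (fderiv ℝ G (u τ + q τ)).comp (j0 + i0) - (fderiv ℝ G (u τ)).comp j0
      = (fderiv ℝ G (u τ + q τ) - fderiv ℝ G (u τ)).comp j0 + (fderiv ℝ G (u τ + q τ)).comp i0 := by
      ext x; simp; abel
    rw [e]
    have := norm_add_le_of_le (comp_le (hD τ h1) h2) (comp_le (hG.b1 (u τ + q τ)) h3)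
    linarith
  have bb : ∀ {τ}, ‖q τ‖ ≤ κ → ‖G (u τ + q τ) - G (u τ)‖ ≤ 4 * Ω * (1 + M + κ) ^ 2 := by
    intro τ h
    apply big
    have := hG.lip0 (u τ) (u τ + q τ)
    rw [add_sub_cancel_left] at this
    nlinarith [mul_le_mul_of_nonneg_left h hB, mul_nonneg hBκ hM]
  refine ⟨⟨b0 hq.bs hu.b0s hq.b0s, b0 hq.bt hu.b0t hq.b0t, b0 hq.bs hu.b1s hq.b1s,
    b0 hq.bt hu.b1t hq.b1t, ?_, key hu.b0t hu.h0 hq.b0t hq.h0, key hu.b1t hu.h1 hq.b1t hq.h1,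
    ?_⟩, bb hq.bs, bb hq.bt⟩
  · have a1 := hdiff hG.d1 (ω := B * κ) (fun x y _ _ h => (hG.lip1 x y).trans
      (mul_le_mul_of_nonneg_left h hB)) hG.b1 hus hut huqs huqt hq.bs hq.bt
    refine a1.trans ?_
    have h1 := mul_le_mul_of_nonneg_left hu.hm hBκ
    have h2 := mul_le_mul_of_nonneg_left hq.hm hB
    have := mul_le_mul_of_nonneg_right (big (B * κ * (1 + M)) le_rfl) hl
    linarith
  · show ‖(G (u t + q t) - G (u t)) - (G (u s + q s) - G (u s))
      - ((fderiv ℝ G (u s + q s)).comp (u0 s + q0 s) - (fderiv ℝ G (u s)).comp (u0 s)) xa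
      - ((fderiv ℝ G (u s + q s)).comp (u1 s + q1 s) - (fderiv ℝ G (u s)).comp (u1 s)) xb‖ ≤ _
    set x := u t - u s with hx
    set k := q t - q s with hk
    have hut' : u t = u s + x := by rw [hx]; abel
    have hqt' : q t = q s + k := by rw [hk]; abel
    have hxM : ‖x‖ ≤ M * l := hu.hm
    have hkM : ‖k‖ ≤ κ * l := hq.hm
    have T := mv01 (f := fun θ : ℝ => (G ((u s + q s) + θ • (x + k)) - G (u s + θ • x))
        - θ • (fderiv ℝ G (u s + q s) (x + k) - fderiv ℝ G (u s) x))
      (C := (ω * (M * l) + B * (κ * l)) * (M * l + κ * l) + B * (M * l) * (κ * l))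
      (fun θ => ((hasDerivAt_comp_line hG.d1 (u s + q s) (x + k) θ).sub
        (hasDerivAt_comp_line hG.d1 (u s) x θ)).sub
        ((hasDerivAt_id θ).smul_const (fderiv ℝ G (u s + q s) (x + k) - fderiv ℝ G (u s) x)))
      (fun θ hθ => by
        have e : fderiv ℝ G ((u s + q s) + θ • (x + k)) (x + k) - fderiv ℝ G (u s + θ • x) x
            - (1:ℝ) • (fderiv ℝ G (u s + q s) (x + k) - fderiv ℝ G (u s) x)
            = ((fderiv ℝ G ((u s + θ • x) + (q s + θ • k)) - fderiv ℝ G (u s + θ • x))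
                - (fderiv ℝ G (u s + q s) - fderiv ℝ G (u s))) (x + k)
              + (fderiv ℝ G (u s + θ • x) - fderiv ℝ G (u s)) k := by
          rw [show (u s + q s) + θ • (x + k) = (u s + θ • x) + (q s + θ • k) by module]
          simp only [_root_.sub_apply, map_add, one_smul]
          abel
        rw [e]
        have n1 : ‖u s + θ • x‖ ≤ M := norm_seg_le hu.bs hu.bt hθ
        have n2 : ‖q s + θ • k‖ ≤ κ := norm_seg_le hq.bs hq.bt hθ
        have hθa : |θ| ≤ 1 := by rw [abs_of_nonneg hθ.1]; exact hθ.2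
        have n3 : ‖θ • x‖ ≤ M * l := by
          rw [norm_smul, Real.norm_eq_abs]
          exact (mul_le_of_le_one_left (norm_nonneg _) hθa).trans hxM
        have n4 : ‖θ • k‖ ≤ κ * l := by
          rw [norm_smul, Real.norm_eq_abs]
          exact (mul_le_of_le_one_left (norm_nonneg _) hθa).trans hkM
        refine norm_add_le_of_le (clm_le ?_ (norm_add_le_of_le hxM hkM)) (clm_le ?_ hkM)
        · refine (hdiff hG.d2 hω hG.b2 hus (n1.trans (by linarith)) huqs
            (norm_add_le_of_le n1 n2) hq.bs n2).trans ?_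
          rw [add_sub_cancel_left, add_sub_cancel_left]
          gcongr
        · refine (hG.lip1 _ _).trans ?_
          rw [add_sub_cancel_left]
          gcongr)
    simp only [one_smul, zero_smul, add_zero, sub_zero] at T
    have e : (G (u t + q t) - G (u t)) - (G (u s + q s) - G (u s))
      - ((fderiv ℝ G (u s + q s)).comp (u0 s + q0 s) - (fderiv ℝ G (u s)).comp (u0 s)) xa
      - ((fderiv ℝ G (u s + q s)).comp (u1 s + q1 s) - (fderiv ℝ G (u s)).comp (u1 s)) xb
      = ((G ((u s + q s) + (x + k)) - G (u s + x)
        - (fderiv ℝ G (u s + q s) (x + k) - fderiv ℝ G (u s) x)) - (G (u s + q s) - G (u s)))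
        + ((fderiv ℝ G (u s + q s) - fderiv ℝ G (u s)) (x - u0 s xa - u1 s xb)
        + fderiv ℝ G (u s + q s) (k - q0 s xa - q1 s xb)) := by
      rw [hut', hqt', show u s + x + (q s + k) = u s + q s + (x + k) by abel]
      simp only [_root_.sub_apply, _root_.add_apply, map_add, map_sub,
        ContinuousLinearMap.comp_apply]
      abel
    rw [e]
    have := norm_add_le_of_le T (norm_add_le_of_le (clm_le (hD s hq.bs) hu.rem)
      (clm_le (hG.b1 (u s + q s)) hq.rem))
    refine this.trans ?_
    have e2 : (ω * (M * l) + B * (κ * l)) * (M * l + κ * l) + B * (M * l) * (κ * l)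
      + (B * κ * (M * l ^ 2) + B * (κ * l ^ 2))
      = (ω * (M * (M + κ)) + B * κ * (3 * M + κ + 1)) * l ^ 2 := by ring
    rw [e2]
    refine mul_le_mul_of_nonneg_right ?_ (sq_nonneg l)
    nlinarith [mul_nonneg hM hκ, mul_nonneg hΩ0 hM, mul_nonneg hΩ0 hκ,
      mul_nonneg hΩ0 (mul_nonneg hM hκ), mul_nonneg hΩ0 (sq_nonneg M),
      mul_nonneg hΩ0 (sq_nonneg κ),
      mul_le_mul_of_nonneg_right hωΩ (by positivity : 0 ≤ M * (M + κ)),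
      mul_le_mul_of_nonneg_right hBΩ (by positivity : 0 ≤ 3 * M + κ + 1)]

end PairBounds2
end SDDE

namespace SDDE
open Set Filter Topology
set_option maxSynthPendingDepth 3

section Nemytskii

variable {E F U V : Type*} [NormedAddCommGroup E] [NormedSpace ℝ E]
  [NormedAddCommGroup F] [NormedSpace ℝ F]
  [NormedAddCommGroup U] [NormedSpace ℝ U] [NormedAddCommGroup V] [NormedSpace ℝ V]

/-- Gubinelli derivative of a composition. -/
def c0 (σ : U → E) (u : ℝ → U) (u0 : ℝ → V →L[ℝ] U) : ℝ → V →L[ℝ] E :=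
  fun τ => (fderiv ℝ σ (u τ)).comp (u0 τ)

/-- Linearized composition. -/
def lm (σ : U → E) (u k : ℝ → U) : ℝ → E := fun τ => fderiv ℝ σ (u τ) (k τ)

/-- Gubinelli derivative of the linearized composition. -/
def l0 (σ : U → E) (u : ℝ → U) (u0 : ℝ → V →L[ℝ] U) (k : ℝ → U) (k0 : ℝ → V →L[ℝ] U) :
    ℝ → V →L[ℝ] E :=
  fun τ => ((fderiv ℝ (fderiv ℝ σ) (u τ)).comp (u0 τ)).flip (k τ) + (fderiv ℝ σ (u τ)).comp (k0 τ)

/-- Three bounded derivatives. -/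
structure C3b (B : ℝ) (σ : U → E) : Prop where
  g : C2b B σ
  dg : C2b B (fderiv ℝ σ)
  symm : ∀ x v w, fderiv ℝ (fderiv ℝ σ) x v w = fderiv ℝ (fderiv ℝ σ) x w v
  cont : Continuous (fderiv ℝ (fderiv ℝ (fderiv ℝ σ)))

variable {B : ℝ} {σ : U → E} {l : ℝ} {xa xb : V} {s t M N : ℝ}
  {u v k : ℝ → U} {u0 u1 v0 v1 k0 k1 : ℝ → V →L[ℝ] U}

theorem C3b.lin (hσ : C3b B σ) (hl : 0 ≤ l) (hu : DI l xa xb s t M u u0 u1)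
    (hk : DC l xa xb s t N k k0 k1) :
    DC l xa xb s t (4 * (B * (1 + M) ^ 2) * N) (lm σ u k) (l0 σ u u0 k k0) (l0 σ u u1 k k1) :=
  DC.prodRule hl (hu.compose hl hσ.dg) hk

theorem C3b.deriv0 (hσ : C3b B σ) (a k : U) (x : ℝ) :
    HasDerivAt (fun x : ℝ => σ (a + x • k)) (fderiv ℝ σ (a + x • k) k) x :=
  hasDerivAt_comp_line hσ.g.d1 a k x

theorem C3b.deriv1 (hσ : C3b B σ) (a k : U) (a0 k0 : V →L[ℝ] U) (x : ℝ) :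
    HasDerivAt (fun x : ℝ => (fderiv ℝ σ (a + x • k)).comp (a0 + x • k0))
      (((fderiv ℝ (fderiv ℝ σ) (a + x • k)).comp (a0 + x • k0)).flip k
        + (fderiv ℝ σ (a + x • k)).comp k0) x := by
  have h := (hasDerivAt_comp_line hσ.g.d2 a k x).clm_comp (hasDerivAt_line a0 k0 x)
  convert h using 1
  congr 1
  ext y
  simp only [ContinuousLinearMap.flip_apply, ContinuousLinearMap.comp_apply]
  rw [hσ.symm]

/-- Lipschitz estimate for composition. -/
theorem C3b.lipschitz (hσ : C3b B σ) (hl : 0 ≤ l) (hu : DI l xa xb s t M u u0 u1)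
    (hv : DI l xa xb s t M v v0 v1)
    (hk : DC l xa xb s t N (fun τ => v τ - u τ) (fun τ => v0 τ - u0 τ) (fun τ => v1 τ - u1 τ)) :
    DC l xa xb s t (4 * (B * (1 + M) ^ 2) * N) (fun τ => σ (v τ) - σ (u τ))
      (fun τ => c0 σ v v0 τ - c0 σ u u0 τ) (fun τ => c0 σ v v1 τ - c0 σ u u1 τ) := by
  have hx : ∀ x ∈ Icc (0:ℝ) 1, DI l xa xb s t M (fun τ => u τ + x • (v τ - u τ))
      (fun τ => u0 τ + x • (v0 τ - u0 τ)) (fun τ => u1 τ + x • (v1 τ - u1 τ)) := by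
    intro x hx
    have h := ((hu.smul (1 - x)).add (hv.smul x)).mono hl (N := M) (by
      rw [abs_of_nonneg hx.1, abs_of_nonneg (sub_nonneg.2 hx.2)]; linarith)
    refine h.congr ?_ ?_ ?_ ?_ ?_ ?_ <;> module
  have := DC.mean (l := l) (xa := xa) (xb := xb) (s := s) (t := t)
    (p := fun x τ => σ (u τ + x • (v τ - u τ)))
    (p0 := fun x τ => (fderiv ℝ σ (u τ + x • (v τ - u τ))).comp (u0 τ + x • (v0 τ - u0 τ)))
    (p1 := fun x τ => (fderiv ℝ σ (u τ + x • (v τ - u τ))).comp (u1 τ + x • (v1 τ - u1 τ)))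
    (fun τ x => hσ.deriv0 _ _ x) (fun τ x => hσ.deriv1 _ _ _ _ x)
    (fun τ x => hσ.deriv1 _ _ _ _ x) (fun x hx' => hσ.lin hl (hx x hx') hk)
  simp only [one_smul, zero_smul, add_zero, add_sub_cancel] at this
  exact this

/-- Differentiability of composition. -/
theorem C3b.remainder [ProperSpace U] (hσ : C3b B σ) (M ε : ℝ) (hε : 0 < ε) :
    ∃ κ0 > 0, ∀ (l : ℝ) (xa xb : V) (s t N : ℝ) (u k : ℝ → U) (u0 u1 k0 k1 : ℝ → V →L[ℝ] U),
      0 ≤ l → N ≤ κ0 → DC l xa xb s t M u u0 u1 → DC l xa xb s t N k k0 k1 →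
      DC l xa xb s t (ε * N) (fun τ => σ (u τ + k τ) - σ (u τ) - lm σ u k τ)
        (fun τ => c0 σ (fun τ => u τ + k τ) (fun τ => u0 τ + k0 τ) τ - c0 σ u u0 τ
          - l0 σ u u0 k k0 τ)
        (fun τ => c0 σ (fun τ => u τ + k τ) (fun τ => u1 τ + k1 τ) τ - c0 σ u u1 τ
          - l0 σ u u1 k k1 τ) := by
  have hB := hσ.g.nonneg
  by_cases hM : 0 ≤ M
  swap
  · exact ⟨1, one_pos, fun l xa xb s t N u k u0 u1 k0 k1 _ _ hu _ => absurd hu.nonneg hM⟩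
  set ω : ℝ := ε / (32 * (2 + M) ^ 2) with hωd
  have hω0 : 0 < ω := by positivity
  have huc := (isCompact_closedBall (0 : U) (M + 1)).uniformContinuousOn_of_continuous
    hσ.cont.continuousOn
  rw [Metric.uniformContinuousOn_iff_le] at huc
  obtain ⟨δ, hδ, hδ'⟩ := huc ω hω0
  refine ⟨min (min δ 1) (ω / (B + 1)), by positivity, ?_⟩
  intro l xa xb s t N u k u0 u1 k0 k1 hl hN hu hk
  have hN0 := hk.nonneg
  have hN1 : N ≤ 1 := hN.trans ((min_le_left _ _).trans (min_le_right _ _))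
  have hNδ : N ≤ δ := hN.trans ((min_le_left _ _).trans (min_le_left _ _))
  have hNω : B * N ≤ ω := by
    have : N ≤ ω / (B + 1) := hN.trans (min_le_right _ _)
    rw [le_div_iff₀ (by positivity)] at this
    nlinarith
  have hω : ∀ x y : U, ‖x‖ ≤ M + N → ‖y‖ ≤ M + N → ‖y - x‖ ≤ N →
      ‖fderiv ℝ (fderiv ℝ (fderiv ℝ σ)) y - fderiv ℝ (fderiv ℝ (fderiv ℝ σ)) x‖ ≤ ω := by
    intro x y hx hy hxy
    rw [← dist_eq_norm]
    refine hδ' y ?_ x ?_ ?_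
    · rw [mem_closedBall_zero_iff]; linarith
    · rw [mem_closedBall_zero_iff]; linarith
    · rw [dist_eq_norm]; linarith
  have hA : ∀ x ∈ Icc (0:ℝ) 1, DC l xa xb s t (ε / 4)
      (fun τ => fderiv ℝ σ (u τ + x • k τ) - fderiv ℝ σ (u τ))
      (fun τ => (fderiv ℝ (fderiv ℝ σ) (u τ + x • k τ)).comp (u0 τ + x • k0 τ)
        - (fderiv ℝ (fderiv ℝ σ) (u τ)).comp (u0 τ))
      (fun τ => (fderiv ℝ (fderiv ℝ σ) (u τ + x • k τ)).comp (u1 τ + x • k1 τ)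
        - (fderiv ℝ (fderiv ℝ σ) (u τ)).comp (u1 τ)) := by
    intro x hx
    have hxk := (hk.smul x).mono hl (N := N) (by
      rw [abs_of_nonneg hx.1]; exact mul_le_of_le_one_left hN0 hx.2)
    refine (DC.composeDiff hl hσ.dg hω hω0.le hu hxk).mono hl ?_
    calc 4 * (ω + B * N) * (1 + M + N) ^ 2 ≤ 4 * (ω + ω) * (1 + M + 1) ^ 2 := by gcongr
      _ = ε / 4 := by
        rw [hωd]
        have : (2 + M) ≠ 0 := by positivity
        field_simp
        ring
  have := DC.mean (l := l) (xa := xa) (xb := xb) (s := s) (t := t) (M := ε * N)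
    (p := fun x τ => σ (u τ + x • k τ) - x • lm σ u k τ)
    (p0 := fun x τ => (fderiv ℝ σ (u τ + x • k τ)).comp (u0 τ + x • k0 τ) - x • l0 σ u u0 k k0 τ)
    (p1 := fun x τ => (fderiv ℝ σ (u τ + x • k τ)).comp (u1 τ + x • k1 τ) - x • l0 σ u u1 k k1 τ)
    (fun τ x => (hσ.deriv0 _ _ x).sub ((hasDerivAt_id x).smul_const _))
    (fun τ x => (hσ.deriv1 _ _ _ _ x).sub ((hasDerivAt_id x).smul_const _))
    (fun τ x => (hσ.deriv1 _ _ _ _ x).sub ((hasDerivAt_id x).smul_const _))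
    (fun x hx => by
      have h := (DC.prodRule hl (hA x hx) hk).mono hl (N := ε * N) (by linarith)
      refine h.congr ?_ ?_ ?_ ?_ ?_ ?_
      · simp [lm]
      · simp [lm]
      all_goals
        ext y
        simp [l0]
        abel)
  simp only [one_smul, zero_smul, add_zero, sub_zero] at this
  refine this.congr ?_ ?_ ?_ ?_ ?_ ?_
  all_goals
    try simp only [c0]
    abel

/-- From the frozen notion of `C³_b`. -/
theorem CnBounded.c3b {σ : U → E} (h : CnBounded 3 σ) : ∃ B, 1 ≤ B ∧ C3b B σ := by
  obtain ⟨hc, hb⟩ := h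
  obtain ⟨B0, h0⟩ := hb 0 (by norm_num)
  obtain ⟨B1, h1⟩ := hb 1 (by norm_num)
  obtain ⟨B2, h2⟩ := hb 2 (by norm_num)
  obtain ⟨B3, h3⟩ := hb 3 (by norm_num)
  have hc1 : ContDiff ℝ 2 (fderiv ℝ σ) := hc.fderiv_right (by norm_num)
  have hc2 : ContDiff ℝ 1 (fderiv ℝ (fderiv ℝ σ)) := hc1.fderiv_right (by norm_num)
  have hc3 : ContDiff ℝ 0 (fderiv ℝ (fderiv ℝ (fderiv ℝ σ))) := hc2.fderiv_right (by norm_num)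
  set B := 1 + |B0| + |B1| + |B2| + |B3| with hB
  have l0 := le_abs_self B0
  have l1 := le_abs_self B1
  have l2 := le_abs_self B2
  have l3 := le_abs_self B3
  have p0 := abs_nonneg B0
  have p1 := abs_nonneg B1
  have p2 := abs_nonneg B2
  have p3 := abs_nonneg B3
  have e1 : ∀ x, ‖fderiv ℝ σ x‖ ≤ B := fun x => by
    have := h1 x
    rw [← norm_iteratedFDeriv_fderiv, norm_iteratedFDeriv_zero] at this
    linarith
  have e2 : ∀ x, ‖fderiv ℝ (fderiv ℝ σ) x‖ ≤ B := fun x => by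
    have := h2 x
    rw [← norm_iteratedFDeriv_fderiv, ← norm_iteratedFDeriv_fderiv,
      norm_iteratedFDeriv_zero] at this
    linarith
  have e3 : ∀ x, ‖fderiv ℝ (fderiv ℝ (fderiv ℝ σ)) x‖ ≤ B := fun x => by
    have := h3 x
    rw [← norm_iteratedFDeriv_fderiv, ← norm_iteratedFDeriv_fderiv,
      ← norm_iteratedFDeriv_fderiv, norm_iteratedFDeriv_zero] at this
    linarith
  refine ⟨B, by linarith, ⟨hc.differentiable (by norm_num), hc1.differentiable (by norm_num),
    fun x => ?_, e1, e2⟩, ⟨hc1.differentiable (by norm_num), hc2.differentiable (by norm_num),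
    e1, e2, e3⟩, fun x v w => ?_, hc3.continuous⟩
  · have := h0 x
    rw [norm_iteratedFDeriv_zero] at this
    linarith
  · have : IsSymmSndFDerivAt ℝ σ x := hc.contDiffAt.isSymmSndFDerivAt (by simp; norm_num)
    exact this v w

end Nemytskii
end SDDE

namespace SDDE
open Set Filter Topology
set_option maxSynthPendingDepth 3

section Rough

variable {d : ℕ} {r γ β : ℝ} {E : Type*} [NormedAddCommGroup E] [NormedSpace ℝ E]

theorem apply2_sub (a b : (Fin d → ℝ) →L[ℝ] ((Fin d → ℝ) →L[ℝ] E)) (M : Fin d → Fin d → ℝ) :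
    apply2 (a - b) M = apply2 a M - apply2 b M := by
  simp [apply2, smul_sub, Finset.sum_sub_distrib]

theorem apply2_add_left (a b : (Fin d → ℝ) →L[ℝ] ((Fin d → ℝ) →L[ℝ] E)) (M : Fin d → Fin d → ℝ) :
    apply2 (a + b) M = apply2 a M + apply2 b M := by
  simp [apply2, smul_add, Finset.sum_add_distrib]

theorem apply2_smul_left (c : ℝ) (b : (Fin d → ℝ) →L[ℝ] ((Fin d → ℝ) →L[ℝ] E))
    (M : Fin d → Fin d → ℝ) :
    apply2 (c • b) M = c • apply2 b M := by
  simp only [apply2, Finset.smul_sum, _root_.smul_apply]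
  refine Finset.sum_congr rfl fun i _ => Finset.sum_congr rfl fun j _ => ?_
  rw [smul_comm]

theorem apply2_add (a : (Fin d → ℝ) →L[ℝ] ((Fin d → ℝ) →L[ℝ] E)) (M N : Fin d → Fin d → ℝ) :
    apply2 a (M + N) = apply2 a M + apply2 a N := by
  simp [apply2, add_smul, Finset.sum_add_distrib]

theorem apply2_tensor (a : (Fin d → ℝ) →L[ℝ] ((Fin d → ℝ) →L[ℝ] E)) (x y : Fin d → ℝ) :
    apply2 a (fun i j => x i * y j) = a x y := by
  have hx : x = ∑ i, x i • (Pi.single i 1 : Fin d → ℝ) := by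
    ext j; simp [Finset.sum_apply, Pi.single_apply]
  have hy : y = ∑ i, y i • (Pi.single i 1 : Fin d → ℝ) := by
    ext j; simp [Finset.sum_apply, Pi.single_apply]
  conv_rhs => rw [hx, hy]
  simp only [map_sum, map_smul, apply2, _root_.sum_apply, _root_.smul_apply,
    Finset.smul_sum, smul_smul]
  rw [Finset.sum_comm]
  refine Finset.sum_congr rfl fun i _ => Finset.sum_congr rfl fun j _ => ?_
  rw [mul_comm]

theorem apply2_le (a : (Fin d → ℝ) →L[ℝ] ((Fin d → ℝ) →L[ℝ] E)) (M : Fin d → Fin d → ℝ) :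
    ‖apply2 a M‖ ≤ d ^ 2 * (‖a‖ * ‖M‖) := by
  have h1 : ∀ i : Fin d, ‖(Pi.single i 1 : Fin d → ℝ)‖ ≤ 1 := by
    intro i
    rw [pi_norm_le_iff_of_nonneg zero_le_one]
    intro j
    by_cases h : j = i
    · subst h; simp
    · simp [Pi.single_apply, h]
  have h2 : ∀ i j : Fin d, ‖M i j • a (Pi.single i 1) (Pi.single j 1)‖ ≤ ‖a‖ * ‖M‖ := by
    intro i j
    rw [norm_smul, mul_comm]
    have e1 : ‖M i j‖ ≤ ‖M‖ := (norm_le_pi_norm (M i) j).trans (norm_le_pi_norm M i)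
    have e2 : ‖a (Pi.single i 1) (Pi.single j 1)‖ ≤ ‖a‖ * 1 * 1 :=
      (a.le_opNorm₂ _ _).trans (by gcongr <;> apply h1)
    calc _ ≤ ‖a‖ * 1 * 1 * ‖M‖ := by gcongr
      _ = _ := by ring
  calc ‖apply2 a M‖ ≤ ∑ i : Fin d, ∑ j : Fin d, ‖a‖ * ‖M‖ :=
        norm_sum_le_of_le _ fun i _ => norm_sum_le_of_le _ fun j _ => h2 i j
    _ = _ := by simp; ring

variable (RP : DelayedRoughPath d r γ)

theorem XX_self (t : ℝ) : RP.XX t t = 0 := by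
  have := RP.chen t t t
  have h : (fun i j => (RP.X t i - RP.X t i) * (RP.X t j - RP.X t j) : Fin d → Fin d → ℝ) = 0 := by
    ext; simp
  rw [h, add_zero] at this
  simpa using this

theorem XXd_self (t : ℝ) : RP.XXd t t = 0 := by
  have := RP.chend t t t
  have h : (fun i j => (RP.X (t - r) i - RP.X (t - r) i) * (RP.X t j - RP.X t j) :
      Fin d → Fin d → ℝ) = 0 := by
    ext; simp
  rw [h, add_zero] at this
  simpa using this

/-- The compensated increment. -/
def Xi (V : ℝ → (Fin d → ℝ) →L[ℝ] E) (z0 z1 : ℝ → (Fin d → ℝ) →L[ℝ] ((Fin d → ℝ) →L[ℝ] E))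
    (s t : ℝ) : E :=
  V s (RP.X t - RP.X s) + apply2 (z0 s) (RP.XX s t) + apply2 (z1 s) (RP.XXd s t)

theorem Xi_self (V : ℝ → (Fin d → ℝ) →L[ℝ] E)
    (z0 z1 : ℝ → (Fin d → ℝ) →L[ℝ] ((Fin d → ℝ) →L[ℝ] E)) (t : ℝ) : Xi RP V z0 z1 t t = 0 := by
  simp [Xi, XX_self, XXd_self, apply2]

theorem Xi_delta (V : ℝ → (Fin d → ℝ) →L[ℝ] E)
    (z0 z1 : ℝ → (Fin d → ℝ) →L[ℝ] ((Fin d → ℝ) →L[ℝ] E)) (s u t : ℝ) :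
    Xi RP V z0 z1 s t - Xi RP V z0 z1 s u - Xi RP V z0 z1 u t =
      -((V u - V s - z0 s (RP.X u - RP.X s) - z1 s (RP.X (u - r) - RP.X (s - r)))
        (RP.X t - RP.X u)) - apply2 (z0 u - z0 s) (RP.XX u t) - apply2 (z1 u - z1 s) (RP.XXd u t) := by
  have e1 : apply2 (z0 s) (RP.XX s t) = apply2 (z0 s) (RP.XX s u) + apply2 (z0 s) (RP.XX u t)
      + z0 s (RP.X u - RP.X s) (RP.X t - RP.X u) := by
    rw [RP.chen s u t, apply2_add, apply2_add, ← apply2_tensor]; rfl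
  have e2 : apply2 (z1 s) (RP.XXd s t) = apply2 (z1 s) (RP.XXd s u) + apply2 (z1 s) (RP.XXd u t)
      + z1 s (RP.X (u - r) - RP.X (s - r)) (RP.X t - RP.X u) := by
    rw [RP.chend s u t, apply2_add, apply2_add, ← apply2_tensor]; rfl
  have e3 : V s (RP.X t - RP.X s) = V s (RP.X u - RP.X s) + V s (RP.X t - RP.X u) := by
    rw [← map_add]; congr 1; abel
  simp only [Xi, e1, e2, e3, apply2_sub, _root_.sub_apply]
  abel

/-- Size of the rough path on pairs at scale `h`, measured in the exponent `β`. -/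
def Small (β h η : ℝ) : Prop := ∀ s t, 0 ≤ s → s ≤ t → t ≤ r → t - s ≤ h →
  ‖RP.X t - RP.X s‖ ≤ η * (t - s) ^ β ∧ ‖RP.X (t - r) - RP.X (s - r)‖ ≤ η * (t - s) ^ β ∧
  ‖RP.XX s t‖ ≤ η * ((t - s) ^ β) ^ 2 ∧ ‖RP.XXd s t‖ ≤ η * ((t - s) ^ β) ^ 2

theorem exists_gamma_bound : ∃ K : ℝ, 1 ≤ K ∧ ∀ s t, 0 ≤ s → s ≤ t → t ≤ r →
    ‖RP.X t - RP.X s‖ ≤ K * (t - s) ^ γ ∧ ‖RP.X (t - r) - RP.X (s - r)‖ ≤ K * (t - s) ^ γ ∧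
    ‖RP.XX s t‖ ≤ K * (t - s) ^ (2 * γ) ∧ ‖RP.XXd s t‖ ≤ K * (t - s) ^ (2 * γ) := by
  obtain ⟨C1, h1⟩ := RP.holX 0 r
  obtain ⟨C2, h2⟩ := RP.holX (-r) 0
  obtain ⟨C3, h3⟩ := RP.holXX 0 r
  obtain ⟨C4, h4⟩ := RP.holXXd 0 r
  have a1 := le_abs_self C1
  have a2 := le_abs_self C2
  have a3 := le_abs_self C3
  have a4 := le_abs_self C4
  have b1 := abs_nonneg C1
  have b2 := abs_nonneg C2
  have b3 := abs_nonneg C3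
  have b4 := abs_nonneg C4
  refine ⟨1 + |C1| + |C2| + |C3| + |C4|, by linarith, fun s t hs hst ht => ?_⟩
  have habs : |t - s| = t - s := abs_of_nonneg (by linarith)
  have habs' : |t - r - (s - r)| = t - s := by rw [← habs]; congr 1; ring
  have g1 := h1 s ⟨hs, by linarith⟩ t ⟨by linarith, ht⟩
  have g2 := h2 (s - r) ⟨by linarith, by linarith⟩ (t - r) ⟨by linarith, by linarith⟩
  have g3 := h3 s ⟨hs, by linarith⟩ t ⟨by linarith, ht⟩
  have g4 := h4 s ⟨hs, by linarith⟩ t ⟨by linarith, ht⟩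
  rw [habs] at g1 g3 g4
  rw [habs'] at g2
  have p1 : 0 ≤ (t - s) ^ γ := Real.rpow_nonneg (by linarith) _
  have p2 : 0 ≤ (t - s) ^ (2 * γ) := Real.rpow_nonneg (by linarith) _
  refine ⟨g1.trans ?_, g2.trans ?_, g3.trans ?_, g4.trans ?_⟩
  all_goals
    gcongr
    linarith

theorem gamma_sq {x : ℝ} (hx : 0 ≤ x) (a : ℝ) : x ^ (2 * a) = (x ^ a) ^ 2 := by
  rw [mul_comm, Real.rpow_mul hx, Real.rpow_two]

theorem exists_small (hβ : 0 < β) (hβγ : β < γ) (η : ℝ) (hη : 0 < η) :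
    ∃ h, 0 < h ∧ h ≤ 1 ∧ Small RP β h η ∧ h ^ β ≤ η := by
  obtain ⟨K, hK, hb⟩ := exists_gamma_bound RP
  have hK0 : 0 < K := by linarith
  have hg : 0 < γ - β := by linarith
  set m := min (η / K) 1 with hm
  have hm0 : 0 < m := lt_min (by positivity) one_pos
  have hm1 : m ≤ 1 := min_le_right _ _
  have hmη : K * m ≤ η := by
    calc K * m ≤ K * (η / K) := by gcongr; exact min_le_left _ _
      _ = η := by field_simp
  have key : ∀ x : ℝ, 0 ≤ x → x ≤ m ^ (1 / (γ - β)) → x ^ (γ - β) ≤ m := by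
    intro x hx hxm
    calc x ^ (γ - β) ≤ (m ^ (1 / (γ - β))) ^ (γ - β) := by gcongr
      _ = m := by rw [← Real.rpow_mul hm0.le, one_div_mul_cancel hg.ne', Real.rpow_one]
  refine ⟨min (m ^ (1 / (γ - β))) (min (η ^ (1 / β)) 1), ?_, ?_, ?_, ?_⟩
  · refine lt_min (Real.rpow_pos_of_pos hm0 _) (lt_min (Real.rpow_pos_of_pos hη _) one_pos)
  · exact (min_le_right _ _).trans (min_le_right _ _)
  · intro s t hs hst ht hts
    have hx : 0 ≤ t - s := by linarith
    obtain ⟨b1, b2, b3, b4⟩ := hb s t hs hst ht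
    have k := key (t - s) hx (hts.trans (min_le_left _ _))
    have k0 : 0 ≤ (t - s) ^ (γ - β) := Real.rpow_nonneg hx _
    have l0 : 0 ≤ (t - s) ^ β := Real.rpow_nonneg hx _
    have e : (t - s) ^ γ = (t - s) ^ (γ - β) * (t - s) ^ β := by
      rw [← Real.rpow_add' hx (by linarith)]; congr 1; ring
    have q1 : K * (t - s) ^ γ ≤ η * (t - s) ^ β := by
      rw [e, ← mul_assoc]; gcongr
      calc K * (t - s) ^ (γ - β) ≤ K * m := by gcongr
        _ ≤ η := hmη
    have q2 : K * (t - s) ^ (2 * γ) ≤ η * ((t - s) ^ β) ^ 2 := by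
      rw [gamma_sq hx, e, mul_pow, ← mul_assoc]; gcongr
      calc K * ((t - s) ^ (γ - β)) ^ 2 ≤ K * m ^ 2 := by gcongr
        _ ≤ K * m := by
          gcongr
          rw [sq]; exact mul_le_of_le_one_left hm0.le hm1
        _ ≤ η := hmη
    exact ⟨b1.trans q1, b2.trans q1, b3.trans q2, b4.trans q2⟩
  · have hp : 0 ≤ min (m ^ (1 / (γ - β))) (min (η ^ (1 / β)) 1) := by positivity
    calc _ ≤ (η ^ (1 / β)) ^ β := by
          gcongr
          exact (min_le_right _ _).trans (min_le_left _ _)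
      _ = η := by rw [← Real.rpow_mul hη.le, one_div_mul_cancel hβ.ne', Real.rpow_one]

theorem exists_small_r (hr : 0 ≤ r) (hβ : 0 < β) (hβγ : β < γ) :
    ∃ K, 1 ≤ K ∧ Small RP β r K ∧ r ^ β ≤ K := by
  obtain ⟨K, hK, hb⟩ := exists_gamma_bound RP
  set R := r ^ (γ - β) with hR
  have hR0 : 0 ≤ R := Real.rpow_nonneg hr _
  have hr0 : 0 ≤ r ^ β := Real.rpow_nonneg hr _
  refine ⟨K * (1 + R) ^ 2 + r ^ β, by nlinarith, ?_, by nlinarith⟩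
  intro s t hs hst ht hts
  have hx : 0 ≤ t - s := by linarith
  obtain ⟨b1, b2, b3, b4⟩ := hb s t hs hst ht
  have k : (t - s) ^ (γ - β) ≤ R := by
    apply Real.rpow_le_rpow hx hts; linarith
  have k0 : 0 ≤ (t - s) ^ (γ - β) := Real.rpow_nonneg hx _
  have l0 : 0 ≤ (t - s) ^ β := Real.rpow_nonneg hx _
  have e : (t - s) ^ γ = (t - s) ^ (γ - β) * (t - s) ^ β := by
    rw [← Real.rpow_add' hx (by linarith)]; congr 1; ring
  have q1 : K * (t - s) ^ γ ≤ (K * (1 + R) ^ 2 + r ^ β) * (t - s) ^ β := by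
    rw [e, ← mul_assoc]; gcongr
    calc K * (t - s) ^ (γ - β) ≤ K * (1 + R) ^ 2 := by gcongr; nlinarith
      _ ≤ _ := by linarith
  have q2 : K * (t - s) ^ (2 * γ) ≤ (K * (1 + R) ^ 2 + r ^ β) * ((t - s) ^ β) ^ 2 := by
    rw [gamma_sq hx, e, mul_pow, ← mul_assoc]; gcongr
    calc K * ((t - s) ^ (γ - β)) ^ 2 ≤ K * (1 + R) ^ 2 := by gcongr; linarith
      _ ≤ _ := by linarith
  exact ⟨b1.trans q1, b2.trans q1, b3.trans q2, b4.trans q2⟩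

variable {RP}
variable {V : ℝ → (Fin d → ℝ) →L[ℝ] E} {z0 z1 : ℝ → (Fin d → ℝ) →L[ℝ] ((Fin d → ℝ) →L[ℝ] E)}

theorem ell_nonneg {s t : ℝ} (hst : s ≤ t) (β : ℝ) : 0 ≤ (t - s) ^ β :=
  Real.rpow_nonneg (by linarith) _

theorem ell_mono {s t s' t' : ℝ} (hβ : 0 < β) (hst : s ≤ t) (h1 : s' ≤ s) (h2 : t ≤ t') :
    (t - s) ^ β ≤ (t' - s') ^ β :=
  Real.rpow_le_rpow (by linarith) (by linarith) hβ.le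

/-- Bound on the higher order part of the compensated increment. -/
theorem Xi_bound2 {h η : ℝ} (hS : Small RP β h η) {s t D : ℝ} (hs : 0 ≤ s) (hst : s ≤ t)
    (ht : t ≤ r) (hts : t - s ≤ h) (h0 : ‖z0 s‖ ≤ D) (h1 : ‖z1 s‖ ≤ D) :
    ‖Xi RP V z0 z1 s t - V s (RP.X t - RP.X s)‖ ≤ 2 * d ^ 2 * D * η * ((t - s) ^ β) ^ 2 := by
  obtain ⟨b1, b2, b3, b4⟩ := hS s t hs hst ht hts
  have hD : 0 ≤ D := (norm_nonneg _).trans h0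
  have e : Xi RP V z0 z1 s t - V s (RP.X t - RP.X s) =
      apply2 (z0 s) (RP.XX s t) + apply2 (z1 s) (RP.XXd s t) := by
    simp only [Xi]; abel
  rw [e]
  refine (norm_add_le_of_le (apply2_le _ _) (apply2_le _ _)).trans ?_
  calc _ ≤ (d:ℝ) ^ 2 * (D * (η * ((t - s) ^ β) ^ 2)) + d ^ 2 * (D * (η * ((t - s) ^ β) ^ 2)) := by
        gcongr
    _ = _ := by ring

theorem Xi_delta_bound {h η : ℝ} (hβ : 0 < β) (hS : Small RP β h η) {s u t D : ℝ} (hs : 0 ≤ s)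
    (hsu : s ≤ u) (hut : u ≤ t) (ht : t ≤ r) (hts : t - s ≤ h) (hη : 0 ≤ η)
    (hD : DI ((u - s) ^ β) (RP.X u - RP.X s) (RP.X (u - r) - RP.X (s - r)) s u D V z0 z1) :
    ‖Xi RP V z0 z1 s t - Xi RP V z0 z1 s u - Xi RP V z0 z1 u t‖ ≤
      (1 + 2 * d ^ 2) * D * η * ((t - s) ^ β) ^ 3 := by
  obtain ⟨b1, b2, b3, b4⟩ := hS u t (by linarith) hut ht (by linarith)
  have hD0 := hD.nonneg
  have l1 := ell_nonneg hsu β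
  have l2 := ell_nonneg hut β
  have l3 := ell_mono hβ hsu le_rfl hut
  have l4 := ell_mono hβ hut hsu le_rfl
  rw [Xi_delta]
  generalize (u - s) ^ β = p at *
  generalize (t - u) ^ β = q at *
  generalize (t - s) ^ β = w at *
  have w0 : 0 ≤ w := l1.trans l3
  refine (norm_sub_le_of_le (r₂ := (d:ℝ) ^ 2 * (D * w * (η * w ^ 2)))
    (norm_sub_le_of_le (r₁ := D * w ^ 2 * (η * w)) (r₂ := (d:ℝ) ^ 2 * (D * w * (η * w ^ 2))) ?_
    ((apply2_le _ _).trans ?_))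
    ((apply2_le _ _).trans ?_)).trans (le_of_eq ?_)
  · rw [norm_neg]
    refine clm_le (hD.rem.trans ?_) (b1.trans ?_) <;> gcongr
  · gcongr
    · exact hD.h0.trans (by gcongr)
    · exact b3.trans (by gcongr)
  · gcongr
    · exact hD.h1.trans (by gcongr)
    · exact b4.trans (by gcongr)
  · ring

/-- Davie-type estimate. -/
def Davie (RP : DelayedRoughPath d r γ) (β T h C : ℝ) (v : ℝ → E) (V : ℝ → (Fin d → ℝ) →L[ℝ] E)
    (z0 z1 : ℝ → (Fin d → ℝ) →L[ℝ] ((Fin d → ℝ) →L[ℝ] E)) : Prop :=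
  ∀ s t, 0 ≤ s → s ≤ t → t ≤ T → t - s ≤ h →
    ‖v t - v s - Xi RP V z0 z1 s t‖ ≤ C * ((t - s) ^ β) ^ 3

/-- contraction factor of the midpoint iteration -/
def th (β : ℝ) : ℝ := 2 * ((1 / 2 : ℝ) ^ β) ^ 3

theorem th_pos : 0 < th β := by unfold th; positivity

theorem th_lt_one (hβ : 1 / 3 < β) : th β < 1 := by
  have h : ((1 / 2 : ℝ) ^ β) ^ 3 < 1 / 2 := by
    rw [← Real.rpow_natCast, ← Real.rpow_mul (by norm_num)]
    calc (1 / 2 : ℝ) ^ (β * (3 : ℕ)) < (1 / 2 : ℝ) ^ (1 : ℝ) := by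
          apply Real.rpow_lt_rpow_of_exponent_gt <;> norm_num
          linarith
      _ = 1 / 2 := by norm_num
  unfold th; linarith

theorem half_ell {s t : ℝ} (hst : s ≤ t) : ((t - s) / 2) ^ β = (1 / 2 : ℝ) ^ β * (t - s) ^ β := by
  rw [← Real.mul_rpow (by norm_num) (by linarith)]; congr 1; ring

theorem Davie.improve {T h C K : ℝ} {v : ℝ → E} (hβ : 1 / 3 < β)
    (hD : Davie RP β T h C v V z0 z1)
    (hK : ∀ s u t, 0 ≤ s → s ≤ u → u ≤ t → t ≤ T → t - s ≤ h →
      ‖Xi RP V z0 z1 s t - Xi RP V z0 z1 s u - Xi RP V z0 z1 u t‖ ≤ K * ((t - s) ^ β) ^ 3) :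
    Davie RP β T h (K / (1 - th β)) v V z0 z1 := by
  have hth := th_lt_one hβ
  have hth0 := th_pos (β := β)
  set L := K / (1 - th β) with hL
  have hLK : th β * L + K = L := by
    rw [hL]; field_simp [(by linarith : (1 - th β) ≠ 0)]; ring
  have step : ∀ n : ℕ, Davie RP β T h (L + th β ^ n * (C - L)) v V z0 z1 := by
    intro n
    induction n with
    | zero => simpa using hD
    | succ n ih =>
      intro s t hs hst ht hts
      have h1 := ih s ((s + t) / 2) hs (by linarith) (by linarith) (by linarith)
      have h2 := ih ((s + t) / 2) t (by linarith) (by linarith) (by linarith) (by linarith)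
      have h3 := hK s ((s + t) / 2) t hs (by linarith) (by linarith) ht hts
      rw [show (s + t) / 2 - s = (t - s) / 2 by ring, half_ell hst] at h1
      rw [show t - (s + t) / 2 = (t - s) / 2 by ring, half_ell hst] at h2
      set u := (s + t) / 2
      have e : v t - v s - Xi RP V z0 z1 s t = (v u - v s - Xi RP V z0 z1 s u)
        + (v t - v u - Xi RP V z0 z1 u t) -
        (Xi RP V z0 z1 s t - Xi RP V z0 z1 s u - Xi RP V z0 z1 u t) := by abel
      rw [e]
      refine (norm_sub_le_of_le (norm_add_le_of_le h1 h2) h3).trans (le_of_eq ?_)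
      rw [mul_pow]
      calc _ = (th β * (L + th β ^ n * (C - L)) + K) * ((t - s) ^ β) ^ 3 := by unfold th; ring
        _ = ((th β * L + K) + th β ^ (n + 1) * (C - L)) * ((t - s) ^ β) ^ 3 := by ring
        _ = _ := by rw [hLK]
  intro s t hs hst ht hts
  have hlim : Tendsto (fun n : ℕ => (L + th β ^ n * (C - L)) * ((t - s) ^ β) ^ 3) atTop
      (𝓝 ((L + 0 * (C - L)) * ((t - s) ^ β) ^ 3)) :=
    ((tendsto_const_nhds.add
      ((tendsto_pow_atTop_nhds_zero_of_lt_one hth0.le hth).mul_const _)).mul_const _)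
  have := ge_of_tendsto' hlim fun n => step n s t hs hst ht hts
  simpa using this

end Rough
end SDDE

namespace SDDE
open Set Filter Topology
set_option maxSynthPendingDepth 3

section APriori

variable {d : ℕ} {r γ β : ℝ} {E : Type*} [NormedAddCommGroup E] [NormedSpace ℝ E]

/-- The delayed controlled bounds on the pair `(s,t)`. -/
abbrev DCp (RP : DelayedRoughPath d r γ) (β s t M : ℝ) (m : ℝ → E)
    (m0 m1 : ℝ → (Fin d → ℝ) →L[ℝ] E) : Prop :=
  DC ((t - s) ^ β) (RP.X t - RP.X s) (RP.X (t - r) - RP.X (s - r)) s t M m m0 m1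

/-- The delayed controlled bounds on all pairs in `[0,T]` at scale `h`. -/
def AllT (RP : DelayedRoughPath d r γ) (β T h M : ℝ) (m : ℝ → E)
    (m0 m1 : ℝ → (Fin d → ℝ) →L[ℝ] E) : Prop :=
  ∀ s t, 0 ≤ s → s ≤ t → t ≤ T → t - s ≤ h → DCp RP β s t M m m0 m1

variable {RP : DelayedRoughPath d r γ} {v : ℝ → E} {V : ℝ → (Fin d → ℝ) →L[ℝ] E}
  {z0 z1 : ℝ → (Fin d → ℝ) →L[ℝ] ((Fin d → ℝ) →L[ℝ] E)}

theorem AllT.mono {T h M N : ℝ} {m : ℝ → E} {m0 m1 : ℝ → (Fin d → ℝ) →L[ℝ] E}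
    (H : AllT RP β T h M m m0 m1) (hMN : M ≤ N) : AllT RP β T h N m m0 m1 :=
  fun s t hs hst ht hts => (H s t hs hst ht hts).mono (ell_nonneg hst β) hMN

theorem AllT.lim {T h M : ℝ} {m : ℝ → E} {m0 m1 : ℝ → (Fin d → ℝ) →L[ℝ] E} {Ms : ℕ → ℝ}
    (H : ∀ i, AllT RP β T h (Ms i) m m0 m1) (hM : Tendsto Ms atTop (𝓝 M)) :
    AllT RP β T h M m m0 m1 :=
  fun s t hs hst ht hts => DC.lim (fun i => H i s t hs hst ht hts) hM

theorem AllT.ext {T h M K : ℝ} {m : ℝ → E} {m0 m1 : ℝ → (Fin d → ℝ) →L[ℝ] E} (hβ : 0 < β)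
    (hh : 0 < h) (hS : Small RP β r K) (hT : T ≤ r) (hK : 0 ≤ K)
    (H : AllT RP β T h M m m0 m1) :
    AllT RP β T r (M * (1 + 2 / h ^ β + 2 / (h ^ β) ^ 2 + 2 * K / h ^ β)) m m0 m1 := by
  intro s t hs hst ht hts
  have Hs := H s s hs le_rfl (by linarith) (by linarith)
  have Ht := H t t (by linarith) le_rfl ht (by linarith)
  have hM := Hs.nonneg
  have hl := ell_nonneg hst β
  have ha : 0 < h ^ β := Real.rpow_pos_of_pos hh β
  set a := h ^ β with had
  set R := 1 + 2 / a + 2 / a ^ 2 + 2 * K / a with hR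
  have p1 : 0 ≤ 2 / a := by positivity
  have p2 : 0 ≤ 2 / a ^ 2 := by positivity
  have p3 : 0 ≤ 2 * K / a := by positivity
  have hR1 : 1 ≤ R := by linarith
  have hMR : M ≤ M * R := le_mul_of_one_le_right hM hR1
  by_cases hc : t - s ≤ h
  · exact (H s t hs hst ht hc).mono hl hMR
  push Not at hc
  have hal : a ≤ (t - s) ^ β := Real.rpow_le_rpow hh.le hc.le hβ.le
  obtain ⟨b1, b2, -, -⟩ := hS s t hs hst (by linarith) hts
  unfold DCp
  generalize (t - s) ^ β = l at *
  have one : 1 ≤ l / a := by rw [one_le_div ha]; exact hal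
  have q1 : 2 * M ≤ M * R * l := by
    calc 2 * M ≤ 2 * M * (l / a) := le_mul_of_one_le_right (by positivity) one
      _ = M * (2 / a) * l := by field_simp
      _ ≤ M * R * l := by gcongr; linarith
  have q2 : 2 * M + M * (K * l) + M * (K * l) ≤ M * R * l ^ 2 := by
    calc 2 * M + M * (K * l) + M * (K * l) = 2 * M * 1 ^ 2 + (2 * M * K * l) * 1 := by ring
      _ ≤ 2 * M * (l / a) ^ 2 + (2 * M * K * l) * (l / a) := by gcongr
      _ = M * (2 / a ^ 2 + 2 * K / a) * l ^ 2 := by field_simp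
      _ ≤ M * R * l ^ 2 := by gcongr; linarith
  refine ⟨⟨Hs.b0s.trans hMR, Ht.b0s.trans hMR, Hs.b1s.trans hMR, Ht.b1s.trans hMR, ?_, ?_, ?_, ?_⟩,
    Hs.bs.trans hMR, Ht.bs.trans hMR⟩
  · exact (norm_sub_le_of_le Ht.bs Hs.bs).trans (by linarith)
  · exact (norm_sub_le_of_le Ht.b0s Hs.b0s).trans (by linarith)
  · exact (norm_sub_le_of_le Ht.b1s Hs.b1s).trans (by linarith)
  · refine (norm_sub_le_of_le (norm_sub_le_of_le (norm_sub_le_of_le Ht.bs Hs.bs)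
      (clm_le Hs.b0s b1)) (clm_le Hs.b1s b2)).trans (by linarith)

theorem Davie.ext {h C K κ D : ℝ} (hβ : 0 < β) (hh : 0 < h) (hS : Small RP β r K)
    (hK : 0 ≤ K) (hC : 0 ≤ C)
    (hv : AllT RP β r r κ v V 0) (hV : AllT RP β r r D V z0 z1)
    (H : Davie RP β r h C v V z0 z1) :
    Davie RP β r r (C + (κ + 2 * d ^ 2 * D * K) / h ^ β) v V z0 z1 := by
  intro s t hs hst ht hts
  have Hv := hv s t hs hst ht hts
  have HV := hV s t hs hst ht hts
  have hX := Xi_bound2 (V := V) hS hs hst ht hts HV.b0s HV.b1s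
  have hκ := Hv.nonneg
  have hD := HV.nonneg
  have ha : 0 < h ^ β := Real.rpow_pos_of_pos hh β
  have hl := ell_nonneg hst β
  have hp : 0 ≤ (κ + 2 * d ^ 2 * D * K) / h ^ β := by positivity
  by_cases hc : t - s ≤ h
  · exact (H s t hs hst ht hc).trans (by gcongr; linarith)
  push Not at hc
  have hal : h ^ β ≤ (t - s) ^ β := Real.rpow_le_rpow hh.le hc.le hβ.le
  have hrem := Hv.rem
  simp only [Pi.zero_apply, _root_.zero_apply, sub_zero] at hrem
  generalize h ^ β = a at *
  have e : v t - v s - Xi RP V z0 z1 s t = (v t - v s - V s (RP.X t - RP.X s)) -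
    (Xi RP V z0 z1 s t - V s (RP.X t - RP.X s)) := by abel
  rw [e]
  refine (norm_sub_le_of_le hrem hX).trans ?_
  generalize (t - s) ^ β = l at *
  have one : 1 ≤ l / a := by rw [one_le_div ha]; exact hal
  calc κ * l ^ 2 + 2 * d ^ 2 * D * K * l ^ 2 = (κ + 2 * d ^ 2 * D * K) * l ^ 2 * 1 := by ring
    _ ≤ (κ + 2 * d ^ 2 * D * K) * l ^ 2 * (l / a) := by gcongr
    _ = (κ + 2 * d ^ 2 * D * K) / a * l ^ 3 := by field_simp
    _ ≤ _ := by gcongr; linarith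

/-- one step of the a priori estimate -/
theorem apriori_step {c h η T N F C0 κ A : ℝ} (hβ : 1 / 3 < β) (hT : T ≤ r)
    (hS : Small RP β h η) (hη0 : 0 ≤ η) (hη1 : η ≤ 1) (hhη : h ^ β ≤ η)
    (hA : A = (1 + 2 * d ^ 2) / (1 - th β) + 2 * d ^ 2 + 3) (hc : 0 ≤ c) (hF : 0 ≤ F)
    (hN : ∀ t, 0 ≤ t → t ≤ T → ‖v t‖ ≤ N)
    (H1 : ∀ t, 0 ≤ t → t ≤ T → ‖V t‖ ≤ c * (‖v t‖ + F))
    (H3 : ∀ s t, 0 ≤ s → s ≤ t → t ≤ T → ∀ κ, 0 ≤ κ → DCp RP β s t κ v V 0 →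
      DCp RP β s t (c * (κ + F)) V z0 z1)
    (hκ : AllT RP β T h κ v V 0) (hκ0 : 0 ≤ κ)
    (hD : Davie RP β T h C0 v V z0 z1) :
    AllT RP β T h (N + c * (N + F) + A * (c * (κ + F)) * η) v V 0 ∧
    (∀ s t, 0 ≤ s → s ≤ t → t ≤ T → t - s ≤ h →
      ‖v t - v s‖ ≤ (c * (N + F) + A * (c * (κ + F)) * η) * η) ∧
    Davie RP β T h (A * (c * (κ + F)) * η) v V z0 z1 := by
  have hth := th_lt_one hβ
  have hβ0 : 0 < β := by linarith
  set D := c * (κ + F) with hDd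
  have hD0 : 0 ≤ D := by positivity
  have hVD : AllT RP β T h D V z0 z1 := fun s t hs hst ht hts =>
    H3 s t hs hst ht κ hκ0 (hκ s t hs hst ht hts)
  set A1 := (1 + 2 * d ^ 2) / (1 - th β) with hA1
  have hA10 : 0 ≤ A1 := div_nonneg (by positivity) (by linarith)
  have hDa : Davie RP β T h (A1 * D * η) v V z0 z1 := by
    have := Davie.improve (K := (1 + 2 * d ^ 2) * D * η) hβ hD (fun s u t hs hsu hut ht hts =>
      Xi_delta_bound hβ0 hS hs hsu hut (by linarith) hts hη0
        (hVD s u hs hsu (by linarith) (by linarith)).toDI)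
    convert this using 1
    rw [hA1]; ring
  have hd2 : (0:ℝ) ≤ 2 * d ^ 2 := by positivity
  have hA0 : 0 ≤ A := by rw [hA]; positivity
  have hVb : ∀ t, 0 ≤ t → t ≤ T → ‖V t‖ ≤ c * (N + F) := fun t h0 h1 =>
    (H1 t h0 h1).trans (by gcongr; exact hN t h0 h1)
  have hrem : ∀ s t, 0 ≤ s → s ≤ t → t ≤ T → t - s ≤ h →
      ‖v t - v s - V s (RP.X t - RP.X s)‖ ≤ A * D * η * ((t - s) ^ β) ^ 2 := by
    intro s t hs hst ht hts
    have HV := hVD s t hs hst ht hts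
    have hX := Xi_bound2 (V := V) hS hs hst (by linarith) hts HV.b0s HV.b1s
    have e : v t - v s - V s (RP.X t - RP.X s) = (v t - v s - Xi RP V z0 z1 s t) +
      (Xi RP V z0 z1 s t - V s (RP.X t - RP.X s)) := by abel
    rw [e]
    refine (norm_add_le_of_le (hDa s t hs hst ht hts) hX).trans ?_
    have hl := ell_nonneg hst β
    have hl1 : (t - s) ^ β ≤ 1 :=
      (Real.rpow_le_rpow (by linarith) hts hβ0.le).trans (hhη.trans hη1)
    generalize (t - s) ^ β = l at *
    calc A1 * D * η * l ^ 3 + 2 * d ^ 2 * D * η * l ^ 2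
        = A1 * D * η * l ^ 2 * l + 2 * d ^ 2 * D * η * l ^ 2 := by ring
      _ ≤ A1 * D * η * l ^ 2 * 1 + 2 * d ^ 2 * D * η * l ^ 2 := by gcongr
      _ = (A1 + 2 * d ^ 2) * D * η * l ^ 2 := by ring
      _ ≤ _ := by gcongr; rw [hA]; linarith
  have hinc : ∀ s t, 0 ≤ s → s ≤ t → t ≤ T → t - s ≤ h →
      ‖v t - v s‖ ≤ (c * (N + F) + A * D * η) * (t - s) ^ β ∧
      ‖v t - v s‖ ≤ (c * (N + F) + A * D * η) * η := by
    intro s t hs hst ht hts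
    have hl := ell_nonneg hst β
    have hl1 : (t - s) ^ β ≤ η :=
      (Real.rpow_le_rpow (by linarith) hts hβ0.le).trans hhη
    obtain ⟨b1, -, -, -⟩ := hS s t hs hst (by linarith) hts
    have e : v t - v s = (v t - v s - V s (RP.X t - RP.X s)) + V s (RP.X t - RP.X s) := by abel
    have hb : ‖v t - v s‖ ≤ A * D * η * ((t - s) ^ β) ^ 2 +
        c * (N + F) * (η * (t - s) ^ β) := by
      rw [e]
      exact norm_add_le_of_le (hrem s t hs hst ht hts) (clm_le (hVb s hs (by linarith)) b1)
    have hcN : 0 ≤ c * (N + F) := (norm_nonneg _).trans (hVb s hs (by linarith))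
    generalize (t - s) ^ β = l at *
    have : ‖v t - v s‖ ≤ (c * (N + F) + A * D * η) * (η * l) := by
      refine hb.trans ?_
      calc A * D * η * l ^ 2 + c * (N + F) * (η * l)
          = A * D * η * (l * l) + c * (N + F) * (η * l) := by ring
        _ ≤ A * D * η * (η * l) + c * (N + F) * (η * l) := by gcongr
        _ = _ := by ring
    constructor
    · refine this.trans ?_
      gcongr
      exact mul_le_of_le_one_left hl hη1
    · refine this.trans ?_
      gcongr
      exact mul_le_of_le_one_right hη0 (hl1.trans hη1)
  refine ⟨fun s t hs hst ht hts => ?_, fun s t hs hst ht hts => (hinc s t hs hst ht hts).2, ?_⟩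
  · have HV := hVD s t hs hst ht hts
    have hl := ell_nonneg hst β
    have hl1 : (t - s) ^ β ≤ η :=
      (Real.rpow_le_rpow (by linarith) hts hβ0.le).trans hhη
    obtain ⟨b1, b2, -, -⟩ := hS s t hs hst (by linarith) hts
    have hcN : 0 ≤ c * (N + F) := (norm_nonneg _).trans (hVb s hs (by linarith))
    have hN0 : 0 ≤ N := (norm_nonneg _).trans (hN s hs (by linarith))
    have hADη : 0 ≤ A * D * η := by positivity
    have hVi : ‖V t - V s‖ ≤ A * D * η * (t - s) ^ β := by
      have e : V t - V s = (V t - V s - z0 s (RP.X t - RP.X s)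
        - z1 s (RP.X (t - r) - RP.X (s - r))) + z0 s (RP.X t - RP.X s)
        + z1 s (RP.X (t - r) - RP.X (s - r)) := by abel
      rw [e]
      refine (norm_add_le_of_le (norm_add_le_of_le HV.rem (clm_le HV.b0s b1))
        (clm_le HV.b1s b2)).trans ?_
      generalize (t - s) ^ β = l at *
      calc D * l ^ 2 + D * (η * l) + D * (η * l) = D * (l * l) + D * (η * l) + D * (η * l) := by ring
        _ ≤ D * (η * l) + D * (η * l) + D * (η * l) := by gcongr
        _ = 3 * D * η * l := by ring
        _ ≤ _ := by gcongr; rw [hA]; linarith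
    have hi := (hinc s t hs hst ht hts).1
    have hrm := hrem s t hs hst ht hts
    have hVs := hVb s hs (by linarith)
    have hVt := hVb t (by linarith) ht
    have hvs := hN s hs (by linarith)
    have hvt := hN t (by linarith) ht
    unfold DCp
    generalize (t - s) ^ β = l at *
    have hz : 0 ≤ N + c * (N + F) + A * D * η := by positivity
    refine ⟨⟨?_, ?_, ?_, ?_, ?_, ?_, ?_, ?_⟩, ?_, ?_⟩
    · linarith
    · linarith
    · simpa using hz
    · simpa using hz
    · exact hi.trans (by gcongr; linarith)
    · exact hVi.trans (by gcongr; linarith)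
    · simp only [Pi.zero_apply, sub_self, norm_zero]; positivity
    · simp only [Pi.zero_apply, _root_.zero_apply, sub_zero]
      exact hrm.trans (by gcongr; linarith)
    · linarith
    · linarith
  · intro s t hs hst ht hts
    refine (hDa s t hs hst ht hts).trans ?_
    have hl := ell_nonneg hst β
    gcongr
    rw [hA]; linarith

set_option maxHeartbeats 2000000 in
/-- a priori estimate for linear-type rough equations -/
theorem apriori (RP : DelayedRoughPath d r γ) (hr : 0 < r) (hβ : 1 / 3 < β) (hβγ : β < γ)
    (c : ℝ) (hc : 0 ≤ c) :
    ∃ C, 1 ≤ C ∧ ∀ (v : ℝ → E) (V : ℝ → (Fin d → ℝ) →L[ℝ] E)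
      (z0 z1 : ℝ → (Fin d → ℝ) →L[ℝ] ((Fin d → ℝ) →L[ℝ] E)) (F C0 κ : ℝ), 0 ≤ F →
      (∀ t, 0 ≤ t → t ≤ r → ‖V t‖ ≤ c * (‖v t‖ + F)) →
      (∀ s t, 0 ≤ s → s ≤ t → t ≤ r → ∀ κ, 0 ≤ κ → DCp RP β s t κ v V 0 →
        DCp RP β s t (c * (κ + F)) V z0 z1) →
      AllT RP β r r κ v V 0 → Davie RP β r r C0 v V z0 z1 →
      AllT RP β r r (C * (‖v 0‖ + F)) v V 0 ∧ Davie RP β r r (C * (‖v 0‖ + F)) v V z0 z1 := by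
  have hth := th_lt_one hβ
  have hβ0 : 0 < β := by linarith
  obtain ⟨K, hK1, hSK, -⟩ := exists_small_r RP hr.le hβ0 hβγ
  obtain ⟨A, hA⟩ : ∃ A : ℝ, A = (1 + 2 * d ^ 2) / (1 - th β) + 2 * d ^ 2 + 3 := ⟨_, rfl⟩
  have hA0 : 0 ≤ A := by
    rw [hA]
    have : 0 ≤ (1 + 2 * (d:ℝ) ^ 2) / (1 - th β) := div_nonneg (by positivity) (by linarith)
    positivity
  set η : ℝ := 1 / (2 * (c + A * c * (5 + 2 * c) + 1)) with hη
  have hη0 : 0 < η := by positivity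
  have hηe : η * (c + A * c * (5 + 2 * c) + 1) = 1 / 2 := by
    rw [hη]; field_simp
  have hAc : 0 ≤ A * c := by positivity
  have hηn : 0 ≤ η * (A * c) := by positivity
  have hηm : 0 ≤ η * (A * c * c) := by positivity
  have hηc : 0 ≤ η * c := by positivity
  have hη1 : η ≤ 1 := by nlinarith
  have hη2 : A * c * η ≤ 1 / 2 := by nlinarith
  obtain ⟨h, hh0, hh1, hS, hhη⟩ := exists_small RP hβ0 hβγ η hη0
  obtain ⟨n, hn⟩ := exists_nat_ge (r / h)
  have hnr : r ≤ n * h := by rwa [div_le_iff₀ hh0] at hn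
  set Ke := 1 + 2 / h ^ β + 2 / (h ^ β) ^ 2 + 2 * K / h ^ β with hKe
  have ha : 0 < h ^ β := Real.rpow_pos_of_pos hh0 β
  have hKe1 : 1 ≤ Ke := by
    have p1 : 0 ≤ 2 / h ^ β := by positivity
    have p2 : 0 ≤ 2 / (h ^ β) ^ 2 := by positivity
    have p3 : 0 ≤ 2 * K / h ^ β := by positivity
    linarith
  set C1 := 2 * (2 + c) * 2 ^ n with hC1
  have hC11 : 1 ≤ C1 := by
    have : (1:ℝ) ≤ 2 ^ n := one_le_pow₀ (by norm_num)
    nlinarith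
  set C2 := C1 * Ke with hC2
  have hC21 : 1 ≤ C2 := by nlinarith
  set C3 := A * (c * (C1 + 1)) * η + (C2 + 2 * d ^ 2 * (c * (C2 + 1)) * K) / h ^ β with hC3
  have hC30 : 0 ≤ C3 := by positivity
  refine ⟨C2 + C3, by linarith, ?_⟩
  intro v V z0 z1 F C0 κ hF H1 H3 hκ hD
  have hκ0 : 0 ≤ κ := (hκ 0 0 le_rfl le_rfl hr.le (by linarith)).nonneg
  have hbd : ∀ t, 0 ≤ t → t ≤ r → ‖v t‖ ≤ κ := fun t h0 h1 =>
    (hκ t t h0 le_rfl h1 (by linarith)).bs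
  -- restriction
  have hr' : ∀ T, T ≤ r → AllT RP β T h κ v V 0 := fun T hT s t hs hst ht hts =>
    hκ s t hs hst (by linarith) (by linarith)
  have hD' : ∀ T, T ≤ r → Davie RP β T h C0 v V z0 z1 := fun T hT s t hs hst ht hts =>
    hD s t hs hst (by linarith) (by linarith)
  have iter : ∀ T, T ≤ r → 0 ≤ T → ∀ N, (∀ t, 0 ≤ t → t ≤ T → ‖v t‖ ≤ N) →
      AllT RP β T h (2 * ((2 + c) * (N + F))) v V 0 := by
    intro T hT hT0 N hN
    have hN0 : 0 ≤ N := (norm_nonneg _).trans (hN 0 le_rfl hT0)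
    have key : ∀ n : ℕ, AllT RP β T h (2 * ((2 + c) * (N + F)) + (1 / 2) ^ n * κ) v V 0 := by
      intro n
      induction n with
      | zero =>
        refine (hr' T hT).mono ?_
        have : 0 ≤ (2 + c) * (N + F) := by positivity
        simp; linarith
      | succ n ih =>
        have hp : 0 ≤ (1 / 2 : ℝ) ^ n * κ := by positivity
        refine (apriori_step hβ hT hS hη0.le hη1 hhη hA hc hF hN
          (fun t h0 h1 => H1 t h0 (by linarith))
          (fun s t hs hst ht => H3 s t hs hst (by linarith)) ih (by positivity) (hD' T hT)).1.mono ?_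
        have hpow : (1 / 2 : ℝ) ^ (n + 1) * κ = (1 / 2 : ℝ) ^ n * κ / 2 := by ring
        rw [hpow]
        generalize (1 / 2 : ℝ) ^ n * κ = x at *
        have e : A * (c * (2 * ((2 + c) * (N + F)) + x + F)) * η
          = (A * c * η) * (2 * ((2 + c) * (N + F)) + x + F) := by ring
        rw [e]
        have : (A * c * η) * (2 * ((2 + c) * (N + F)) + x + F) ≤
          1 / 2 * (2 * ((2 + c) * (N + F)) + x + F) := by gcongr
        linarith
    refine AllT.lim key ?_
    have : Tendsto (fun n : ℕ => 2 * ((2 + c) * (N + F)) + (1 / 2 : ℝ) ^ n * κ) atTop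
      (𝓝 (2 * ((2 + c) * (N + F)) + 0 * κ)) :=
      tendsto_const_nhds.add ((tendsto_pow_atTop_nhds_zero_of_lt_one (by norm_num)
        (by norm_num)).mul_const _)
    simpa using this
  have step2 : ∀ T, T ≤ r → 0 ≤ T → ∀ N, (∀ t, 0 ≤ t → t ≤ T → ‖v t‖ ≤ N) →
      (∀ s t, 0 ≤ s → s ≤ t → t ≤ T → t - s ≤ h → ‖v t - v s‖ ≤ 1 / 2 * (N + F)) ∧
      Davie RP β T h (A * (c * (2 * ((2 + c) * (N + F)) + F)) * η) v V z0 z1 := by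
    intro T hT hT0 N hN
    have hN0 : 0 ≤ N := (norm_nonneg _).trans (hN 0 le_rfl hT0)
    obtain ⟨-, q1, q2⟩ := apriori_step hβ hT hS hη0.le hη1 hhη hA hc hF hN
          (fun t h0 h1 => H1 t h0 (by linarith))
          (fun s t hs hst ht => H3 s t hs hst (by linarith)) (iter T hT hT0 N hN) (by positivity)
          (hD' T hT)
    refine ⟨fun s t hs hst ht hts => (q1 s t hs hst ht hts).trans ?_, q2⟩
    calc _ = η * (c * (N + F)) + η * η * (A * c * (2 * ((2 + c) * (N + F)) + F)) := by ring
      _ ≤ η * (c * (N + F)) + η * 1 * (A * c * (2 * ((2 + c) * (N + F)) + (N + F))) := by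
        gcongr; linarith
      _ = (η * (c + A * c * (5 + 2 * c) + 1)) * (N + F) - η * (N + F) := by ring
      _ ≤ _ := by
        rw [hηe]
        have : 0 ≤ η * (N + F) := by positivity
        linarith
  have chunk : ∀ k : ℕ, ∀ t, 0 ≤ t → t ≤ r → t ≤ k * h → ‖v t‖ + F ≤ 2 ^ k * (‖v 0‖ + F) := by
    intro k
    induction k with
    | zero =>
      intro t h0 h1 h2
      have : t = 0 := by simp at h2; linarith
      subst this; simp
    | succ k ih =>
      set T := min ((k + 1 : ℕ) * h) r with hTd
      have hT : T ≤ r := min_le_right _ _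
      have hT0 : 0 ≤ T := le_min (by positivity) hr.le
      set S := Set.image (fun t => ‖v t‖) (Icc 0 T) with hSd
      have hSb : BddAbove S := ⟨κ, by
        rintro _ ⟨t, ht, rfl⟩; exact hbd t ht.1 (ht.2.trans hT)⟩
      have hSm : ∀ t, 0 ≤ t → t ≤ T → ‖v t‖ ≤ sSup S := fun t h0 h1 =>
        le_csSup hSb ⟨t, ⟨h0, h1⟩, rfl⟩
      have hs := (step2 T hT hT0 (sSup S) hSm).1
      have hle : sSup S ≤ (2 ^ k * (‖v 0‖ + F) - F) + 1 / 2 * (sSup S + F) := by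
        apply csSup_le (⟨‖v 0‖, 0, ⟨le_rfl, hT0⟩, rfl⟩ : S.Nonempty)
        rintro _ ⟨t, ht, rfl⟩
        have ht1 : t ≤ (k + 1 : ℕ) * h := ht.2.trans (min_le_left _ _)
        push_cast at ht1
        have h2 := hs (max 0 (t - h)) t (le_max_left _ _) (max_le ht.1 (by linarith)) ht.2
          (by linarith [le_max_right 0 (t - h)])
        have h3 := ih (max 0 (t - h)) (le_max_left _ _)
          (max_le hr.le (by linarith [ht.2])) (max_le (by positivity) (by linarith))
        have h4 := norm_sub_norm_le (v t) (v (max 0 (t - h)))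
        show ‖v t‖ ≤ _
        linarith
      intro t h0 h1 h2
      have := hSm t h0 (le_min h2 h1)
      rw [pow_succ]
      linarith
  set N0 := 2 ^ n * (‖v 0‖ + F) - F with hN0
  have hN : ∀ t, 0 ≤ t → t ≤ r → ‖v t‖ ≤ N0 := fun t h0 h1 => by
    have := chunk n t h0 h1 (by linarith)
    linarith
  have hNF : N0 + F = 2 ^ n * (‖v 0‖ + F) := by ring
  have f1 := iter r le_rfl hr.le N0 hN
  have f2 := (step2 r le_rfl hr.le N0 hN).2
  set G := ‖v 0‖ + F with hG
  have hG0 : 0 ≤ G := by positivity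
  have hFG : F ≤ G := by rw [hG]; linarith [norm_nonneg (v 0)]
  have e1 : 2 * ((2 + c) * (N0 + F)) = C1 * G := by rw [hNF]; ring
  rw [e1] at f1 f2
  have g1 : AllT RP β r r (C2 * G) v V 0 := by
    have := f1.ext hβ0 hh0 hSK le_rfl (by linarith)
    convert this using 1
    ring
  have g2 : AllT RP β r r (c * (C2 + 1) * G) V z0 z1 := fun s t hs hst ht hts =>
    (H3 s t hs hst ht _ (by positivity) (g1 s t hs hst ht hts)).mono (ell_nonneg hst β) (by
      rw [mul_assoc c]; exact mul_le_mul_of_nonneg_left (by linarith) hc)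
  have g3 := f2.ext hβ0 hh0 hSK (by linarith) (by positivity) g1 g2
  refine ⟨g1.mono (by nlinarith), fun s t hs hst ht hts => (g3 s t hs hst ht hts).trans ?_⟩
  have hl := ell_nonneg hst β
  gcongr
  calc _ ≤ A * (c * (C1 * G + G)) * η + (C2 * G + 2 * d ^ 2 * (c * (C2 + 1) * G) * K) / h ^ β := by
        gcongr
    _ = C3 * G := by rw [hC3]; ring
    _ ≤ _ := by nlinarith

end APriori
end SDDE

namespace SDDE
open Set Filter Topology
set_option maxSynthPendingDepth 3

section Euler

variable {d : ℕ} {r γ β : ℝ} {W : Type*} [NormedAddCommGroup W] [NormedSpace ℝ W]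

/-- pair path -/
def pu (y e : ℝ → W) : ℝ → W × W := fun τ => (y τ, e τ)
/-- derivative in the direction of `X` -/
def pa (Y : ℝ → (Fin d → ℝ) →L[ℝ] W) : ℝ → (Fin d → ℝ) →L[ℝ] W × W := fun τ => (Y τ).prod 0
/-- derivative in the direction of the delayed `X` -/
def pb (Y : ℝ → (Fin d → ℝ) →L[ℝ] W) : ℝ → (Fin d → ℝ) →L[ℝ] W × W :=
  fun τ => (0 : (Fin d → ℝ) →L[ℝ] W).prod (Y τ)

theorem norm_pr0 (f : (Fin d → ℝ) →L[ℝ] W) :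
    ‖f.prod (0 : (Fin d → ℝ) →L[ℝ] W)‖ = ‖f‖ := by
  rw [ContinuousLinearMap.opNorm_prod]; simp [Prod.norm_def]

theorem norm_0pr (f : (Fin d → ℝ) →L[ℝ] W) :
    ‖(0 : (Fin d → ℝ) →L[ℝ] W).prod f‖ = ‖f‖ := by
  rw [ContinuousLinearMap.opNorm_prod]; simp [Prod.norm_def]

theorem pa_sub (f g : (Fin d → ℝ) →L[ℝ] W) :
    f.prod (0 : (Fin d → ℝ) →L[ℝ] W) - g.prod 0 = (f - g).prod 0 := by
  ext x <;> simp

theorem pb_sub (f g : (Fin d → ℝ) →L[ℝ] W) :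
    (0 : (Fin d → ℝ) →L[ℝ] W).prod f - (0 : (Fin d → ℝ) →L[ℝ] W).prod g
      = (0 : (Fin d → ℝ) →L[ℝ] W).prod (f - g) := by
  ext x <;> simp

theorem DI.pair {l s t M N : ℝ} {xa xb : Fin d → ℝ} {y e : ℝ → W}
    {Y e' : ℝ → (Fin d → ℝ) →L[ℝ] W} (hl : 0 ≤ l) (hy : DI l xa xb s t M y Y 0)
    (he : DI l xa xb s t N e 0 e') : DI l xa xb s t (M + N) (pu y e) (pa Y) (pb e') := by
  have hM := hy.nonneg
  have hN := he.nonneg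
  have hy1 := hy.rem
  have he1 := he.rem
  simp only [Pi.zero_apply, _root_.zero_apply, sub_zero] at hy1 he1
  have m1 : M * l ≤ (M + N) * l := by gcongr; linarith
  have m2 : N * l ≤ (M + N) * l := by gcongr; linarith
  have m3 : M * l ^ 2 ≤ (M + N) * l ^ 2 := by gcongr; linarith
  have m4 : N * l ^ 2 ≤ (M + N) * l ^ 2 := by gcongr; linarith
  refine ⟨?_, ?_, ?_, ?_, ?_, ?_, ?_, ?_⟩
  · simp only [pa, norm_pr0]; linarith [hy.b0s]
  · simp only [pa, norm_pr0]; linarith [hy.b0t]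
  · simp only [pb, norm_0pr]; linarith [he.b1s]
  · simp only [pb, norm_0pr]; linarith [he.b1t]
  · exact max_le (hy.hm.trans m1) (he.hm.trans m2)
  · simp only [pa, pa_sub, norm_pr0]; exact hy.h0.trans m1
  · simp only [pb, pb_sub, norm_0pr]; exact he.h1.trans m2
  · have e : pu y e t - pu y e s - pa Y s xa - pb e' s xb =
      (y t - y s - Y s xa, e t - e s - e' s xb) := by
      ext <;> simp [pu, pa, pb]
    rw [e]
    exact max_le (hy1.trans m3) (he1.trans m4)

theorem DC.pair {l s t M N : ℝ} {xa xb : Fin d → ℝ} {y e : ℝ → W}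
    {Y e' : ℝ → (Fin d → ℝ) →L[ℝ] W} (hl : 0 ≤ l) (hy : DC l xa xb s t M y Y 0)
    (he : DC l xa xb s t N e 0 e') : DC l xa xb s t (M + N) (pu y e) (pa Y) (pb e') := by
  have hM := hy.nonneg
  have hN := he.nonneg
  refine ⟨hy.toDI.pair hl he.toDI, max_le ?_ ?_, max_le ?_ ?_⟩
  · exact hy.bs.trans (by linarith)
  · exact he.bs.trans (by linarith)
  · exact hy.bt.trans (by linarith)
  · exact he.bt.trans (by linarith)

variable (RP : DelayedRoughPath d r γ) (σ : W × W → (Fin d → ℝ) →L[ℝ] W)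

/-- The integrand. -/
def Yf (y e : ℝ → W) : ℝ → (Fin d → ℝ) →L[ℝ] W := fun τ => σ (y τ, e τ)

/-- compensated increment for the equation -/
def Xs (y e : ℝ → W) (e' : ℝ → (Fin d → ℝ) →L[ℝ] W) (s t : ℝ) : W :=
  Xi RP (Yf σ y e) (c0 σ (pu y e) (pa (Yf σ y e))) (c0 σ (pu y e) (pb e')) s t

theorem Xs_congr {y z e : ℝ → W} {e' : ℝ → (Fin d → ℝ) →L[ℝ] W} {s t : ℝ} (h : y s = z s) :
    Xs RP σ y e e' s t = Xs RP σ z e e' s t := by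
  simp only [Xs, Xi, Yf, c0, pu, pa, pb, h]

/-- one step of the Euler scheme -/
def phi (e : ℝ → W) (e' : ℝ → (Fin d → ℝ) →L[ℝ] W) (s t : ℝ) (x : W) : W :=
  x + Xs RP σ (fun _ => x) e e' s t

variable {RP σ} {B : ℝ}

theorem phi_eq {y e : ℝ → W} {e' : ℝ → (Fin d → ℝ) →L[ℝ] W} {s t : ℝ} :
    phi RP σ e e' s t (y s) = y s + Xs RP σ y e e' s t := by
  rw [phi]; exact congrArg (fun x => y s + x) (Xs_congr RP σ rfl)

theorem c0_bounds (hσ : C3b B σ) {y e : ℝ → W} {Y e' : ℝ → (Fin d → ℝ) →L[ℝ] W} {s D M : ℝ}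
    (hY : ‖Y s‖ ≤ D) (he' : ‖e' s‖ ≤ M) :
    ‖c0 σ (pu y e) (pa Y) s‖ ≤ B * D ∧ ‖c0 σ (pu y e) (pb e') s‖ ≤ B * M := by
  have hB := hσ.g.nonneg
  constructor
  · refine (ContinuousLinearMap.opNorm_comp_le _ _).trans ?_
    rw [pa, norm_pr0]
    gcongr
    exact hσ.g.b1 _
  · refine (ContinuousLinearMap.opNorm_comp_le _ _).trans ?_
    rw [pb, norm_0pr]
    gcongr
    exact hσ.g.b1 _

/-- Davie estimate implies controlled bounds on a pair -/
theorem lemQ (hβ : 0 < β) (hσ : C3b B σ) {h C M s t : ℝ} (hS : Small RP β h 1) (hh : h ^ β ≤ 1)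
    (hC : 0 ≤ C) {y e : ℝ → W} {e' : ℝ → (Fin d → ℝ) →L[ℝ] W} (hs : 0 ≤ s) (hst : s ≤ t)
    (ht : t ≤ r) (hts : t - s ≤ h) (he : DCp RP β s t M e 0 e')
    (hy : ‖y t - y s - Xs RP σ y e e' s t‖ ≤ C * ((t - s) ^ β) ^ 3) :
    DI ((t - s) ^ β) (RP.X t - RP.X s) (RP.X (t - r) - RP.X (s - r)) s t
      ((1 + B) * (C + 2 * B + M + 2 * d ^ 2 * (B * (B + M)))) y (Yf σ y e) 0 := by
  have hB := hσ.g.nonneg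
  have hM := he.nonneg
  have hl := ell_nonneg hst β
  have hl1 : (t - s) ^ β ≤ 1 := (Real.rpow_le_rpow (by linarith) hts hβ.le).trans hh
  obtain ⟨b1, b2, -, -⟩ := hS s t hs hst (by linarith) hts
  obtain ⟨q0, q1⟩ := c0_bounds (y := y) (e := e) (Y := Yf σ y e) (s := s) hσ
    (hσ.g.b0 (y s, e s)) he.b1s
  have hX := Xi_bound2 (V := Yf σ y e) (D := B * (B + M)) hS hs hst ht hts
    (q0.trans (by gcongr; linarith)) (q1.trans (by gcongr; linarith))
  have hem := he.hm
  have hed : ∀ τ, ‖Yf σ y e τ‖ ≤ B := fun τ => hσ.g.b0 _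
  have hlip : ‖Yf σ y e t - Yf σ y e s‖ ≤ B * max ‖y t - y s‖ ‖e t - e s‖ := hσ.g.lip0 _ _
  set D := 2 * d ^ 2 * (B * (B + M)) with hD
  have hD0 : 0 ≤ D := by positivity
  have hrem : ‖y t - y s - Yf σ y e s (RP.X t - RP.X s)‖ ≤ (C + D) * ((t - s) ^ β) ^ 2 := by
    have e : y t - y s - Yf σ y e s (RP.X t - RP.X s) = (y t - y s - Xs RP σ y e e' s t) +
      (Xs RP σ y e e' s t - Yf σ y e s (RP.X t - RP.X s)) := by abel
    rw [e]
    refine (norm_add_le_of_le hy hX).trans ?_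
    generalize (t - s) ^ β = l at *
    calc C * l ^ 3 + D * 1 * l ^ 2 = C * l ^ 2 * l + D * l ^ 2 := by ring
      _ ≤ C * l ^ 2 * 1 + D * l ^ 2 := by gcongr
      _ = _ := by ring
  have hinc : ‖y t - y s‖ ≤ (C + D + B) * (t - s) ^ β := by
    have e : y t - y s = (y t - y s - Yf σ y e s (RP.X t - RP.X s))
      + Yf σ y e s (RP.X t - RP.X s) := by abel
    rw [e]
    refine (norm_add_le_of_le hrem (clm_le (hed s) b1)).trans ?_
    generalize (t - s) ^ β = l at *
    calc (C + D) * l ^ 2 + B * (1 * l) = (C + D) * l * l + B * l := by ring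
      _ ≤ (C + D) * 1 * l + B * l := by gcongr
      _ = _ := by ring
  generalize (t - s) ^ β = l at *
  set R := C + 2 * B + M + D with hR
  have hR0 : 0 ≤ R := by positivity
  have hBR : 0 ≤ B * R := by positivity
  refine ⟨?_, ?_, ?_, ?_, ?_, ?_, ?_, ?_⟩
  · refine (hed s).trans ?_; linarith
  · refine (hed t).trans ?_; linarith
  · simp only [Pi.zero_apply, norm_zero]; positivity
  · simp only [Pi.zero_apply, norm_zero]; positivity
  · refine hinc.trans ?_; gcongr; linarith
  · refine hlip.trans ?_
    have : max ‖y t - y s‖ ‖e t - e s‖ ≤ R * l := by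
      refine max_le (hinc.trans ?_) (hem.trans ?_) <;> gcongr <;> linarith
    calc B * max ‖y t - y s‖ ‖e t - e s‖ ≤ B * (R * l) := by gcongr
      _ ≤ _ := by
        have : 0 ≤ R * l := by positivity
        linarith
  · simp only [Pi.zero_apply, sub_self, norm_zero]; positivity
  · simp only [Pi.zero_apply, _root_.zero_apply, sub_zero]
    refine hrem.trans ?_
    gcongr
    linarith

theorem phi_self {e : ℝ → W} {e' : ℝ → (Fin d → ℝ) →L[ℝ] W} (s : ℝ) (x : W) :
    phi RP σ e e' s s x = x := by
  rw [phi, Xs, Xi_self, add_zero]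

/-- almost flow property -/
theorem phi_comp (hβ : 0 < β) (hσ : C3b B σ) {h M s u t : ℝ} (hS : Small RP β h 1)
    (hh : h ^ β ≤ 1) {e : ℝ → W} {e' : ℝ → (Fin d → ℝ) →L[ℝ] W} (hs : 0 ≤ s) (hsu : s ≤ u)
    (hut : u ≤ t) (ht : t ≤ r) (hts : t - s ≤ h) (he : DCp RP β s u M e 0 e') (x : W) :
    ‖phi RP σ e e' u t (phi RP σ e e' s u x) - phi RP σ e e' s t x‖ ≤
      (1 + 2 * d ^ 2) * (B * (1 + ((1 + B) * (0 + 2 * B + M + 2 * d ^ 2 * (B * (B + M))) + M)) ^ 2)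
        * ((t - s) ^ β) ^ 3 := by
  set y : ℝ → W := Function.update (fun _ => x) u (phi RP σ e e' s u x) with hyd
  have hyu : y u = phi RP σ e e' s u x := by simp [hyd]
  have hys : y s = x := by
    by_cases hc : s = u
    · subst hc; rw [hyu, phi_self]
    · simp [hyd, hc]
  have hyi : y u = y s + Xs RP σ y e e' s u := by
    rw [hyu, ← phi_eq, hys]
  have hQ := lemQ (C := 0) (y := y) hβ hσ hS hh le_rfl hs hsu (by linarith) (by linarith) he (by
    rw [hyi]; simp)
  have hQ2 := (hQ.pair (ell_nonneg hsu β) he.toDI).compose (ell_nonneg hsu β) hσ.g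
  have := Xi_delta_bound hβ hS hs hsu hut ht hts zero_le_one hQ2.toDI
  rw [mul_one] at this
  refine le_trans (le_of_eq ?_) this
  rw [← norm_neg]
  congr 1
  have e1 : phi RP σ e e' s t x = y s + Xs RP σ y e e' s t := by rw [← phi_eq, hys]
  have e2 : phi RP σ e e' u t (phi RP σ e e' s u x) = y u + Xs RP σ y e e' u t := by
    rw [← phi_eq, hyu]
  rw [e1, e2, hyi]
  simp only [Xs]
  have e3 : (fun τ => σ (pu y e τ)) = Yf σ y e := rfl
  rw [e3]
  unfold c0
  abel

/-- Lipschitz property of the almost flow -/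
theorem phi_lip (hβ : 0 < β) (hσ : C3b B σ) {h η M s t : ℝ} (hS : Small RP β h η)
    (hη : 0 ≤ η) (hh : h ^ β ≤ 1) {e : ℝ → W} {e' : ℝ → (Fin d → ℝ) →L[ℝ] W} (hs : 0 ≤ s)
    (hst : s ≤ t) (ht : t ≤ r) (hts : t - s ≤ h) (he : ‖e' s‖ ≤ M) (x z : W) :
    ‖phi RP σ e e' s t x - phi RP σ e e' s t z‖ ≤
      (1 + (1 + 2 * d ^ 2) * (4 * (B * (1 + (B + M)) ^ 2) * (1 + B)) * η) * ‖x - z‖ := by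
  have hB := hσ.g.nonneg
  have hM : 0 ≤ M := (norm_nonneg _).trans he
  have hl := ell_nonneg hst β
  have hl1 : (t - s) ^ β ≤ 1 := (Real.rpow_le_rpow (by linarith) hts hβ.le).trans hh
  have hdi : ∀ w : W, DI (0:ℝ) (0 : Fin d → ℝ) 0 s s (B + M) (pu (fun _ => w) e)
      (pa (Yf σ (fun _ => w) e)) (pb e') := by
    intro w
    have hb : ‖Yf σ (fun _ => w) e s‖ ≤ B := hσ.g.b0 _
    refine ⟨?_, ?_, ?_, ?_, ?_, ?_, ?_, ?_⟩
    · simp only [pa, norm_pr0]; linarith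
    · simp only [pa, norm_pr0]; linarith
    · simp only [pb, norm_0pr]; linarith
    · simp only [pb, norm_0pr]; linarith
    all_goals simp
  have hlip : ‖Yf σ (fun _ => x) e s - Yf σ (fun _ => z) e s‖ ≤ B * ‖x - z‖ := by
    refine (hσ.g.lip0 _ _).trans ?_
    gcongr
    simp [Prod.norm_def]
  have hdc : DC (0:ℝ) (0 : Fin d → ℝ) 0 s s ((1 + B) * ‖x - z‖)
      (fun τ => pu (fun _ => x) e τ - pu (fun _ => z) e τ)
      (fun τ => pa (Yf σ (fun _ => x) e) τ - pa (Yf σ (fun _ => z) e) τ)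
      (fun τ => pb e' τ - pb e' τ) := by
    have hz : 0 ≤ B * ‖x - z‖ := by positivity
    have hx : ‖pu (fun _ => x) e s - pu (fun _ => z) e s‖ ≤ (1 + B) * ‖x - z‖ := by
      simp [pu, Prod.norm_def]; linarith
    refine ⟨⟨?_, ?_, ?_, ?_, ?_, ?_, ?_, ?_⟩, hx, hx⟩
    · simp only [pa, pa_sub, norm_pr0]; refine hlip.trans ?_; linarith [norm_nonneg (x - z)]
    · simp only [pa, pa_sub, norm_pr0]; refine hlip.trans ?_; linarith [norm_nonneg (x - z)]
    · simp; positivity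
    · simp; positivity
    all_goals simp
  have key := hσ.lipschitz le_rfl (hdi z) (hdi x) hdc
  set L := 4 * (B * (1 + (B + M)) ^ 2) * (1 + B) with hLd
  have hL0 : 0 ≤ L := by positivity
  have eL : 4 * (B * (1 + (B + M)) ^ 2) * ((1 + B) * ‖x - z‖) = L * ‖x - z‖ := by rw [hLd]; ring
  rw [eL] at key
  obtain ⟨b1, -, b3, b4⟩ := hS s t hs hst (by linarith) hts
  have e1 : phi RP σ e e' s t x - phi RP σ e e' s t z = (x - z) +
      ((σ (pu (fun _ => x) e s) - σ (pu (fun _ => z) e s)) (RP.X t - RP.X s) +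
      apply2 (c0 σ (pu (fun _ => x) e) (pa (Yf σ (fun _ => x) e)) s
        - c0 σ (pu (fun _ => z) e) (pa (Yf σ (fun _ => z) e)) s) (RP.XX s t) +
      apply2 (c0 σ (pu (fun _ => x) e) (pb e') s
        - c0 σ (pu (fun _ => z) e) (pb e') s) (RP.XXd s t)) := by
    simp only [phi, Xs, Xi, apply2_sub, _root_.sub_apply, Yf, pu]
    abel
  rw [e1]
  have k1 : ‖(σ (pu (fun _ => x) e s) - σ (pu (fun _ => z) e s)) (RP.X t - RP.X s)‖ ≤
      L * ‖x - z‖ * (η * 1) := clm_le key.bs (b1.trans (by gcongr))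
  have k2 := (apply2_le (c0 σ (pu (fun _ => x) e) (pa (Yf σ (fun _ => x) e)) s
        - c0 σ (pu (fun _ => z) e) (pa (Yf σ (fun _ => z) e)) s) (RP.XX s t)).trans
    (mul_le_mul_of_nonneg_left (mul_le_mul key.b0s (b3.trans
      (mul_le_mul_of_nonneg_left (pow_le_one₀ hl hl1) hη)) (norm_nonneg _) (by positivity))
      (by positivity))
  have k3 := (apply2_le (c0 σ (pu (fun _ => x) e) (pb e') s
        - c0 σ (pu (fun _ => z) e) (pb e') s) (RP.XXd s t)).trans
    (mul_le_mul_of_nonneg_left (mul_le_mul key.b1s (b4.trans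
      (mul_le_mul_of_nonneg_left (pow_le_one₀ hl hl1) hη)) (norm_nonneg _) (by positivity))
      (by positivity))
  refine (norm_add_le_of_le le_rfl (norm_add_le_of_le (norm_add_le_of_le k1 k2) k3)).trans
    (le_of_eq ?_)
  ring

end Euler
end SDDE

namespace SDDE
open Set Filter Topology
set_option maxSynthPendingDepth 3

section Exist

variable {d : ℕ} {r γ β : ℝ} {W : Type*} [NormedAddCommGroup W] [NormedSpace ℝ W]

/-- contraction factor for the Euler scheme -/
def qf (β : ℝ) : ℝ := (2 / 3 : ℝ) ^ (3 * β - 1)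

theorem qf_pos : 0 < qf β := by unfold qf; positivity

theorem qf_lt_one (hβ : 1 / 3 < β) : qf β < 1 :=
  Real.rpow_lt_one (by norm_num) (by norm_num) (by linarith)

theorem cube_eq {x : ℝ} (hβ : 1 / 3 < β) (hx : 0 ≤ x) : (x ^ β) ^ 3 = x * x ^ (3 * β - 1) := by
  rcases hx.eq_or_lt with h | h
  · rw [← h, Real.zero_rpow (by linarith)]; simp
  · rw [← Real.rpow_natCast, ← Real.rpow_mul hx]
    nth_rewrite 2 [← Real.rpow_one x]
    rw [← Real.rpow_add h]
    congr 1; push_cast; ring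

theorem sum_cubes {x z : ℝ} (hβ : 1 / 3 < β) (hx : 0 ≤ x) (hz : 0 ≤ z)
    (h1 : x ≤ 2 / 3 * (x + z)) (h2 : z ≤ 2 / 3 * (x + z)) :
    (x ^ β) ^ 3 + (z ^ β) ^ 3 ≤ qf β * ((x + z) ^ β) ^ 3 := by
  rw [cube_eq hβ hx, cube_eq hβ hz, cube_eq hβ (by linarith : 0 ≤ x + z)]
  have e : qf β * (x + z) ^ (3 * β - 1) = (2 / 3 * (x + z)) ^ (3 * β - 1) := by
    rw [qf, Real.mul_rpow (by norm_num) (by linarith)]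
  have k1 : x ^ (3 * β - 1) ≤ qf β * (x + z) ^ (3 * β - 1) := by
    rw [e]; exact Real.rpow_le_rpow hx h1 (by linarith)
  have k2 : z ^ (3 * β - 1) ≤ qf β * (x + z) ^ (3 * β - 1) := by
    rw [e]; exact Real.rpow_le_rpow hz h2 (by linarith)
  have m1 := mul_le_mul_of_nonneg_left k1 hx
  have m2 := mul_le_mul_of_nonneg_left k2 hz
  linarith

/-- The discrete Davie estimate. -/
theorem euler_est {φ : ℝ → ℝ → W → W} {h δ K L C : ℝ} (hβ : 1 / 3 < β) (hδ : 0 < δ)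
    (hK : ∀ s u t, 0 ≤ s → s ≤ u → u ≤ t → t ≤ r → t - s ≤ h → ∀ x,
      ‖φ u t (φ s u x) - φ s t x‖ ≤ K * ((t - s) ^ β) ^ 3)
    (hL : ∀ s t, 0 ≤ s → s ≤ t → t ≤ r → t - s ≤ h → ∀ x z,
      ‖φ s t x - φ s t z‖ ≤ L * ‖x - z‖)
    (hφ : ∀ s x, φ s s x = x)
    (hL1 : 1 ≤ L) (hC : 0 ≤ C) (hKC : qf β * L * C + K ≤ C) {Y : ℕ → W}
    (hY : ∀ k : ℕ, Y (k + 1) = φ (k * δ) ((k + 1 : ℕ) * δ) (Y k)) :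
    ∀ m i j : ℕ, i + m = j → (j : ℝ) * δ ≤ r → (j : ℝ) * δ - i * δ ≤ h →
      ‖Y j - φ (i * δ) (j * δ) (Y i)‖ ≤ C * (((j : ℝ) * δ - i * δ) ^ β) ^ 3 := by
  intro m
  induction m using Nat.strong_induction_on with
  | _ m ih =>
  intro i j hij hj hh
  have hnn : 0 ≤ C * (((j : ℝ) * δ - i * δ) ^ β) ^ 3 := by
    have : (i : ℝ) * δ ≤ j * δ := by
      have : (i : ℝ) ≤ j := by exact_mod_cast (by omega : i ≤ j)
      gcongr
    have := ell_nonneg this β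
    positivity
  rcases Nat.lt_or_ge m 2 with hm | hm
  · interval_cases m
    · have : i = j := by omega
      subst this
      rw [hφ, sub_self, norm_zero]; exact hnn
    · have : j = i + 1 := by omega
      subst this
      rw [hY, sub_self, norm_zero]; exact hnn
  · obtain ⟨k, hk⟩ : ∃ k, k = i + m / 2 := ⟨_, rfl⟩
    have n1 : i + m / 2 = k := hk.symm
    have n2 : k + (m - m / 2) = j := by omega
    have c1 : 3 * (k - i : ℕ) ≤ 2 * m := by omega
    have c2 : 3 * (j - k : ℕ) ≤ 2 * m := by omega
    have r1 : 3 * ((k : ℝ) - i) ≤ 2 * ((j : ℝ) - i) := by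
      have : 3 * (k : ℝ) + 2 * i ≤ 2 * j + 3 * i := by exact_mod_cast (by omega : 3 * k + 2 * i ≤ 2 * j + 3 * i)
      linarith
    have r2 : 3 * ((j : ℝ) - k) ≤ 2 * ((j : ℝ) - i) := by
      have : 3 * (j : ℝ) + 2 * i ≤ 2 * j + 3 * k := by exact_mod_cast (by omega : 3 * j + 2 * i ≤ 2 * j + 3 * k)
      linarith
    have hik : (i : ℝ) ≤ k := by exact_mod_cast (by omega : i ≤ k)
    have hkj : (k : ℝ) ≤ j := by exact_mod_cast (by omega : k ≤ j)
    have hik' : (i : ℝ) * δ ≤ k * δ := by gcongr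
    have hkj' : (k : ℝ) * δ ≤ j * δ := by gcongr
    have hi0 : 0 ≤ (i : ℝ) * δ := by positivity
    have I1 := ih (m / 2) (by omega) i k n1 (by linarith) (by linarith)
    have I2 := ih (m - m / 2) (by omega) k j n2 hj (by linarith)
    have K1 := hK _ _ _ hi0 hik' hkj' hj hh (Y i)
    have L1 := hL _ _ (by linarith) hkj' hj (by linarith) (Y k) (φ (i * δ) (k * δ) (Y i))
    have S := sum_cubes (x := (k : ℝ) * δ - i * δ) (z := (j : ℝ) * δ - k * δ) hβ (by linarith)
      (by linarith) (by nlinarith) (by nlinarith)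
    rw [show (k : ℝ) * δ - i * δ + (j * δ - k * δ) = j * δ - i * δ by ring] at S
    have e : Y j - φ (i * δ) (j * δ) (Y i) = (Y j - φ (k * δ) (j * δ) (Y k)) +
        (φ (k * δ) (j * δ) (Y k) - φ (k * δ) (j * δ) (φ (i * δ) (k * δ) (Y i))) +
        (φ (k * δ) (j * δ) (φ (i * δ) (k * δ) (Y i)) - φ (i * δ) (j * δ) (Y i)) := by abel
    rw [e]
    refine (norm_add_le_of_le (norm_add_le_of_le I2 (L1.trans
      (mul_le_mul_of_nonneg_left I1 (by linarith)))) K1).trans ?_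
    have p1 := ell_nonneg hik' β
    have p2 := ell_nonneg hkj' β
    have p3 := ell_nonneg (hik'.trans hkj') β
    generalize ((k : ℝ) * δ - i * δ) ^ β = a at *
    generalize ((j : ℝ) * δ - k * δ) ^ β = b at *
    generalize ((j : ℝ) * δ - i * δ) ^ β = c at *
    calc C * b ^ 3 + L * (C * a ^ 3) + K * c ^ 3 ≤ L * (C * b ^ 3) + L * (C * a ^ 3) + K * c ^ 3 := by
          have : 0 ≤ C * b ^ 3 := by positivity
          nlinarith
      _ = L * C * (a ^ 3 + b ^ 3) + K * c ^ 3 := by ring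
      _ ≤ L * C * (qf β * c ^ 3) + K * c ^ 3 := by gcongr
      _ = (qf β * L * C + K) * c ^ 3 := by ring
      _ ≤ C * c ^ 3 := by gcongr

/-- uniform bound by chunks -/
theorem euler_bdd {h δ A : ℝ} (hδ : 0 < δ) (hh : 0 < h) (hδh : δ ≤ h / 2) (hA : 0 ≤ A) {Y : ℕ → W}
    (hY : ∀ i j : ℕ, i ≤ j → (j : ℝ) * δ ≤ r → (j : ℝ) * δ - i * δ ≤ h → ‖Y j - Y i‖ ≤ A) :
    ∀ k : ℕ, (k : ℝ) * δ ≤ r → ‖Y k‖ ≤ ‖Y 0‖ + A * (1 + 2 * (k * δ) / h) := by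
  intro k
  induction k using Nat.strong_induction_on with
  | _ k ih =>
  intro hk
  by_cases hc : (k : ℝ) * δ ≤ h
  · have := hY 0 k (Nat.zero_le _) hk (by simpa using hc)
    have e : Y k = Y 0 + (Y k - Y 0) := by abel
    rw [e]
    refine (norm_add_le_of_le le_rfl this).trans ?_
    have : 0 ≤ A * (2 * (k * δ) / h) := by positivity
    linarith
  · push Not at hc
    set m := ⌊h / δ⌋₊ with hm
    have m1 : (m : ℝ) * δ ≤ h := by
      rw [← le_div_iff₀ hδ]; exact Nat.floor_le (by positivity)
    have m2 : h < (m + 1 : ℝ) * δ := by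
      rw [← div_lt_iff₀ hδ]; exact Nat.lt_floor_add_one _
    have m3 : h / 2 ≤ m * δ := by linarith
    have hm0 : 0 < m := by
      by_contra h0
      have : m = 0 := by omega
      rw [this] at m3; norm_num at m3; linarith
    have hmk : m ≤ k := by
      have : (m : ℝ) * δ ≤ k * δ := by linarith
      exact_mod_cast le_of_mul_le_mul_right this hδ
    have e1 : ((k - m : ℕ) : ℝ) = k - m := by rw [Nat.cast_sub hmk]
    have hmd : 0 ≤ (m : ℝ) * δ := by positivity
    have I := ih (k - m) (by omega) (by rw [e1]; linarith)
    have J := hY (k - m) k (by omega) hk (by rw [e1]; linarith)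
    have e : Y k = Y (k - m) + (Y k - Y (k - m)) := by abel
    rw [e]
    refine (norm_add_le_of_le I J).trans ?_
    rw [e1]
    have : 1 ≤ 2 * (m * δ) / h := by rw [le_div_iff₀ hh]; linarith
    have e2 : 2 * (((k : ℝ) - m) * δ) / h = 2 * (k * δ) / h - 2 * (m * δ) / h := by ring
    rw [e2]
    nlinarith

end Exist
end SDDE

namespace SDDE
open Set Filter Topology
set_option maxSynthPendingDepth 3

section Exist2

set_option linter.unusedSectionVars false

variable {d : ℕ} {r γ β : ℝ} {W : Type*} [NormedAddCommGroup W] [NormedSpace ℝ W]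
variable {E : Type*} [NormedAddCommGroup E] [NormedSpace ℝ E]

theorem contOn_of_ell {f : ℝ → E} {M : ℝ} (hβ : 0 < β)
    (h : ∀ s t, 0 ≤ s → s ≤ t → t ≤ r → ‖f t - f s‖ ≤ M * (t - s) ^ β) :
    ContinuousOn f (Icc 0 r) := by
  have h2 : ∀ s ∈ Icc 0 r, ∀ t ∈ Icc 0 r, ‖f t - f s‖ ≤ M * |t - s| ^ β := by
    intro s hs t ht
    rcases le_total s t with hst | hst
    · rw [abs_of_nonneg (by linarith)]; exact h s t hs.1 hst ht.2
    · rw [abs_sub_comm, norm_sub_rev, abs_of_nonneg (by linarith)]; exact h t s ht.1 hst hs.2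
  intro s hs
  rw [ContinuousWithinAt, tendsto_iff_norm_sub_tendsto_zero]
  have lim : Tendsto (fun t => M * |t - s| ^ β) (𝓝[Icc 0 r] s) (𝓝 0) := by
    have : Tendsto (fun t => M * |t - s| ^ β) (𝓝 s) (𝓝 (M * |s - s| ^ β)) := by
      apply Continuous.tendsto
      exact continuous_const.mul (Continuous.rpow_const (by fun_prop) (fun _ => Or.inr hβ.le))
    rw [sub_self, abs_zero, Real.zero_rpow hβ.ne', mul_zero] at this
    exact this.mono_left nhdsWithin_le_nhds
  refine squeeze_zero' (Eventually.of_forall fun _ => norm_nonneg _) ?_ lim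
  filter_upwards [self_mem_nhdsWithin] with t ht
  exact h2 s hs t ht

theorem contX (RP : DelayedRoughPath d r γ) (hγ : 0 < γ) : Continuous RP.X := by
  rw [continuous_iff_continuousAt]
  intro x
  obtain ⟨C, hC⟩ := RP.holX (x - 1) (x + 1)
  have : ∀ t ∈ Icc (x - 1) (x + 1), ‖RP.X t - RP.X x‖ ≤ C * |t - x| ^ γ := fun t ht =>
    hC x ⟨by linarith, by linarith⟩ t ht
  rw [ContinuousAt, tendsto_iff_norm_sub_tendsto_zero]
  have lim : Tendsto (fun t => C * |t - x| ^ γ) (𝓝 x) (𝓝 0) := by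
    have : Tendsto (fun t => C * |t - x| ^ γ) (𝓝 x) (𝓝 (C * |x - x| ^ γ)) := by
      apply Continuous.tendsto
      exact continuous_const.mul (Continuous.rpow_const (by fun_prop) (fun _ => Or.inr hγ.le))
    rwa [sub_self, abs_zero, Real.zero_rpow hγ.ne', mul_zero] at this
  refine squeeze_zero' (Eventually.of_forall fun _ => norm_nonneg _) ?_ lim
  filter_upwards [Icc_mem_nhds (by linarith : x - 1 < x) (by linarith : x < x + 1)] with t ht
  exact this t ht

theorem td_app {ι : Type*} {l : Filter ι} {E F : Type*} [NormedAddCommGroup E] [NormedSpace ℝ E]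
    [NormedAddCommGroup F] [NormedSpace ℝ F] {f : ι → E →L[ℝ] F} {x : ι → E} {f' x'}
    (hf : Tendsto f l (𝓝 f')) (hx : Tendsto x l (𝓝 x')) :
    Tendsto (fun i => f i (x i)) l (𝓝 (f' x')) :=
  (isBoundedBilinearMap_apply.continuous.tendsto (f', x')).comp (hf.prodMk_nhds hx)

theorem td_comp {ι : Type*} {l : Filter ι} {E F G : Type*} [NormedAddCommGroup E] [NormedSpace ℝ E]
    [NormedAddCommGroup F] [NormedSpace ℝ F] [NormedAddCommGroup G] [NormedSpace ℝ G]
    {f : ι → F →L[ℝ] G} {x : ι → E →L[ℝ] F} {f' x'}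
    (hf : Tendsto f l (𝓝 f')) (hx : Tendsto x l (𝓝 x')) :
    Tendsto (fun i => (f i).comp (x i)) l (𝓝 (f'.comp x')) :=
  (isBoundedBilinearMap_comp.continuous.tendsto (f', x')).comp (hf.prodMk_nhds hx)

theorem tendsto_apply2 {ι : Type*} {l : Filter ι}
    {z : ι → (Fin d → ℝ) →L[ℝ] ((Fin d → ℝ) →L[ℝ] E)} {N : ι → Fin d → Fin d → ℝ} {z' N'}
    (hz : Tendsto z l (𝓝 z')) (hN : Tendsto N l (𝓝 N')) :
    Tendsto (fun i => apply2 (z i) (N i)) l (𝓝 (apply2 z' N')) := by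
  unfold apply2
  refine tendsto_finsetSum _ fun i _ => tendsto_finsetSum _ fun j _ => ?_
  refine Tendsto.smul ?_ ?_
  · exact tendsto_pi_nhds.1 (tendsto_pi_nhds.1 hN i) j
  · exact td_app (td_app hz tendsto_const_nhds) tendsto_const_nhds

theorem tendsto_Xi {ι : Type*} {l : Filter ι} (RP : DelayedRoughPath d r γ) (hγ : 0 < γ)
    {V : ι → ℝ → (Fin d → ℝ) →L[ℝ] E} {z0 z1 : ι → ℝ → (Fin d → ℝ) →L[ℝ] ((Fin d → ℝ) →L[ℝ] E)}
    {V' z0' z1'} {sn tn : ι → ℝ} {s t : ℝ} (hs : Tendsto sn l (𝓝 s)) (ht : Tendsto tn l (𝓝 t))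
    (hV : Tendsto (fun i => V i (sn i)) l (𝓝 (V' s)))
    (h0 : Tendsto (fun i => z0 i (sn i)) l (𝓝 (z0' s)))
    (h1 : Tendsto (fun i => z1 i (sn i)) l (𝓝 (z1' s))) :
    Tendsto (fun i => Xi RP (V i) (z0 i) (z1 i) (sn i) (tn i)) l (𝓝 (Xi RP V' z0' z1' s t)) := by
  have hX := contX RP hγ
  unfold Xi
  refine Tendsto.add (Tendsto.add ?_ ?_) ?_
  · exact td_app hV (((hX.tendsto t).comp ht).sub ((hX.tendsto s).comp hs))
  · exact tendsto_apply2 h0 ((RP.contXX.tendsto (s, t)).comp (hs.prodMk_nhds ht))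
  · exact tendsto_apply2 h1 ((RP.contXXd.tendsto (s, t)).comp (hs.prodMk_nhds ht))

variable {RP : DelayedRoughPath d r γ} {σ : W × W → (Fin d → ℝ) →L[ℝ] W} {B : ℝ}

theorem C3b.contσ (hσ : C3b B σ) : Continuous σ := hσ.g.d1.continuous
theorem C3b.contdσ (hσ : C3b B σ) : Continuous (fderiv ℝ σ) := hσ.dg.d1.continuous

theorem tendsto_c0 {ι : Type*} {l : Filter ι} (hσ : C3b B σ) {u : ι → ℝ → W × W}
    {u0 : ι → ℝ → (Fin d → ℝ) →L[ℝ] W × W} {sn : ι → ℝ} {s : ℝ} {u' u0'}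
    (hu : Tendsto (fun i => u i (sn i)) l (𝓝 (u' s)))
    (hu0 : Tendsto (fun i => u0 i (sn i)) l (𝓝 (u0' s))) :
    Tendsto (fun i => c0 σ (u i) (u0 i) (sn i)) l (𝓝 (c0 σ u' u0' s)) := by
  unfold c0
  exact td_comp ((hσ.contdσ.tendsto _).comp hu) hu0

theorem tendsto_pr {ι : Type*} {l : Filter ι} {f g : ι → (Fin d → ℝ) →L[ℝ] W} {f' g'}
    (hf : Tendsto f l (𝓝 f')) (hg : Tendsto g l (𝓝 g')) :
    Tendsto (fun i => (f i).prod (g i)) l (𝓝 (f'.prod g')) := by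
  have e : ∀ f g : (Fin d → ℝ) →L[ℝ] W, f.prod g = (ContinuousLinearMap.inl ℝ W W).comp f +
      (ContinuousLinearMap.inr ℝ W W).comp g := by
    intro f g; ext x <;> simp
  simp only [e]
  exact (td_comp tendsto_const_nhds hf).add (td_comp tendsto_const_nhds hg)

theorem tendsto_Xs {ι : Type*} {l : Filter ι} (hγ : 0 < γ) (hσ : C3b B σ)
    {y e : ι → ℝ → W} {e' : ι → ℝ → (Fin d → ℝ) →L[ℝ] W} {y' g : ℝ → W}
    {g' : ℝ → (Fin d → ℝ) →L[ℝ] W}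
    {sn tn : ι → ℝ} {s t : ℝ} (hs : Tendsto sn l (𝓝 s)) (ht : Tendsto tn l (𝓝 t))
    (hy : Tendsto (fun i => y i (sn i)) l (𝓝 (y' s)))
    (he : Tendsto (fun i => e i (sn i)) l (𝓝 (g s)))
    (he' : Tendsto (fun i => e' i (sn i)) l (𝓝 (g' s))) :
    Tendsto (fun i => Xs RP σ (y i) (e i) (e' i) (sn i) (tn i)) l (𝓝 (Xs RP σ y' g g' s t)) := by
  have hu : Tendsto (fun i => pu (y i) (e i) (sn i)) l (𝓝 (pu y' g s)) := hy.prodMk_nhds he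
  have hY : Tendsto (fun i => Yf σ (y i) (e i) (sn i)) l (𝓝 (Yf σ y' g s)) :=
    (hσ.contσ.tendsto (y' s, g s)).comp (hy.prodMk_nhds he)
  unfold Xs
  refine tendsto_Xi (V := fun i => Yf σ (y i) (e i))
    (z0 := fun i => c0 σ (pu (y i) (e i)) (pa (Yf σ (y i) (e i))))
    (z1 := fun i => c0 σ (pu (y i) (e i)) (pb (e' i))) RP hγ hs ht hY ?_ ?_
  · exact tendsto_c0 (u := fun i => pu (y i) (e i)) (u0 := fun i => (pa (Yf σ (y i) (e i))))
      hσ hu (tendsto_pr hY tendsto_const_nhds)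
  · exact tendsto_c0 (u := fun i => pu (y i) (e i)) (u0 := fun i => pb (e' i))
      hσ hu (tendsto_pr tendsto_const_nhds he')

def euler (RP : DelayedRoughPath d r γ) (σ : W × W → (Fin d → ℝ) →L[ℝ] W) (e : ℝ → W)
    (e' : ℝ → (Fin d → ℝ) →L[ℝ] W) (δ : ℝ) (x0 : W) : ℕ → W
  | 0 => x0
  | k + 1 => phi RP σ e e' (k * δ) ((k + 1 : ℕ) * δ) (euler RP σ e e' δ x0 k)

theorem Xs_bound (hβ : 0 < β) (hσ : C3b B σ) {h M s t : ℝ} (hS : Small RP β h 1) (hh : h ^ β ≤ 1)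
    {y e : ℝ → W} {e' : ℝ → (Fin d → ℝ) →L[ℝ] W} (hs : 0 ≤ s) (hst : s ≤ t)
    (ht : t ≤ r) (hts : t - s ≤ h) (he : ‖e' s‖ ≤ M) :
    ‖Xs RP σ y e e' s t‖ ≤ B + 2 * d ^ 2 * (B * (B + M)) := by
  have hB := hσ.g.nonneg
  have hM : 0 ≤ M := (norm_nonneg _).trans he
  have hl := ell_nonneg hst β
  have hl1 : (t - s) ^ β ≤ 1 := (Real.rpow_le_rpow (by linarith) hts hβ.le).trans hh
  obtain ⟨b1, b2, -, -⟩ := hS s t hs hst (by linarith) hts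
  obtain ⟨q0, q1⟩ := c0_bounds (y := y) (e := e) (Y := Yf σ y e) (s := s) hσ
    (hσ.g.b0 (y s, e s)) he
  have hX := Xi_bound2 (V := Yf σ y e) (D := B * (B + M)) hS hs hst ht hts
    (q0.trans (by gcongr; linarith)) (q1.trans (by gcongr; linarith))
  have hed : ‖Yf σ y e s‖ ≤ B := hσ.g.b0 _
  have e1 : Xs RP σ y e e' s t = Yf σ y e s (RP.X t - RP.X s) +
    (Xs RP σ y e e' s t - Yf σ y e s (RP.X t - RP.X s)) := by abel
  rw [e1]
  refine (norm_add_le_of_le (clm_le hed b1) hX).trans ?_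
  generalize (t - s) ^ β = l at *
  calc B * (1 * l) + 2 * d ^ 2 * (B * (B + M)) * 1 * l ^ 2
      ≤ B * (1 * 1) + 2 * d ^ 2 * (B * (B + M)) * 1 * 1 ^ 2 := by gcongr
    _ = _ := by ring

theorem ultra_lim [ProperSpace E] (U : Ultrafilter ℕ) {f : ℕ → E} {R : ℝ}
    (h : ∀ᶠ n in (U : Filter ℕ), ‖f n‖ ≤ R) : ∃ x, Tendsto f U (𝓝 x) := by
  have hc : IsCompact (Metric.closedBall (0 : E) R) := isCompact_closedBall _ _
  obtain ⟨x, -, hx⟩ := hc.ultrafilter_le_nhds (U.map f) (by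
    rw [le_principal_iff]
    show ∀ᶠ n in (U : Filter ℕ), f n ∈ Metric.closedBall (0 : E) R
    filter_upwards [h] with n hn
    simpa using hn)
  exact ⟨x, hx⟩

end Exist2
end SDDE

namespace SDDE
open Set Filter Topology
set_option maxSynthPendingDepth 3

section Exist3

set_option linter.unusedSectionVars false
variable {d : ℕ} {r γ β : ℝ} {W : Type*} [NormedAddCommGroup W] [NormedSpace ℝ W]
variable {RP : DelayedRoughPath d r γ} {σ : W × W → (Fin d → ℝ) →L[ℝ] W} {B : ℝ}

theorem Small.mono {h η η' : ℝ} (hS : Small RP β h η) (hη : η ≤ η') : Small RP β h η' := by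
  intro s t hs hst ht hts
  obtain ⟨b1, b2, b3, b4⟩ := hS s t hs hst ht hts
  have := ell_nonneg hst β
  exact ⟨b1.trans (by gcongr), b2.trans (by gcongr), b3.trans (by gcongr), b4.trans (by gcongr)⟩

/-- local existence at a small scale, uniformly -/
theorem exists_loc [ProperSpace W] (RP : DelayedRoughPath d r γ) (hr : 0 < r) (hβ : 1 / 3 < β)
    (hβγ : β < γ) (hσ : C3b B σ) (M : ℝ) (hM : 0 ≤ M) :
    ∃ h C R, 0 < h ∧ h ^ β ≤ 1 ∧ Small RP β h 1 ∧ 0 ≤ C ∧ ∀ (e : ℝ → W) (e' : ℝ → (Fin d → ℝ) →L[ℝ] W),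
      AllT RP β r r M e 0 e' → ∀ x0 : W, ‖x0‖ ≤ M →
      ∃ y : ℝ → W, y 0 = x0 ∧ (∀ t, 0 ≤ t → t ≤ r → ‖y t‖ ≤ R) ∧
        Davie RP β r h C y (Yf σ y e) (c0 σ (pu y e) (pa (Yf σ y e))) (c0 σ (pu y e) (pb e')) := by
  have hβ0 : 0 < β := by linarith
  have hB := hσ.g.nonneg
  have hq := qf_lt_one hβ
  have hq0 := qf_pos (β := β)
  obtain ⟨K0, hK0⟩ : ∃ K0 : ℝ, K0 = (1 + 2 * d ^ 2) * (B * (1 + ((1 + B) *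
    (0 + 2 * B + M + 2 * d ^ 2 * (B * (B + M))) + M)) ^ 2) := ⟨_, rfl⟩
  have hK0' : 0 ≤ K0 := by rw [hK0]; positivity
  obtain ⟨L0, hL0⟩ : ∃ L0 : ℝ, L0 = (1 + 2 * d ^ 2) * (4 * (B * (1 + (B + M)) ^ 2) * (1 + B)) :=
    ⟨_, rfl⟩
  have hL0' : 0 ≤ L0 := by rw [hL0]; positivity
  obtain ⟨ε, hε⟩ : ∃ ε : ℝ, ε = (1 - qf β) / 2 := ⟨_, rfl⟩
  have hε0 : 0 < ε := by rw [hε]; linarith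
  have hqε : qf β * (1 + ε) < 1 := by nlinarith
  obtain ⟨η, hη0, hη1, hη2⟩ : ∃ η : ℝ, 0 < η ∧ η ≤ 1 ∧ L0 * η ≤ ε := by
    refine ⟨min 1 (ε / (1 + L0)), lt_min one_pos (by positivity), min_le_left _ _, ?_⟩
    calc L0 * min 1 (ε / (1 + L0)) ≤ (1 + L0) * (ε / (1 + L0)) := by
          gcongr
          · linarith
          · exact min_le_right _ _
      _ = ε := by field_simp
  obtain ⟨h, hh0, hh1, hS, hhη⟩ := exists_small RP hβ0 hβγ η hη0
  have hS1 := hS.mono hη1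
  have hhb : h ^ β ≤ 1 := hhη.trans hη1
  obtain ⟨C, hC⟩ : ∃ C : ℝ, C = K0 / (1 - qf β * (1 + ε)) := ⟨_, rfl⟩
  have hC0 : 0 ≤ C := by rw [hC]; exact div_nonneg hK0' (by linarith)
  have hKC : qf β * (1 + ε) * C + K0 ≤ C := by
    have : C * (1 - qf β * (1 + ε)) = K0 := by rw [hC]; field_simp [(by linarith : 1 - qf β * (1 + ε) ≠ 0)]
    linarith
  obtain ⟨A, hA⟩ : ∃ A : ℝ, A = C + (B + 2 * d ^ 2 * (B * (B + M))) := ⟨_, rfl⟩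
  have hA0 : 0 ≤ A := by rw [hA]; positivity
  have hh2 : (h / 2) ^ β ≤ h ^ β := Real.rpow_le_rpow (by linarith) (by linarith) hβ0.le
  refine ⟨h / 2, C, M + A * (1 + 2 * r / h), by linarith, by linarith,
    fun s t hs hst ht hts => hS1 s t hs hst ht (by linarith), hC0, ?_⟩
  intro e e' he x0 hx0
  have he's : ∀ s, 0 ≤ s → s ≤ r → ‖e' s‖ ≤ M := fun s h1 h2 =>
    (he s s h1 le_rfl h2 (by linarith)).b1s
  have hec : ContinuousOn e (Icc 0 r) := contOn_of_ell hβ0 fun s t hs hst ht =>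
    (he s t hs hst ht (by linarith)).hm
  have hec' : ContinuousOn e' (Icc 0 r) := contOn_of_ell hβ0 fun s t hs hst ht =>
    (he s t hs hst ht (by linarith)).h1
  -- the scheme
  obtain ⟨δ, hδ⟩ : ∃ δ : ℕ → ℝ, δ = fun n : ℕ => (h / 2) * (1 / ((n : ℝ) + 1)) := ⟨_, rfl⟩
  have hδ0 : ∀ n, 0 < δ n := fun n => by rw [hδ]; positivity
  have hδh : ∀ n, δ n ≤ h / 2 := fun n => by
    rw [hδ]
    have : 1 / ((n : ℝ) + 1) ≤ 1 := by
      rw [div_le_one (by positivity)]; linarith [Nat.cast_nonneg (α := ℝ) n]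
    nlinarith
  have hδl : Tendsto δ atTop (𝓝 0) := by
    have := (tendsto_one_div_add_atTop_nhds_zero_nat (𝕜 := ℝ)).const_mul (h / 2)
    rw [mul_zero] at this
    rw [hδ]; exact this
  set Y : ℕ → ℕ → W := fun n => euler RP σ e e' (δ n) x0 with hYdef
  have est : ∀ n (i j : ℕ), i ≤ j → (j : ℝ) * δ n ≤ r → (j : ℝ) * δ n - i * δ n ≤ h →
      ‖Y n j - phi RP σ e e' (i * δ n) (j * δ n) (Y n i)‖
        ≤ C * (((j : ℝ) * δ n - i * δ n) ^ β) ^ 3 := by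
    intro n i j hij hj hh
    refine euler_est (r := r) (h := h) (K := K0) (L := 1 + ε) (φ := phi RP σ e e') hβ (hδ0 n) ?_ ?_ ?_
      (by linarith) hC0 hKC (fun k => rfl) (j - i) i j (by omega) hj hh
    · intro s u t hs hsu hut ht hts x
      rw [hK0]
      exact phi_comp hβ0 hσ hS1 hhb hs hsu hut ht hts (he s u hs hsu (by linarith) (by linarith)) x
    · intro s t hs hst ht hts x z
      refine (phi_lip hβ0 hσ hS hη0.le hhb hs hst ht hts (he's s hs (by linarith)) x z).trans ?_
      rw [← hL0]
      gcongr
    · intro s x; exact phi_self s x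
  have inc : ∀ n (i j : ℕ), i ≤ j → (j : ℝ) * δ n ≤ r → (j : ℝ) * δ n - i * δ n ≤ h →
      ‖Y n j - Y n i‖ ≤ A := by
    intro n i j hij hj hh
    have E := est n i j hij hj hh
    have hij' : (i : ℝ) * δ n ≤ j * δ n := by
      have := (hδ0 n).le
      gcongr
    have hi0 : 0 ≤ (i : ℝ) * δ n := mul_nonneg (Nat.cast_nonneg _) (hδ0 n).le
    have X := Xs_bound (y := fun _ => Y n i) (e := e) hβ0 hσ hS1 hhb hi0 hij' hj hh
      (he's _ hi0 (by linarith))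
    have hl := ell_nonneg hij' β
    have hl1 : ((j : ℝ) * δ n - i * δ n) ^ β ≤ 1 :=
      (Real.rpow_le_rpow (by linarith) hh hβ0.le).trans hhb
    have e1 : Y n j - Y n i = (Y n j - phi RP σ e e' (i * δ n) (j * δ n) (Y n i)) +
        Xs RP σ (fun _ => Y n i) e e' (i * δ n) (j * δ n) := by
      rw [phi]; abel
    rw [e1, hA]
    refine norm_add_le_of_le (E.trans ?_) X
    calc C * _ ≤ C * 1 := by gcongr; exact pow_le_one₀ hl hl1
      _ = C := mul_one _
  have bdd : ∀ n (k : ℕ), (k : ℝ) * δ n ≤ r → ‖Y n k‖ ≤ M + A * (1 + 2 * r / h) := by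
    intro n k hk
    refine (euler_bdd (hδ0 n) hh0 (hδh n) hA0 (inc n) k hk).trans ?_
    have : ‖Y n 0‖ ≤ M := hx0
    gcongr
  -- interpolation
  set kn : ℕ → ℝ → ℕ := fun n t => ⌊t / δ n⌋₊ with hkn
  have k1 : ∀ n t, 0 ≤ t → (kn n t : ℝ) * δ n ≤ t := fun n t ht => by
    rw [← le_div_iff₀ (hδ0 n)]; exact Nat.floor_le (div_nonneg ht (hδ0 n).le)
  have k2 : ∀ n t, t < kn n t * δ n + δ n := fun n t => by
    have : t < (kn n t + 1) * δ n := by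
      rw [← div_lt_iff₀ (hδ0 n)]; exact Nat.lt_floor_add_one _
    linarith
  have klim : ∀ t, 0 ≤ t → Tendsto (fun n => (kn n t : ℝ) * δ n) atTop (𝓝 t) := by
    intro t ht
    refine tendsto_of_tendsto_of_tendsto_of_le_of_le (g := fun n => t - δ n) (h := fun _ => t) ?_
      tendsto_const_nhds (fun n => by linarith [k2 n t]) (fun n => k1 n t ht)
    simpa using tendsto_const_nhds.sub hδl
  have kmono : ∀ n s t, s ≤ t → kn n s ≤ kn n t := fun n s t hst =>
    Nat.floor_le_floor (by have := hδ0 n; gcongr)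
  set U : Ultrafilter ℕ := hyperfilter ℕ with hU
  have hUle : (U : Filter ℕ) ≤ atTop := Nat.hyperfilter_le_atTop
  have ex : ∀ t : ℝ, ∃ x : W, (0 ≤ t → t ≤ r → Tendsto (fun n => Y n (kn n t)) U (𝓝 x)) := by
    intro t
    by_cases ht : 0 ≤ t ∧ t ≤ r
    · obtain ⟨x, hx⟩ := ultra_lim U (f := fun n => Y n (kn n t)) (R := M + A * (1 + 2 * r / h))
        (Eventually.of_forall fun n => bdd n _ ((k1 n t ht.1).trans ht.2))
      exact ⟨x, fun _ _ => hx⟩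
    · exact ⟨0, fun h1 h2 => absurd ⟨h1, h2⟩ ht⟩
  choose y hy using ex
  refine ⟨y, ?_, ?_, ?_⟩
  · refine tendsto_nhds_unique (hy 0 le_rfl hr.le) ?_
    have : (fun n => Y n (kn n 0)) = fun _ => x0 := by
      funext n; simp [hkn, hYdef, euler]
    rw [this]; exact tendsto_const_nhds
  · intro t h1 h2
    refine le_of_tendsto (hy t h1 h2).norm (Eventually.of_forall fun n => bdd n _ ((k1 n t h1).trans h2))
  · intro s t hs hst ht hts
    have ls : Tendsto (fun n => (kn n s : ℝ) * δ n) U (𝓝 s) := (klim s hs).mono_left hUle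
    have lt : Tendsto (fun n => (kn n t : ℝ) * δ n) U (𝓝 t) :=
      (klim t (by linarith)).mono_left hUle
    have yS := hy s hs (by linarith)
    have yT := hy t (by linarith) ht
    have hsI : s ∈ Icc 0 r := ⟨hs, by linarith⟩
    have mem : ∀ n, (kn n s : ℝ) * δ n ∈ Icc 0 r := fun n =>
      ⟨mul_nonneg (Nat.cast_nonneg _) (hδ0 n).le, (k1 n s hs).trans hsI.2⟩
    have lsI : Tendsto (fun n => (kn n s : ℝ) * δ n) U (𝓝[Icc 0 r] s) :=
      tendsto_nhdsWithin_iff.2 ⟨ls, Eventually.of_forall mem⟩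
    have eS := (hec s hsI).tendsto.comp lsI
    have eS' := (hec' s hsI).tendsto.comp lsI
    have XS := tendsto_Xs (RP := RP) (σ := σ) (l := (U : Filter ℕ)) (y := fun n _ => Y n (kn n s))
      (e := fun _ => e) (e' := fun _ => e') (y' := y) (by linarith : 0 < γ) hσ ls lt yS eS eS'
    have lhs := ((yT.sub yS).sub XS).norm
    have rhs : Tendsto (fun n => C * (((kn n t : ℝ) * δ n - kn n s * δ n) ^ β) ^ 3) U
        (𝓝 (C * ((t - s) ^ β) ^ 3)) :=
      (((lt.sub ls).rpow_const (Or.inr hβ0.le)).pow 3).const_mul C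
    refine le_of_tendsto_of_tendsto lhs rhs (Eventually.of_forall fun n => ?_)
    have := est n (kn n s) (kn n t) (kmono n s t hst) ((k1 n t (by linarith)).trans ht)
      (by linarith [k1 n t (by linarith), k2 n s, hδh n])
    refine le_trans (le_of_eq ?_) this
    rw [phi]; abel_nf

theorem exists_sol [ProperSpace W] (RP : DelayedRoughPath d r γ) (hr : 0 < r) (hβ : 1 / 3 < β)
    (hβγ : β < γ) (hσ : C3b B σ) (M : ℝ) (hM : 0 ≤ M) :
    ∃ κ, 1 ≤ κ ∧ ∀ (e : ℝ → W) (e' : ℝ → (Fin d → ℝ) →L[ℝ] W),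
      AllT RP β r r M e 0 e' → ∀ x0 : W, ‖x0‖ ≤ M →
      ∃ y : ℝ → W, y 0 = x0 ∧ AllT RP β r r κ y (Yf σ y e) 0 ∧
        Davie RP β r r κ y (Yf σ y e) (c0 σ (pu y e) (pa (Yf σ y e))) (c0 σ (pu y e) (pb e')) := by
  have hβ0 : 0 < β := by linarith
  have hB := hσ.g.nonneg
  obtain ⟨h, C, R, hh, hhb, hS, hC, H⟩ := exists_loc RP hr hβ hβγ hσ M hM
  obtain ⟨K, hK1, hSK, -⟩ := exists_small_r RP hr.le hβ0 hβγ
  have ha : 0 < h ^ β := Real.rpow_pos_of_pos hh β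
  obtain ⟨κ1, hκ1⟩ : ∃ κ1 : ℝ, κ1 = |R| + (1 + B) * (C + 2 * B + M + 2 * d ^ 2 * (B * (B + M))) :=
    ⟨_, rfl⟩
  have hκ10 : 0 ≤ κ1 := by rw [hκ1]; positivity
  obtain ⟨κ2, hκ2⟩ : ∃ κ2 : ℝ, κ2 = κ1 * (1 + 2 / h ^ β + 2 / (h ^ β) ^ 2 + 2 * K / h ^ β) := ⟨_, rfl⟩
  have hκ20 : 0 ≤ κ2 := by rw [hκ2]; positivity
  obtain ⟨C2, hC2⟩ : ∃ C2 : ℝ, C2 = C + (κ2 + 2 * d ^ 2 * (B * (1 + (κ2 + M)) ^ 2) * K) / h ^ β :=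
    ⟨_, rfl⟩
  have hC20 : 0 ≤ C2 := by rw [hC2]; positivity
  refine ⟨1 + κ2 + C2, by linarith, fun e e' he x0 hx0 => ?_⟩
  obtain ⟨y, hy0, hyR, hyD⟩ := H e e' he x0 hx0
  have A1 : AllT RP β r h κ1 y (Yf σ y e) 0 := by
    intro s t hs hst ht hts
    have q := lemQ hβ0 hσ hS hhb hC hs hst ht hts (he s t hs hst ht (by linarith))
      (hyD s t hs hst ht hts)
    refine ⟨q.mono (ell_nonneg hst β) ?_, ?_, ?_⟩
    · rw [hκ1]; linarith [abs_nonneg R]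
    · refine (hyR s hs (by linarith)).trans ((le_abs_self R).trans ?_)
      rw [hκ1]; linarith [q.nonneg]
    · refine (hyR t (by linarith) ht).trans ((le_abs_self R).trans ?_)
      rw [hκ1]; linarith [q.nonneg]
  have A2 : AllT RP β r r κ2 y (Yf σ y e) 0 := by
    rw [hκ2]; exact A1.ext hβ0 hh hSK le_rfl (by linarith)
  have A3 : AllT RP β r r (B * (1 + (κ2 + M)) ^ 2) (Yf σ y e) (c0 σ (pu y e) (pa (Yf σ y e)))
      (c0 σ (pu y e) (pb e')) := by
    intro s t hs hst ht hts
    have hl := ell_nonneg hst β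
    exact ((A2 s t hs hst ht hts).toDI.pair hl (he s t hs hst ht hts).toDI).compose hl hσ.g
  have D := hyD.ext hβ0 hh hSK (by linarith) hC A2 A3
  rw [← hC2] at D
  refine ⟨y, hy0, A2.mono (by linarith), fun s t hs hst ht hts =>
    (D s t hs hst ht hts).trans ?_⟩
  have := ell_nonneg hst β
  gcongr
  linarith

end Exist3
end SDDE

namespace SDDE
open Set Filter Topology
set_option maxSynthPendingDepth 3

section Integral

set_option linter.unusedSectionVars false
variable {d : ℕ} {r γ β : ℝ} {E : Type*} [NormedAddCommGroup E] [NormedSpace ℝ E]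
variable {RP : DelayedRoughPath d r γ} {V m : ℝ → (Fin d → ℝ) →L[ℝ] E}
  {z0 z1 ζ0 ζ1 : ℝ → (Fin d → ℝ) →L[ℝ] ((Fin d → ℝ) →L[ℝ] E)} {v : ℝ → E}

theorem riemannSum_eq {s t : ℝ} (P : Partition s t) : riemannSum RP m ζ0 ζ1 P =
    ∑ i ∈ Finset.range P.n, Xi RP m ζ0 ζ1 (P.pts i) (P.pts (i + 1)) := rfl

theorem Partition.ge {s t : ℝ} (P : Partition s t) : ∀ i, i ≤ P.n → s ≤ P.pts i := by
  intro i
  induction i with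
  | zero => intro _; exact P.h0.ge
  | succ k ih => intro h; exact (ih (by omega)).trans (P.mono k (by omega))

theorem Partition.le {s t : ℝ} (P : Partition s t) : ∀ j i, i + j = P.n → P.pts i ≤ t := by
  intro j
  induction j with
  | zero => intro i h; have : i = P.n := by omega
            rw [this]; exact P.hn.le
  | succ k ih => intro i h; exact (P.mono i (by omega)).trans (ih (i + 1) (by omega))

theorem Xi_agree (hm : ∀ τ, 0 ≤ τ → τ < r → m τ = V τ ∧ ζ0 τ = z0 τ ∧ ζ1 τ = z1 τ) {s t : ℝ}
    (hs : 0 ≤ s) (hst : s ≤ t) (ht : t ≤ r) : Xi RP m ζ0 ζ1 s t = Xi RP V z0 z1 s t := by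
  rcases hst.eq_or_lt with h | h
  · subst h; rw [Xi_self, Xi_self]
  · obtain ⟨a, b, c⟩ := hm s hs (by linarith)
    simp only [Xi, a, b, c]

/-- The Davie estimate gives the rough integral. -/
theorem Davie.hasInt (hβ : 1 / 3 < β) {C : ℝ} (hC : 0 ≤ C) (D : Davie RP β r r C v V z0 z1)
    (hm : ∀ τ, 0 ≤ τ → τ < r → m τ = V τ ∧ ζ0 τ = z0 τ ∧ ζ1 τ = z1 τ) {s t : ℝ}
    (hs : 0 ≤ s) (ht : t ≤ r) : HasRoughIntegral RP m ζ0 ζ1 s t (v t - v s) := by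
  intro ε hε
  have hp : 0 < 3 * β - 1 := by linarith
  have hlim : Tendsto (fun x : ℝ => C * x ^ (3 * β - 1) * (t - s)) (𝓝 0) (𝓝 0) := by
    have : Tendsto (fun x : ℝ => C * x ^ (3 * β - 1) * (t - s)) (𝓝 0)
        (𝓝 (C * 0 ^ (3 * β - 1) * (t - s))) := by
      apply Continuous.tendsto
      exact (continuous_const.mul (Continuous.rpow_const continuous_id
        (fun _ => Or.inr hp.le))).mul continuous_const
    rwa [Real.zero_rpow hp.ne', mul_zero, zero_mul] at this
  obtain ⟨δ, hδ, hδε⟩ : ∃ δ > 0, C * δ ^ (3 * β - 1) * (t - s) < ε := by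
    have h1 : ∀ᶠ x in 𝓝[>] (0:ℝ), C * x ^ (3 * β - 1) * (t - s) < ε :=
      (hlim.mono_left nhdsWithin_le_nhds).eventually (gt_mem_nhds hε)
    obtain ⟨δ, h2, h3⟩ := (h1.and self_mem_nhdsWithin).exists
    exact ⟨δ, h3, h2⟩
  refine ⟨δ, hδ, fun P hP => ?_⟩
  have e : riemannSum RP m ζ0 ζ1 P - (v t - v s) =
      ∑ i ∈ Finset.range P.n, (Xi RP m ζ0 ζ1 (P.pts i) (P.pts (i + 1)) -
        (v (P.pts (i + 1)) - v (P.pts i))) := by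
    rw [Finset.sum_sub_distrib, Finset.sum_range_sub (fun i => v (P.pts i)), P.h0, P.hn,
      riemannSum_eq]
  have e2 : ∑ i ∈ Finset.range P.n, C * δ ^ (3 * β - 1) * (P.pts (i + 1) - P.pts i) =
      C * δ ^ (3 * β - 1) * (t - s) := by
    rw [← Finset.mul_sum, Finset.sum_range_sub (fun i => P.pts i), P.h0, P.hn]
  rw [e]
  refine le_trans (norm_sum_le_of_le _ fun i hi => ?_) (e2.le.trans hδε.le)
  have hi := Finset.mem_range.1 hi
  have a1 := P.ge i hi.le
  have a2 := P.mono i hi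
  have a3 := P.le (P.n - (i + 1)) (i + 1) (by omega)
  have a4 := hP i hi
  rw [Xi_agree hm (by linarith) a2 (by linarith), norm_sub_rev]
  refine (D _ _ (by linarith) a2 (by linarith) (by linarith)).trans ?_
  rw [cube_eq hβ (by linarith)]
  have : (P.pts (i + 1) - P.pts i) ^ (3 * β - 1) ≤ δ ^ (3 * β - 1) :=
    Real.rpow_le_rpow (by linarith) a4 hp.le
  have h0 : 0 ≤ P.pts (i + 1) - P.pts i := by linarith
  calc C * ((P.pts (i + 1) - P.pts i) * (P.pts (i + 1) - P.pts i) ^ (3 * β - 1))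
      ≤ C * ((P.pts (i + 1) - P.pts i) * δ ^ (3 * β - 1)) := by gcongr
    _ = _ := by ring

/-- concatenation of partitions -/
def Partition.append {s u t : ℝ} (P : Partition s u) (Q : Partition u t) : Partition s t where
  n := P.n + Q.n
  pts i := if i ≤ P.n then P.pts i else Q.pts (i - P.n)
  h0 := by simp [P.h0]
  hn := by
    by_cases h : Q.n = 0
    · have : u = t := by
        have h1 := Q.h0
        have h2 := Q.hn
        rw [h] at h2
        exact h1.symm.trans h2
      simp [h, P.hn, this]
    · have : ¬ (P.n + Q.n ≤ P.n) := by omega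
      simp [h, Q.hn]
  mono := by
    intro i hi
    by_cases h1 : i + 1 ≤ P.n
    · rw [if_pos (by omega), if_pos h1]; exact P.mono i (by omega)
    · rw [if_neg h1]
      by_cases h2 : i ≤ P.n
      · have : i = P.n := by omega
        subst this
        rw [if_pos le_rfl, P.hn, show P.n + 1 - P.n = 0 + 1 by omega]
        nth_rewrite 1 [← Q.h0]
        exact Q.mono 0 (by omega)
      · rw [if_neg h2, show i + 1 - P.n = (i - P.n) + 1 by omega]
        exact Q.mono _ (by omega)

theorem Partition.append_left {s u t : ℝ} (P : Partition s u) (Q : Partition u t) {i : ℕ}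
    (hi : i ≤ P.n) : (P.append Q).pts i = P.pts i := by
  simp [Partition.append, hi]

theorem Partition.append_right {s u t : ℝ} (P : Partition s u) (Q : Partition u t) (i : ℕ) :
    (P.append Q).pts (P.n + i) = Q.pts i := by
  by_cases h : i = 0
  · subst h; simp [Partition.append, P.hn, Q.h0]
  · simp [Partition.append, h]

theorem Partition.append_sum {s u t : ℝ} (P : Partition s u) (Q : Partition u t) :
    riemannSum RP m ζ0 ζ1 (P.append Q) = riemannSum RP m ζ0 ζ1 P + riemannSum RP m ζ0 ζ1 Q := by
  rw [riemannSum_eq, riemannSum_eq, riemannSum_eq]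
  show ∑ i ∈ Finset.range (P.n + Q.n), _ = _
  rw [Finset.sum_range_add]
  congr 1
  · refine Finset.sum_congr rfl fun i hi => ?_
    have := Finset.mem_range.1 hi
    rw [P.append_left Q (by omega), P.append_left Q (by omega)]
  · refine Finset.sum_congr rfl fun i hi => ?_
    rw [P.append_right Q, add_assoc, P.append_right Q]

theorem Partition.append_mesh {s u t δ : ℝ} {P : Partition s u} {Q : Partition u t}
    (hP : P.MeshLE δ) (hQ : Q.MeshLE δ) : (P.append Q).MeshLE δ := by
  intro i hi
  have hi : i < P.n + Q.n := hi
  by_cases h : i < P.n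
  · rw [P.append_left Q (by omega), P.append_left Q (by omega)]; exact hP i h
  · obtain ⟨j, rfl⟩ : ∃ j, i = P.n + j := ⟨i - P.n, by omega⟩
    rw [P.append_right Q, add_assoc, P.append_right Q]; exact hQ j (by omega)

/-- dyadic sums are close to the germ -/
theorem dyadic (hβ : 1 / 3 < β) {K : ℝ}
    (hK : ∀ s u t, 0 ≤ s → s ≤ u → u ≤ t → t ≤ r →
      ‖Xi RP m ζ0 ζ1 s t - Xi RP m ζ0 ζ1 s u - Xi RP m ζ0 ζ1 u t‖ ≤ K * ((t - s) ^ β) ^ 3)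
    (n : ℕ) : ∀ s t, 0 ≤ s → s ≤ t → t ≤ r → 0 ≤ K → ∃ P : Partition s t,
      P.MeshLE ((t - s) / 2 ^ n) ∧
      ‖riemannSum RP m ζ0 ζ1 P - Xi RP m ζ0 ζ1 s t‖ ≤ K / (1 - th β) * ((t - s) ^ β) ^ 3 := by
  have hth := th_lt_one hβ
  have hth0 := th_pos (β := β)
  obtain ⟨L, hL⟩ : ∃ L, L = K / (1 - th β) := ⟨_, rfl⟩
  have hLK : th β * L + K = L := by
    rw [hL]; field_simp [(by linarith : (1 - th β) ≠ 0)]; ring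
  rw [← hL]
  induction n with
  | zero =>
    intro s t hs hst ht hK0
    refine ⟨⟨1, fun i => if i = 0 then s else t, by simp, by simp, fun i hi => ?_⟩, ?_, ?_⟩
    · have : i = 0 := by omega
      subst this; simpa using hst
    · intro i hi
      have : i < 1 := hi
      have : i = 0 := by omega
      subst this; simp
    · have hL0 : 0 ≤ L := by rw [hL]; exact div_nonneg hK0 (by linarith)
      have := ell_nonneg hst β
      rw [riemannSum_eq]
      simp; positivity
  | succ n ih =>
    intro s t hs hst ht hK0
    set u := (s + t) / 2 with hu
    have h1 : s ≤ u := by linarith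
    have h2 : u ≤ t := by linarith
    obtain ⟨P, hP, eP⟩ := ih s u hs h1 (by linarith) hK0
    obtain ⟨Q, hQ, eQ⟩ := ih u t (by linarith) h2 ht hK0
    have e1 : u - s = (t - s) / 2 := by rw [hu]; ring
    have e2 : t - u = (t - s) / 2 := by rw [hu]; ring
    have em : (t - s) / 2 ^ (n + 1) = (t - s) / 2 / 2 ^ n := by rw [pow_succ]; field_simp
    refine ⟨P.append Q, Partition.append_mesh ?_ ?_, ?_⟩
    · rw [em, ← e1]; exact hP
    · rw [em, ← e2]; exact hQ
    · rw [Partition.append_sum]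
      have ee : riemannSum RP m ζ0 ζ1 P + riemannSum RP m ζ0 ζ1 Q - Xi RP m ζ0 ζ1 s t =
        (riemannSum RP m ζ0 ζ1 P - Xi RP m ζ0 ζ1 s u) + (riemannSum RP m ζ0 ζ1 Q - Xi RP m ζ0 ζ1 u t)
        - (Xi RP m ζ0 ζ1 s t - Xi RP m ζ0 ζ1 s u - Xi RP m ζ0 ζ1 u t) := by abel
      rw [ee]
      refine (norm_sub_le_of_le (norm_add_le_of_le eP eQ) (hK s u t hs h1 h2 ht)).trans ?_
      rw [e1, e2, half_ell hst]
      refine le_of_eq ?_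
      have : th β = 2 * ((1 / 2 : ℝ) ^ β) ^ 3 := rfl
      calc _ = (th β * L + K) * ((t - s) ^ β) ^ 3 := by rw [this]; ring
        _ = _ := by rw [hLK]

/-- The rough integral gives the Davie estimate. -/
theorem davie_of_int (hr : 0 < r) (hβ : 1 / 3 < β) (hβγ : β < γ) {D : ℝ}
    (hV : AllT RP β r r D V z0 z1)
    (hm : ∀ τ, 0 ≤ τ → τ < r → m τ = V τ ∧ ζ0 τ = z0 τ ∧ ζ1 τ = z1 τ)
    (hI : ∀ t, 0 ≤ t → t ≤ r → HasRoughIntegral RP m ζ0 ζ1 0 t (v t - v 0)) :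
    ∃ C, 0 ≤ C ∧ Davie RP β r r C v V z0 z1 := by
  have hβ0 : 0 < β := by linarith
  have hth := th_lt_one hβ
  obtain ⟨K, hK1, hSK, -⟩ := exists_small_r RP hr.le hβ0 hβγ
  have hD0 : 0 ≤ D := (hV 0 0 le_rfl le_rfl hr.le (by linarith)).nonneg
  obtain ⟨K', hK'⟩ : ∃ K', K' = (1 + 2 * d ^ 2) * D * K := ⟨_, rfl⟩
  have hK'0 : 0 ≤ K' := by rw [hK']; positivity
  have hdel : ∀ s u t, 0 ≤ s → s ≤ u → u ≤ t → t ≤ r →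
      ‖Xi RP m ζ0 ζ1 s t - Xi RP m ζ0 ζ1 s u - Xi RP m ζ0 ζ1 u t‖ ≤ K' * ((t - s) ^ β) ^ 3 := by
    intro s u t hs hsu hut ht
    rw [Xi_agree hm hs (hsu.trans hut) ht, Xi_agree hm hs hsu (by linarith),
      Xi_agree hm (by linarith) hut ht, hK']
    exact Xi_delta_bound hβ0 hSK hs hsu hut ht (by linarith) (by linarith)
      (hV s u hs hsu (by linarith) (by linarith)).toDI
  refine ⟨K' / (1 - th β), div_nonneg hK'0 (by linarith), ?_⟩
  intro s t hs hst ht hts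
  rw [← Xi_agree hm hs hst ht]
  refine le_of_forall_pos_le_add fun ε hε => ?_
  obtain ⟨δ1, hδ1, I1⟩ := hI s hs (by linarith) (ε / 2) (by linarith)
  obtain ⟨δ2, hδ2, I2⟩ := hI t (by linarith) ht (ε / 2) (by linarith)
  obtain ⟨n, hn⟩ : ∃ n : ℕ, r / 2 ^ n < min δ1 δ2 := by
    have : Tendsto (fun n : ℕ => r * (1 / 2 : ℝ) ^ n) atTop (𝓝 (r * 0)) :=
      (tendsto_pow_atTop_nhds_zero_of_lt_one (by norm_num) (by norm_num)).const_mul r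
    rw [mul_zero] at this
    obtain ⟨n, hn⟩ := (this.eventually (gt_mem_nhds (lt_min hδ1 hδ2))).exists
    refine ⟨n, lt_of_eq_of_lt ?_ hn⟩
    rw [one_div, inv_pow]; rfl
  have hmono : ∀ x : ℝ, x ≤ r → x / 2 ^ n ≤ r / 2 ^ n := fun x hx => by gcongr
  obtain ⟨P, hP, eP⟩ := dyadic hβ hdel n 0 s le_rfl hs (by linarith) hK'0
  obtain ⟨Q, hQ, eQ⟩ := dyadic hβ hdel n s t hs hst ht hK'0
  have hP2 : P.MeshLE (r / 2 ^ n) := fun i hi => (hP i hi).trans (hmono _ (by linarith))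
  have hQ2 : Q.MeshLE (r / 2 ^ n) := fun i hi => (hQ i hi).trans (hmono _ (by linarith))
  have J1 := I1 P (fun i hi => (hP2 i hi).trans (hn.le.trans (min_le_left _ _)))
  have J2 := I2 (P.append Q) (fun i hi => (Partition.append_mesh hP2 hQ2 i hi).trans
    (hn.le.trans (min_le_right _ _)))
  rw [Partition.append_sum] at J2
  have e : v t - v s - Xi RP m ζ0 ζ1 s t =
      (riemannSum RP m ζ0 ζ1 Q - Xi RP m ζ0 ζ1 s t) +
      ((riemannSum RP m ζ0 ζ1 P - (v s - v 0)) -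
        (riemannSum RP m ζ0 ζ1 P + riemannSum RP m ζ0 ζ1 Q - (v t - v 0))) := by abel
  rw [e]
  refine (norm_add_le_of_le eQ (norm_sub_le_of_le J1 J2)).trans (by linarith)

end Integral
end SDDE

namespace SDDE
open Set Filter Topology
set_option maxSynthPendingDepth 3

section Conv

set_option linter.unusedSectionVars false
variable {d : ℕ} {r γ β : ℝ} {E : Type*} [NormedAddCommGroup E] [NormedSpace ℝ E]
variable {RP : DelayedRoughPath d r γ}

theorem inf_spec {I : Set ℝ} {F G : ℝ → ℝ → ℝ} (hG : ∀ s ∈ I, ∀ t ∈ I, 0 ≤ G s t)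
    (hC : ∃ C : ℝ, ∀ s ∈ I, ∀ t ∈ I, F s t ≤ C * G s t) :
    0 ≤ sInf {C : ℝ | 0 ≤ C ∧ ∀ s ∈ I, ∀ t ∈ I, F s t ≤ C * G s t} ∧
    ∀ s ∈ I, ∀ t ∈ I, F s t ≤ sInf {C : ℝ | 0 ≤ C ∧ ∀ s ∈ I, ∀ t ∈ I, F s t ≤ C * G s t} * G s t := by
  obtain ⟨C, hC⟩ := hC
  have hne : {C : ℝ | 0 ≤ C ∧ ∀ s ∈ I, ∀ t ∈ I, F s t ≤ C * G s t}.Nonempty :=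
    ⟨|C|, abs_nonneg C, fun s hs t ht => (hC s hs t ht).trans
      (mul_le_mul_of_nonneg_right (le_abs_self C) (hG s hs t ht))⟩
  refine ⟨Real.sInf_nonneg fun x hx => hx.1, fun s hs t ht => ?_⟩
  rcases (hG s hs t ht).eq_or_lt with h0 | h0
  · have := hC s hs t ht
    rw [← h0] at this ⊢
    simpa using this
  · rw [← div_le_iff₀ h0]
    exact le_csInf hne fun x hx => by
      rw [div_le_iff₀ h0]
      exact hx.2 s hs t ht

theorem inf_le {I : Set ℝ} {F G : ℝ → ℝ → ℝ} {C : ℝ} (hC0 : 0 ≤ C)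
    (hC : ∀ s ∈ I, ∀ t ∈ I, F s t ≤ C * G s t) :
    sInf {C : ℝ | 0 ≤ C ∧ ∀ s ∈ I, ∀ t ∈ I, F s t ≤ C * G s t} ≤ C :=
  csInf_le ⟨0, fun _ hx => hx.1⟩ ⟨hC0, hC⟩

theorem ctrl_spec {X : ℝ → Fin d → ℝ} {a b : ℝ} {m : ℝ → E} {m' : ℝ → (Fin d → ℝ) →L[ℝ] E}
    (h : IsControlled β X (Icc a b) m m') :
    0 ≤ cpNorm β X a b m m' ∧ ‖m a‖ ≤ cpNorm β X a b m m' ∧ ‖m' a‖ ≤ cpNorm β X a b m m' ∧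
    ∀ s t, a ≤ s → s ≤ t → t ≤ b → ‖m' t - m' s‖ ≤ cpNorm β X a b m m' * (t - s) ^ β ∧
      ‖m t - m s - m' s (X t - X s)‖ ≤ cpNorm β X a b m m' * ((t - s) ^ β) ^ 2 := by
  obtain ⟨h1, h2⟩ := h
  obtain ⟨p1, q1⟩ := inf_spec (I := Icc a b) (F := fun s t => ‖m' t - m' s‖)
    (G := fun s t => |t - s| ^ β) (fun s _ t _ => by positivity) h1
  obtain ⟨p2, q2⟩ := inf_spec (I := Icc a b) (F := fun s t => ‖m t - m s - m' s (X t - X s)‖)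
    (G := fun s t => |t - s| ^ (2 * β)) (fun s _ t _ => by positivity) h2
  have e : cpNorm β X a b m m' = ‖m a‖ + ‖m' a‖ +
    sInf {C : ℝ | 0 ≤ C ∧ ∀ s ∈ Icc a b, ∀ t ∈ Icc a b, ‖m' t - m' s‖ ≤ C * |t - s| ^ β} +
    sInf {C : ℝ | 0 ≤ C ∧ ∀ s ∈ Icc a b, ∀ t ∈ Icc a b,
      ‖m t - m s - m' s (X t - X s)‖ ≤ C * |t - s| ^ (2 * β)} := rfl
  rw [e]
  generalize sInf {C : ℝ | 0 ≤ C ∧ ∀ s ∈ Icc a b, ∀ t ∈ Icc a b,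
    ‖m' t - m' s‖ ≤ C * |t - s| ^ β} = A at *
  generalize sInf {C : ℝ | 0 ≤ C ∧ ∀ s ∈ Icc a b, ∀ t ∈ Icc a b,
      ‖m t - m s - m' s (X t - X s)‖ ≤ C * |t - s| ^ (2 * β)} = A' at *
  have := norm_nonneg (m a)
  have := norm_nonneg (m' a)
  refine ⟨by linarith, by linarith, by linarith, fun s t hs hst ht => ?_⟩
  have g1 := q1 s ⟨hs, by linarith⟩ t ⟨by linarith, ht⟩
  have g2 := q2 s ⟨hs, by linarith⟩ t ⟨by linarith, ht⟩
  simp only [abs_of_nonneg (sub_nonneg.2 hst)] at g1 g2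
  rw [gamma_sq (sub_nonneg.2 hst)] at g2
  have hl := ell_nonneg hst β
  exact ⟨g1.trans (by gcongr; linarith), g2.trans (by gcongr; linarith)⟩

theorem ctrl_bounds {X : ℝ → Fin d → ℝ} {a b K : ℝ} {m : ℝ → E} {m' : ℝ → (Fin d → ℝ) →L[ℝ] E}
    (hβ : 0 < β) (h : IsControlled β X (Icc a b) m m') (hK : 1 ≤ K) (hab : (b - a) ^ β ≤ K)
    (hX : ∀ s t, a ≤ s → s ≤ t → t ≤ b → ‖X t - X s‖ ≤ K * (t - s) ^ β)
    {N : ℝ} (hN : 4 * K ^ 2 * cpNorm β X a b m m' = N) :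
    0 ≤ N ∧ (∀ t, a ≤ t → t ≤ b → ‖m t‖ ≤ N ∧ ‖m' t‖ ≤ N) ∧
    ∀ s t, a ≤ s → s ≤ t → t ≤ b → ‖m t - m s‖ ≤ N * (t - s) ^ β ∧
      ‖m' t - m' s‖ ≤ N * (t - s) ^ β ∧
      ‖m t - m s - m' s (X t - X s)‖ ≤ N * ((t - s) ^ β) ^ 2 := by
  obtain ⟨h0, ha, ha', hh⟩ := ctrl_spec h
  subst hN
  generalize cpNorm β X a b m m' = N at *
  have hlK : ∀ s t, a ≤ s → s ≤ t → t ≤ b → (t - s) ^ β ≤ K := fun s t hs hst ht =>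
    (Real.rpow_le_rpow (sub_nonneg.2 hst) (by linarith) hβ.le).trans hab
  have hKK : 1 ≤ K ^ 2 := one_le_pow₀ hK
  have hKK' : K ≤ K ^ 2 := by nlinarith
  have hNK : N ≤ N * K := le_mul_of_one_le_right h0 hK
  have hNK1 : N ≤ N * K ^ 2 := le_mul_of_one_le_right h0 hKK
  have hNK2 : N * K ≤ N * K ^ 2 := mul_le_mul_of_nonneg_left hKK' h0
  have m'b : ∀ t, a ≤ t → t ≤ b → ‖m' t‖ ≤ 2 * N * K := fun t h1 h2 => by
    have := (hh a t le_rfl h1 h2).1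
    have g : N * (t - a) ^ β ≤ N * K := by gcongr; exact hlK a t le_rfl h1 h2
    have := norm_le_norm_add_norm_sub' (m' t) (m' a)
    linarith
  have minc : ∀ s t, a ≤ s → s ≤ t → t ≤ b → ‖m t - m s‖ ≤ 3 * N * K ^ 2 * (t - s) ^ β := by
    intro s t hs hst ht
    have g1 := (hh s t hs hst ht).2
    have g2 := clm_le (m'b s hs (by linarith)) (hX s t hs hst ht)
    have g3 := hlK s t hs hst ht
    have hl := ell_nonneg hst β
    generalize (t - s) ^ β = l at *
    have g4 : N * l ^ 2 ≤ N * (K ^ 2 * l) := by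
      gcongr
      nlinarith
    have : m t - m s = (m t - m s - m' s (X t - X s)) + m' s (X t - X s) := by abel
    rw [this]
    refine (norm_add_le _ _).trans ?_
    calc _ ≤ N * (K ^ 2 * l) + 2 * N * K * (K * l) := by linarith
      _ = _ := by ring
  refine ⟨by positivity, fun t h1 h2 => ⟨?_, (m'b t h1 h2).trans (by nlinarith)⟩, fun s t hs hst ht =>
    ⟨(minc s t hs hst ht).trans ?_, (hh s t hs hst ht).1.trans ?_, (hh s t hs hst ht).2.trans ?_⟩⟩
  · have e : m t = m a + (m t - m a - m' a (X t - X a)) + m' a (X t - X a) := by abel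
    have g1 := (hh a t le_rfl h1 h2).2
    have g2 := clm_le ha' (hX a t le_rfl h1 h2)
    have g3 := hlK a t le_rfl h1 h2
    have hl := ell_nonneg h1 β
    generalize (t - a) ^ β = l at *
    rw [e]
    refine (norm_add₃_le).trans ?_
    have : N * l ^ 2 ≤ N * K ^ 2 := by gcongr
    have : N * (K * l) ≤ N * (K * K) := by gcongr
    nlinarith
  all_goals
    have hl := ell_nonneg hst β
    refine mul_le_mul_of_nonneg_right ?_ (by positivity)
    nlinarith

/-- Controlled paths on `[-r,0]`, shifted, are delayed controlled on `[0,r]`. -/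
theorem ctrl_shift {K : ℝ} (hβ : 0 < β) (hK : 1 ≤ K) (hS : Small RP β r K) (hrK : r ^ β ≤ K)
    {q : ℝ → E} {q' : ℝ → (Fin d → ℝ) →L[ℝ] E} (h : IsControlled β RP.X (Icc (-r) 0) q q') :
    AllT RP β r r (4 * K ^ 2 * cpNorm β RP.X (-r) 0 q q') (fun τ => q (τ - r)) 0
      (fun τ => q' (τ - r)) := by
  obtain ⟨h0, hb, hi⟩ := ctrl_bounds hβ h hK (by simpa using hrK) (fun s t hs hst ht => by
    have := (hS (s + r) (t + r) (by linarith) (by linarith) (by linarith) (by linarith)).2.1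
    simpa using this) rfl
  intro s t hs hst ht hts
  obtain ⟨i1, i2, i3⟩ := hi (s - r) (t - r) (by linarith) (by linarith) (by linarith)
  rw [show t - r - (s - r) = t - s by ring] at i1 i2 i3
  have bs := hb (s - r) (by linarith) (by linarith)
  have bt := hb (t - r) (by linarith) (by linarith)
  have hl := ell_nonneg hst β
  refine ⟨⟨by simpa using h0, by simpa using h0, bs.2, bt.2, i1, ?_, i2, ?_⟩, bs.1, bt.1⟩
  · simp; positivity
  · simpa using i3

theorem ctrl_allT {K : ℝ} (hβ : 0 < β) (hK : 1 ≤ K) (hS : Small RP β r K) (hrK : r ^ β ≤ K)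
    {q : ℝ → E} {q' : ℝ → (Fin d → ℝ) →L[ℝ] E} (h : IsControlled β RP.X (Icc 0 r) q q') :
    AllT RP β r r (4 * K ^ 2 * cpNorm β RP.X 0 r q q') q q' 0 := by
  obtain ⟨h0, hb, hi⟩ := ctrl_bounds hβ h hK (by simpa using hrK) (fun s t hs hst ht =>
    (hS s t hs hst ht (by linarith)).1) rfl
  intro s t hs hst ht hts
  obtain ⟨i1, i2, i3⟩ := hi s t hs hst ht
  have bs := hb s hs (by linarith)
  have bt := hb t (by linarith) (by linarith)
  have hl := ell_nonneg hst β
  refine ⟨⟨bs.2, bt.2, by simpa using h0, by simpa using h0, i1, i2, ?_, ?_⟩, bs.1, bt.1⟩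
  · simp; positivity
  · simpa using i3

theorem AllT.ctrl {K κ : ℝ} (hr : 0 < r) (hK : 1 ≤ K) (hS : Small RP β r K)
    {v : ℝ → E} {V : ℝ → (Fin d → ℝ) →L[ℝ] E} (h : AllT RP β r r κ v V 0) :
    IsControlled β RP.X (Icc 0 r) v V ∧ cpNorm β RP.X 0 r v V ≤ (4 + K) * κ := by
  have H00 := h 0 0 le_rfl le_rfl hr.le (by linarith)
  have hκ := H00.nonneg
  have A1 : ∀ s ∈ Icc 0 r, ∀ t ∈ Icc 0 r, ‖V t - V s‖ ≤ κ * |t - s| ^ β := by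
    intro s hs t ht
    rcases le_total s t with hst | hst
    · rw [abs_of_nonneg (sub_nonneg.2 hst)]
      exact (h s t hs.1 hst ht.2 (by linarith [hs.1, ht.2])).h0
    · rw [abs_sub_comm, abs_of_nonneg (sub_nonneg.2 hst), norm_sub_rev]
      exact (h t s ht.1 hst hs.2 (by linarith [hs.2, ht.1])).h0
  have A2 : ∀ s ∈ Icc 0 r, ∀ t ∈ Icc 0 r, ‖v t - v s - V s (RP.X t - RP.X s)‖ ≤
      ((1 + K) * κ) * |t - s| ^ (2 * β) := by
    intro s hs t ht
    rcases le_total s t with hst | hst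
    · rw [abs_of_nonneg (sub_nonneg.2 hst), gamma_sq (sub_nonneg.2 hst)]
      have := (h s t hs.1 hst ht.2 (by linarith [hs.1, ht.2])).rem
      have hl := ell_nonneg hst β
      simp only [Pi.zero_apply, _root_.zero_apply, sub_zero] at this
      exact this.trans (by gcongr; nlinarith)
    · rw [abs_sub_comm, abs_of_nonneg (sub_nonneg.2 hst), gamma_sq (sub_nonneg.2 hst)]
      have g := (h t s ht.1 hst hs.2 (by linarith [hs.2, ht.1]))
      have g1 := g.rem
      have g2 := clm_le g.h0 (hS t s ht.1 hst hs.2 (by linarith [hs.2, ht.1])).1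
      have hl := ell_nonneg hst β
      simp only [Pi.zero_apply, _root_.zero_apply, sub_zero] at g1
      have e : v t - v s - V s (RP.X t - RP.X s) =
        -(v s - v t - V t (RP.X s - RP.X t)) + (V s - V t) (RP.X s - RP.X t) := by
        rw [_root_.sub_apply, show RP.X t - RP.X s = -(RP.X s - RP.X t) by abel, map_neg]; abel
      rw [e]
      refine (norm_add_le _ _).trans ?_
      rw [norm_neg]
      calc _ ≤ _ := add_le_add g1 g2
        _ = _ := by ring
  refine ⟨⟨⟨κ, A1⟩, _, A2⟩, ?_⟩
  have i1 := inf_le (F := fun s t => ‖V t - V s‖) (G := fun s t => |t - s| ^ β) hκ A1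
  have i2 := inf_le (F := fun s t => ‖v t - v s - V s (RP.X t - RP.X s)‖)
    (G := fun s t => |t - s| ^ (2 * β)) (by positivity) A2
  have b1 := H00.bs
  have b2 := H00.b0s
  calc cpNorm β RP.X 0 r v V ≤ κ + κ + κ + (1 + K) * κ :=
      add_le_add (add_le_add (add_le_add b1 b2) i1) i2
    _ = _ := by ring

theorem AllT.congr {M : ℝ} {m n : ℝ → E} {m0 m1 n0 n1 : ℝ → (Fin d → ℝ) →L[ℝ] E}
    (h : AllT RP β r r M m m0 m1) (e : ∀ τ, 0 ≤ τ → τ ≤ r → m τ = n τ)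
    (e0 : ∀ τ, 0 ≤ τ → τ ≤ r → m0 τ = n0 τ) (e1 : ∀ τ, 0 ≤ τ → τ ≤ r → m1 τ = n1 τ) :
    AllT RP β r r M n n0 n1 := by
  intro s t hs hst ht hts
  have H := h s t hs hst ht hts
  have hs' : s ≤ r := by linarith
  have ht' : 0 ≤ t := by linarith
  obtain ⟨⟨a1, a2, a3, a4, a5, a6, a7, a8⟩, a9, a10⟩ := H
  rw [e0 s hs hs'] at a1 a6 a8
  rw [e0 t ht' ht] at a2 a6
  rw [e1 s hs hs'] at a3 a7 a8
  rw [e1 t ht' ht] at a4 a7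
  rw [e s hs hs'] at a5 a8 a9
  rw [e t ht' ht] at a5 a8 a10
  exact ⟨⟨a1, a2, a3, a4, a5, a6, a7, a8⟩, a9, a10⟩

theorem Davie.congr {C : ℝ} {v w : ℝ → E} {V V' : ℝ → (Fin d → ℝ) →L[ℝ] E}
    {z0 z1 z0' z1' : ℝ → (Fin d → ℝ) →L[ℝ] ((Fin d → ℝ) →L[ℝ] E)}
    (h : Davie RP β r r C v V z0 z1) (e : ∀ τ, 0 ≤ τ → τ ≤ r → v τ = w τ)
    (eV : ∀ τ, 0 ≤ τ → τ ≤ r → V τ = V' τ)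
    (e0 : ∀ τ, 0 ≤ τ → τ ≤ r → z0 τ = z0' τ) (e1 : ∀ τ, 0 ≤ τ → τ ≤ r → z1 τ = z1' τ) :
    Davie RP β r r C w V' z0' z1' := by
  intro s t hs hst ht hts
  have H := h s t hs hst ht hts
  have hs' : s ≤ r := by linarith
  have ht' : 0 ≤ t := by linarith
  rwa [Xi, e s hs hs', e t ht' ht, eV s hs hs', e0 s hs hs', e1 s hs hs'] at H

theorem Davie.mono {C C' : ℝ} {v : ℝ → E} {V : ℝ → (Fin d → ℝ) →L[ℝ] E}
    {z0 z1 : ℝ → (Fin d → ℝ) →L[ℝ] ((Fin d → ℝ) →L[ℝ] E)}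
    (h : Davie RP β r r C v V z0 z1) (hC : C ≤ C') : Davie RP β r r C' v V z0 z1 := by
  intro s t hs hst ht hts
  have := ell_nonneg hst β
  exact (h s t hs hst ht hts).trans (by gcongr)

theorem Davie.add {C C' : ℝ} {v w : ℝ → E} {V V' : ℝ → (Fin d → ℝ) →L[ℝ] E}
    {z0 z1 z0' z1' : ℝ → (Fin d → ℝ) →L[ℝ] ((Fin d → ℝ) →L[ℝ] E)}
    (h : Davie RP β r r C v V z0 z1) (h' : Davie RP β r r C' w V' z0' z1') :
    Davie RP β r r (C + C') (fun τ => v τ + w τ) (fun τ => V τ + V' τ) (fun τ => z0 τ + z0' τ)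
      (fun τ => z1 τ + z1' τ) := by
  intro s t hs hst ht hts
  have e : (v t + w t) - (v s + w s) - Xi RP (fun τ => V τ + V' τ) (fun τ => z0 τ + z0' τ)
      (fun τ => z1 τ + z1' τ) s t = (v t - v s - Xi RP V z0 z1 s t) +
      (w t - w s - Xi RP V' z0' z1' s t) := by
    simp only [Xi, apply2_add_left, _root_.add_apply]; abel
  dsimp only
  rw [e]
  refine (norm_add_le _ _).trans ?_
  rw [add_mul]
  exact add_le_add (h s t hs hst ht hts) (h' s t hs hst ht hts)

theorem Davie.smul {C : ℝ} (c : ℝ) {v : ℝ → E} {V : ℝ → (Fin d → ℝ) →L[ℝ] E}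
    {z0 z1 : ℝ → (Fin d → ℝ) →L[ℝ] ((Fin d → ℝ) →L[ℝ] E)}
    (h : Davie RP β r r C v V z0 z1) :
    Davie RP β r r (|c| * C) (fun τ => c • v τ) (fun τ => c • V τ) (fun τ => c • z0 τ)
      (fun τ => c • z1 τ) := by
  intro s t hs hst ht hts
  have e : c • v t - c • v s - Xi RP (fun τ => c • V τ) (fun τ => c • z0 τ)
      (fun τ => c • z1 τ) s t = c • (v t - v s - Xi RP V z0 z1 s t) := by
    simp only [Xi, apply2_smul_left, _root_.smul_apply, smul_sub, smul_add]
  dsimp only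
  rw [e, norm_smul, Real.norm_eq_abs, mul_assoc]
  gcongr
  exact h s t hs hst ht hts

theorem Davie.sub {C C' : ℝ} {v w : ℝ → E} {V V' : ℝ → (Fin d → ℝ) →L[ℝ] E}
    {z0 z1 z0' z1' : ℝ → (Fin d → ℝ) →L[ℝ] ((Fin d → ℝ) →L[ℝ] E)}
    (h : Davie RP β r r C v V z0 z1) (h' : Davie RP β r r C' w V' z0' z1') :
    Davie RP β r r (C + C') (fun τ => v τ - w τ) (fun τ => V τ - V' τ) (fun τ => z0 τ - z0' τ)
      (fun τ => z1 τ - z1' τ) := by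
  have := h.add (h'.smul (-1))
  simpa [sub_eq_add_neg] using this

theorem AllT.add {M N : ℝ} {m n : ℝ → E} {m0 m1 n0 n1 : ℝ → (Fin d → ℝ) →L[ℝ] E}
    (h : AllT RP β r r M m m0 m1) (h' : AllT RP β r r N n n0 n1) :
    AllT RP β r r (M + N) (fun τ => m τ + n τ) (fun τ => m0 τ + n0 τ) (fun τ => m1 τ + n1 τ) :=
  fun s t hs hst ht hts => (h s t hs hst ht hts).add (h' s t hs hst ht hts)

theorem AllT.sub {M N : ℝ} {m n : ℝ → E} {m0 m1 n0 n1 : ℝ → (Fin d → ℝ) →L[ℝ] E}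
    (h : AllT RP β r r M m m0 m1) (h' : AllT RP β r r N n n0 n1) :
    AllT RP β r r (M + N) (fun τ => m τ - n τ) (fun τ => m0 τ - n0 τ) (fun τ => m1 τ - n1 τ) :=
  fun s t hs hst ht hts => (h s t hs hst ht hts).sub (h' s t hs hst ht hts)

theorem AllT.smul {M : ℝ} {m : ℝ → E} {m0 m1 : ℝ → (Fin d → ℝ) →L[ℝ] E} (c : ℝ)
    (h : AllT RP β r r M m m0 m1) :
    AllT RP β r r (|c| * M) (fun τ => c • m τ) (fun τ => c • m0 τ) (fun τ => c • m1 τ) :=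
  fun s t hs hst ht hts => (h s t hs hst ht hts).smul c

theorem AllT.nonneg {M : ℝ} {m : ℝ → E} {m0 m1 : ℝ → (Fin d → ℝ) →L[ℝ] E} (hr : 0 < r)
    (h : AllT RP β r r M m m0 m1) : 0 ≤ M := (h 0 0 le_rfl le_rfl hr.le (by linarith)).nonneg

theorem AllT.bd {M : ℝ} {m : ℝ → E} {m0 m1 : ℝ → (Fin d → ℝ) →L[ℝ] E} (hr : 0 < r)
    (h : AllT RP β r r M m m0 m1) {t : ℝ} (h0 : 0 ≤ t) (h1 : t ≤ r) :
    ‖m t‖ ≤ M ∧ ‖m0 t‖ ≤ M ∧ ‖m1 t‖ ≤ M := by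
  have := h t t h0 le_rfl h1 (by linarith)
  exact ⟨this.bs, this.b0s, this.b1s⟩

end Conv
end SDDE

namespace SDDE
open Set Filter Topology
set_option maxSynthPendingDepth 3

section LinEst

set_option linter.unusedSectionVars false
variable {d : ℕ} {r γ β : ℝ} {W : Type*} [NormedAddCommGroup W] [NormedSpace ℝ W]
variable {RP : DelayedRoughPath d r γ} {σ : W × W → (Fin d → ℝ) →L[ℝ] W} {B : ℝ}

theorem AllT.pair {M N : ℝ} {y e : ℝ → W} {Y e' : ℝ → (Fin d → ℝ) →L[ℝ] W}
    (hy : AllT RP β r r M y Y 0) (he : AllT RP β r r N e 0 e') :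
    AllT RP β r r (M + N) (pu y e) (pa Y) (pb e') :=
  fun s t hs hst ht hts => DC.pair (ell_nonneg hst β) (hy s t hs hst ht hts) (he s t hs hst ht hts)

theorem lin_est (RP : DelayedRoughPath d r γ) (hr : 0 < r) (hβ : 1 / 3 < β) (hβγ : β < γ)
    (hσ : C3b B σ) (M : ℝ) :
    ∃ C, 1 ≤ C ∧ ∀ (u : ℝ → W × W) (u0 u1 : ℝ → (Fin d → ℝ) →L[ℝ] W × W) (v : ℝ → W)
      (V : ℝ → (Fin d → ℝ) →L[ℝ] W) (z0 z1 : ℝ → (Fin d → ℝ) →L[ℝ] ((Fin d → ℝ) →L[ℝ] W))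
      (g : ℝ → W) (g' : ℝ → (Fin d → ℝ) →L[ℝ] W) (R : ℝ → (Fin d → ℝ) →L[ℝ] W)
      (R0 R1 : ℝ → (Fin d → ℝ) →L[ℝ] ((Fin d → ℝ) →L[ℝ] W)) (G NR κ C0 : ℝ),
      AllT RP β r r M u u0 u1 → AllT RP β r r G g 0 g' → AllT RP β r r NR R R0 R1 →
      (∀ τ, 0 ≤ τ → τ ≤ r → V τ = lm σ u (pu v g) τ + R τ) →
      (∀ τ, 0 ≤ τ → τ ≤ r → z0 τ = l0 σ u u0 (pu v g) (pa V) τ + R0 τ) →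
      (∀ τ, 0 ≤ τ → τ ≤ r → z1 τ = l0 σ u u1 (pu v g) (pb g') τ + R1 τ) →
      AllT RP β r r κ v V 0 → Davie RP β r r C0 v V z0 z1 →
      AllT RP β r r (C * (‖v 0‖ + (G + NR))) v V 0 ∧
      Davie RP β r r (C * (‖v 0‖ + (G + NR))) v V z0 z1 := by
  have hB := hσ.g.nonneg
  obtain ⟨c, hc⟩ : ∃ c, c = 4 * (B * (1 + |M|) ^ 2) + 1 := ⟨_, rfl⟩
  have hMM : (1:ℝ) ≤ (1 + |M|) ^ 2 := one_le_pow₀ (by linarith [abs_nonneg M])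
  have hB' : B ≤ B * (1 + |M|) ^ 2 := le_mul_of_one_le_right hB hMM
  have hc1 : 1 ≤ c := by rw [hc]; linarith [mul_nonneg hB (sq_nonneg (1 + |M|))]
  have hcB : B ≤ c := by rw [hc]; linarith
  obtain ⟨C, hC1, hC⟩ := apriori (E := W) RP hr hβ hβγ c (by linarith)
  refine ⟨C, hC1, ?_⟩
  intro u u0 u1 v V z0 z1 g g' R R0 R1 G NR κ C0 hu hg hR eV e0 e1 hv hD
  have hM := hu.nonneg hr
  have hG := hg.nonneg hr
  have hNR := hR.nonneg hr
  rw [abs_of_nonneg hM] at hc hMM hB'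
  refine hC v V z0 z1 (G + NR) C0 κ (by positivity) ?_ ?_ hv hD
  · intro t h0 h1
    rw [eV t h0 h1]
    have a1 : ‖lm σ u (pu v g) t‖ ≤ B * (‖v t‖ + G) := by
      refine clm_le (hσ.g.b1 _) ?_
      exact max_le (by simpa [pu] using hG)
        ((hg.bd hr h0 h1).1.trans (by simp))
    refine (norm_add_le _ _).trans ((add_le_add a1 (hR.bd hr h0 h1).1).trans ?_)
    have : 0 ≤ ‖v t‖ := norm_nonneg _
    nlinarith
  · intro s t hs hst ht κ' hκ' H
    have hl := ell_nonneg hst β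
    have h1 := DC.pair hl H (hg s t hs hst ht (by linarith))
    have h2 := C3b.lin hσ hl (hu s t hs hst ht (by linarith)).toDI h1
    have h3 := (h2.add (hR s t hs hst ht (by linarith))).mono hl (N := c * (κ' + (G + NR))) (by
      rw [hc]
      have : 0 ≤ B * (1 + M) ^ 2 := by positivity
      nlinarith)
    exact h3.congr (eV s hs (by linarith)).symm (eV t (by linarith) ht).symm
      (e0 s hs (by linarith)).symm (e0 t (by linarith) ht).symm
      (e1 s hs (by linarith)).symm (e1 t (by linarith) ht).symm

/-- Solutions of the frozen delay equation in Davie form. -/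
def SolP (RP : DelayedRoughPath d r γ) (β : ℝ) (σ : W × W → (Fin d → ℝ) →L[ℝ] W) (κ : ℝ)
    (e : ℝ → W) (e' : ℝ → (Fin d → ℝ) →L[ℝ] W) (y : ℝ → W) : Prop :=
  AllT RP β r r κ y (Yf σ y e) 0 ∧
  Davie RP β r r κ y (Yf σ y e) (c0 σ (pu y e) (pa (Yf σ y e))) (c0 σ (pu y e) (pb e'))

theorem SolP.mono {κ κ' : ℝ} {e : ℝ → W} {e' : ℝ → (Fin d → ℝ) →L[ℝ] W} {y : ℝ → W}
    (h : SolP RP β σ κ e e' y) (hk : κ ≤ κ') : SolP RP β σ κ' e e' y :=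
  ⟨h.1.mono hk, h.2.mono hk⟩

theorem lip_sol (RP : DelayedRoughPath d r γ) (hr : 0 < r) (hβ : 1 / 3 < β) (hβγ : β < γ)
    (hσ : C3b B σ) (M κ : ℝ) :
    ∃ C, 1 ≤ C ∧ ∀ (e f y w : ℝ → W) (e' f' : ℝ → (Fin d → ℝ) →L[ℝ] W) (N : ℝ),
      AllT RP β r r M e 0 e' → AllT RP β r r M f 0 f' →
      AllT RP β r r N (fun τ => f τ - e τ) 0 (fun τ => f' τ - e' τ) →
      SolP RP β σ κ e e' y → SolP RP β σ κ f f' w →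
      AllT RP β r r (C * (‖w 0 - y 0‖ + N)) (fun τ => w τ - y τ)
        (fun τ => Yf σ w f τ - Yf σ y e τ) 0 ∧
      Davie RP β r r (C * (‖w 0 - y 0‖ + N)) (fun τ => w τ - y τ)
        (fun τ => Yf σ w f τ - Yf σ y e τ)
        (fun τ => c0 σ (pu w f) (pa (Yf σ w f)) τ - c0 σ (pu y e) (pa (Yf σ y e)) τ)
        (fun τ => c0 σ (pu w f) (pb f') τ - c0 σ (pu y e) (pb e') τ) := by
  have hB := hσ.g.nonneg
  obtain ⟨c, hc⟩ : ∃ c, c = 4 * (B * (1 + |κ + M|) ^ 2) := ⟨_, rfl⟩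
  have hMM : (1:ℝ) ≤ (1 + |κ + M|) ^ 2 := one_le_pow₀ (by linarith [abs_nonneg (κ + M)])
  have hB' : B ≤ B * (1 + |κ + M|) ^ 2 := le_mul_of_one_le_right hB hMM
  have hcB : B ≤ c := by rw [hc]; linarith
  obtain ⟨C, hC1, hC⟩ := apriori (E := W) RP hr hβ hβγ c (by linarith)
  refine ⟨C, hC1, ?_⟩
  intro e f y w e' f' N he hf hN hy hw
  have hM := he.nonneg hr
  have hκ := hy.1.nonneg hr
  have hN0 := hN.nonneg hr
  rw [abs_of_nonneg (by positivity)] at hc hMM hB'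
  refine hC (fun τ => w τ - y τ) _ _ _ N (κ + κ) (κ + κ) hN0 ?_ ?_ ?_ ?_
  · intro t h0 h1
    refine (hσ.g.lip0 (y t, e t) (w t, f t)).trans ?_
    have : ‖(w t, f t) - (y t, e t)‖ ≤ ‖w t - y t‖ + N :=
      max_le (by simpa using hN0) ((hN.bd hr h0 h1).1.trans (by simp))
    gcongr
    linarith
  · intro s t hs hst ht κ' hκ' H
    have hl := ell_nonneg hst β
    have h1 := DC.pair hl H (hN s t hs hst ht (by linarith))
    have hu := DI.pair hl (hy.1 s t hs hst ht (by linarith)).toDI (he s t hs hst ht (by linarith)).toDI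
    have hv := DI.pair hl (hw.1 s t hs hst ht (by linarith)).toDI (hf s t hs hst ht (by linarith)).toDI
    have h2 := C3b.lipschitz hσ hl hu hv (N := κ' + N) (h1.congr rfl rfl
      (pa_sub _ _).symm (pa_sub _ _).symm (pb_sub _ _).symm (pb_sub _ _).symm)
    rw [← hc] at h2
    exact h2
  · exact (hw.1.sub hy.1).congr (fun _ _ _ => rfl) (fun _ _ _ => rfl) (fun _ _ _ => by simp)
  · exact hw.2.sub hy.2

theorem SolP.unique {κ κ' : ℝ} (hr : 0 < r) (hβ : 1 / 3 < β) (hβγ : β < γ)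
    (hσ : C3b B σ) {M : ℝ} {e : ℝ → W} {e' : ℝ → (Fin d → ℝ) →L[ℝ] W} (he : AllT RP β r r M e 0 e')
    {y w : ℝ → W} (hy : SolP RP β σ κ e e' y) (hw : SolP RP β σ κ' e e' w) (h0 : y 0 = w 0)
    {t : ℝ} (ht0 : 0 ≤ t) (ht1 : t ≤ r) : y t = w t := by
  obtain ⟨C, hC1, hC⟩ := lip_sol RP hr hβ hβγ hσ M (max κ κ')
  have hz : AllT RP β r r 0 (fun τ => e τ - e τ) 0 (fun τ => e' τ - e' τ) := by
    have := (he.smul 0).congr (n := fun τ => e τ - e τ) (n0 := 0) (n1 := fun τ => e' τ - e' τ)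
      (fun _ _ _ => by simp) (fun _ _ _ => by simp) (fun _ _ _ => by simp)
    simpa using this
  have := (hC e e y w e' e' 0 he he hz (hy.mono (le_max_left _ _)) (hw.mono (le_max_right _ _))).1
  rw [h0] at this
  have h := (this.bd hr ht0 ht1).1
  simp only [sub_self, norm_zero, add_zero, mul_zero] at h
  exact (sub_eq_zero.1 (norm_le_zero_iff.1 h)).symm

/-- Solutions of the linearised equation in Davie form. -/
def LinP (RP : DelayedRoughPath d r γ) (β : ℝ) (σ : W × W → (Fin d → ℝ) →L[ℝ] W) (κ : ℝ)
    (u : ℝ → W × W) (u0 u1 : ℝ → (Fin d → ℝ) →L[ℝ] W × W)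
    (g : ℝ → W) (g' : ℝ → (Fin d → ℝ) →L[ℝ] W) (Z : ℝ → W) : Prop :=
  AllT RP β r r κ Z (lm σ u (pu Z g)) 0 ∧
  Davie RP β r r κ Z (lm σ u (pu Z g)) (l0 σ u u0 (pu Z g) (pa (lm σ u (pu Z g))))
    (l0 σ u u1 (pu Z g) (pb g'))

variable {u : ℝ → W × W} {u0 u1 : ℝ → (Fin d → ℝ) →L[ℝ] W × W}

theorem LinP.lin {κ κ' : ℝ} {g h Z Z' : ℝ → W} {g' h' : ℝ → (Fin d → ℝ) →L[ℝ] W}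
    (a : ℝ) (H : LinP RP β σ κ u u0 u1 g g' Z) (H' : LinP RP β σ κ' u u0 u1 h h' Z') :
    LinP RP β σ (κ + |a| * κ') u u0 u1 (fun τ => g τ + a • h τ) (fun τ => g' τ + a • h' τ)
      (fun τ => Z τ + a • Z' τ) := by
  have e1 : ∀ τ, lm σ u (pu Z g) τ + a • lm σ u (pu Z' h) τ =
      lm σ u (pu (fun τ => Z τ + a • Z' τ) (fun τ => g τ + a • h τ)) τ := by
    intro τ
    simp only [lm, pu]
    rw [← map_smul, ← map_add]; rfl
  refine ⟨(H.1.add (H'.1.smul a)).congr (fun _ _ _ => rfl) (fun τ _ _ => e1 τ)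
    (fun τ _ _ => by simp), (H.2.add (H'.2.smul a)).congr (fun _ _ _ => rfl) (fun τ _ _ => e1 τ)
    (fun τ _ _ => ?_) (fun τ _ _ => ?_)⟩
  · have : pa (lm σ u (pu (fun τ => Z τ + a • Z' τ) (fun τ => g τ + a • h τ))) τ =
      pa (lm σ u (pu Z g)) τ + a • pa (lm σ u (pu Z' h)) τ := by
      simp only [pa, ← e1]
      ext x <;> simp
    simp only [l0]
    rw [this]
    simp only [pu]
    ext x y
    simp [← Prod.smul_mk, ← Prod.mk_add_mk]
    abel_nf
  · have : pb (fun τ => g' τ + a • h' τ) τ = pb g' τ + a • pb h' τ := by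
      simp only [pb]
      ext x <;> simp
    simp only [l0]
    rw [this]
    simp only [pu]
    ext x y
    simp [← Prod.smul_mk, ← Prod.mk_add_mk]
    abel_nf

theorem allT_zero : AllT RP β r r 0 (0 : ℝ → W) 0 0 := by
  intro s t hs hst ht hts
  constructor <;> [constructor; skip; skip] <;> simp

theorem LinP.est (RP : DelayedRoughPath d r γ) (hr : 0 < r) (hβ : 1 / 3 < β) (hβγ : β < γ)
    (hσ : C3b B σ) {M : ℝ} (hu : AllT RP β r r M u u0 u1) :
    ∃ C, 1 ≤ C ∧ ∀ (g Z : ℝ → W) (g' : ℝ → (Fin d → ℝ) →L[ℝ] W) (G κ : ℝ),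
      AllT RP β r r G g 0 g' → LinP RP β σ κ u u0 u1 g g' Z →
      LinP RP β σ (C * (‖Z 0‖ + G)) u u0 u1 g g' Z := by
  obtain ⟨C, hC1, hC⟩ := lin_est RP hr hβ hβγ hσ M
  refine ⟨C, hC1, fun g Z g' G κ hg hZ => ?_⟩
  have hz : AllT RP β r r 0 (0 : ℝ → (Fin d → ℝ) →L[ℝ] W) 0 0 := by
    intro s t hs hst ht hts
    constructor <;> [constructor; skip; skip] <;> simp
  have := hC u u0 u1 Z _ _ _ g g' 0 0 0 G 0 κ κ hu hg hz (fun τ _ _ => by simp)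
    (fun τ _ _ => by simp) (fun τ _ _ => by simp) hZ.1 hZ.2
  rwa [add_zero] at this

theorem LinP.unique (hr : 0 < r) (hβ : 1 / 3 < β) (hβγ : β < γ) (hσ : C3b B σ) {M : ℝ}
    (hu : AllT RP β r r M u u0 u1) {g g₂ Z Z' : ℝ → W} {g' g₂' : ℝ → (Fin d → ℝ) →L[ℝ] W}
    {κ κ' : ℝ}
    (eg : ∀ τ, 0 ≤ τ → τ ≤ r → g τ = g₂ τ) (eg' : ∀ τ, 0 ≤ τ → τ ≤ r → g' τ = g₂' τ)
    (H : LinP RP β σ κ u u0 u1 g g' Z) (H' : LinP RP β σ κ' u u0 u1 g₂ g₂' Z') (h0 : Z 0 = Z' 0)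
    {t : ℝ} (ht0 : 0 ≤ t) (ht1 : t ≤ r) : Z t = Z' t := by
  obtain ⟨C, hC1, hC⟩ := LinP.est RP hr hβ hβγ hσ hu
  have h1 := H.lin (-1) H'
  have h2 := (hC _ _ _ 0 _ (AllT.congr allT_zero (fun τ h h' => by simp [eg τ h h'])
    (fun _ _ _ => rfl) (fun τ h h' => by simp [eg' τ h h'])) h1).1
  have h := (h2.bd hr ht0 ht1).1
  simp only [h0, neg_smul, one_smul, add_neg_cancel, norm_zero, add_zero, mul_zero] at h
  have := norm_le_zero_iff.1 h
  rwa [← sub_eq_add_neg, sub_eq_zero] at this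

end LinEst
end SDDE

namespace SDDE
open Set Filter Topology
set_option maxSynthPendingDepth 3

section LinExist

set_option linter.unusedSectionVars false
variable {d : ℕ} {r γ β : ℝ} {W : Type*} [NormedAddCommGroup W] [NormedSpace ℝ W]
variable {RP : DelayedRoughPath d r γ} {σ : W × W → (Fin d → ℝ) →L[ℝ] W} {B : ℝ}

theorem AllT.limU {ι : Type*} {l : Filter ι} [l.NeBot] {M : ℝ} {m : ι → ℝ → W}
    {m0 m1 : ι → ℝ → (Fin d → ℝ) →L[ℝ] W} {n : ℝ → W} {n0 n1 : ℝ → (Fin d → ℝ) →L[ℝ] W}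
    (h : ∀ i, AllT RP β r r M (m i) (m0 i) (m1 i))
    (e : ∀ τ, 0 ≤ τ → τ ≤ r → Tendsto (fun i => m i τ) l (𝓝 (n τ)))
    (e0 : ∀ τ, 0 ≤ τ → τ ≤ r → Tendsto (fun i => m0 i τ) l (𝓝 (n0 τ)))
    (e1 : ∀ τ, 0 ≤ τ → τ ≤ r → Tendsto (fun i => m1 i τ) l (𝓝 (n1 τ))) :
    AllT RP β r r M n n0 n1 := by
  intro s t hs hst ht hts
  have H := fun i => h i s t hs hst ht hts
  have hs' : s ≤ r := by linarith
  have ht' : 0 ≤ t := by linarith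
  have es := e s hs hs'
  have et := e t ht' ht
  have e0s := e0 s hs hs'
  have e0t := e0 t ht' ht
  have e1s := e1 s hs hs'
  have e1t := e1 t ht' ht
  refine ⟨⟨le_of_tendsto' e0s.norm fun i => (H i).b0s, le_of_tendsto' e0t.norm fun i => (H i).b0t,
    le_of_tendsto' e1s.norm fun i => (H i).b1s, le_of_tendsto' e1t.norm fun i => (H i).b1t,
    le_of_tendsto' (et.sub es).norm fun i => (H i).hm,
    le_of_tendsto' (e0t.sub e0s).norm fun i => (H i).h0,
    le_of_tendsto' (e1t.sub e1s).norm fun i => (H i).h1,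
    le_of_tendsto' (((et.sub es).sub (td_app e0s tendsto_const_nhds)).sub
      (td_app e1s tendsto_const_nhds)).norm fun i => (H i).rem⟩,
    le_of_tendsto' es.norm fun i => (H i).bs, le_of_tendsto' et.norm fun i => (H i).bt⟩

theorem Davie.limU {ι : Type*} {l : Filter ι} [l.NeBot] (hγ : 0 < γ) {C : ℝ} {v : ι → ℝ → W}
    {V : ι → ℝ → (Fin d → ℝ) →L[ℝ] W}
    {z0 z1 : ι → ℝ → (Fin d → ℝ) →L[ℝ] ((Fin d → ℝ) →L[ℝ] W)} {v' : ℝ → W}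
    {V' : ℝ → (Fin d → ℝ) →L[ℝ] W} {z0' z1' : ℝ → (Fin d → ℝ) →L[ℝ] ((Fin d → ℝ) →L[ℝ] W)}
    (h : ∀ i, Davie RP β r r C (v i) (V i) (z0 i) (z1 i))
    (e : ∀ τ, 0 ≤ τ → τ ≤ r → Tendsto (fun i => v i τ) l (𝓝 (v' τ)))
    (eV : ∀ τ, 0 ≤ τ → τ ≤ r → Tendsto (fun i => V i τ) l (𝓝 (V' τ)))
    (e0 : ∀ τ, 0 ≤ τ → τ ≤ r → Tendsto (fun i => z0 i τ) l (𝓝 (z0' τ)))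
    (e1 : ∀ τ, 0 ≤ τ → τ ≤ r → Tendsto (fun i => z1 i τ) l (𝓝 (z1' τ))) :
    Davie RP β r r C v' V' z0' z1' := by
  intro s t hs hst ht hts
  have hs' : s ≤ r := by linarith
  have ht' : 0 ≤ t := by linarith
  exact le_of_tendsto' (((e t ht' ht).sub (e s hs hs')).sub (tendsto_Xi RP hγ (V := V) (z0 := z0)
    (z1 := z1) (V' := V') (z0' := z0') (z1' := z1') (sn := fun _ => s) (tn := fun _ => t)
    tendsto_const_nhds tendsto_const_nhds (eV s hs hs') (e0 s hs hs') (e1 s hs hs'))).norm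
    fun i => h i s t hs hst ht hts

section Pt
variable {ι : Type*} {l : Filter ι} {U V E : Type*} [NormedAddCommGroup U] [NormedSpace ℝ U]
  [NormedAddCommGroup V] [NormedSpace ℝ V] [NormedAddCommGroup E] [NormedSpace ℝ E]

theorem lim_base {a k : U} {c : ι → ℝ} {b : ι → U} (hc : Tendsto c l atTop)
    (hb : Tendsto (fun i => c i • (b i - a)) l (𝓝 k)) : Tendsto b l (𝓝 a) := by
  have h1 : Tendsto (fun i => (c i)⁻¹ • (c i • (b i - a))) l (𝓝 ((0:ℝ) • k)) :=
    (tendsto_inv_atTop_zero.comp hc).smul hb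
  have h2 : Tendsto (fun i => b i - a) l (𝓝 0) := by
    rw [zero_smul] at h1
    refine h1.congr' ?_
    filter_upwards [hc.eventually (eventually_gt_atTop 0)] with i hi
    rw [smul_smul, inv_mul_cancel₀ hi.ne', one_smul]
  simpa using h2.add_const a

theorem lim_diff {G : U → E} {a k : U} {c : ι → ℝ} {b : ι → U} (hG : DifferentiableAt ℝ G a)
    (hc : Tendsto c l atTop) (hb : Tendsto (fun i => c i • (b i - a)) l (𝓝 k)) :
    Tendsto (fun i => c i • (G (b i) - G a)) l (𝓝 (fderiv ℝ G a k)) := by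
  have := (hasFDerivWithinAt_univ.2 hG.hasFDerivAt).lim (c := c) (d := fun i => b i - a) (v := k)
    (l := l) (by simpa using (lim_base hc hb).sub_const a) (by simp) hb
  simpa using this

theorem lim_c0 {B : ℝ} {σ : U → E} (hσ : C3b B σ) {a k : U} {A K : V →L[ℝ] U} {c : ι → ℝ}
    {b : ι → U} {Ab : ι → V →L[ℝ] U} (hc : Tendsto c l atTop)
    (hb : Tendsto (fun i => c i • (b i - a)) l (𝓝 k))
    (hA : Tendsto (fun i => c i • (Ab i - A)) l (𝓝 K)) :
    Tendsto (fun i => c i • ((fderiv ℝ σ (b i)).comp (Ab i) - (fderiv ℝ σ a).comp A)) l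
      (𝓝 (((fderiv ℝ (fderiv ℝ σ) a).comp A).flip k + (fderiv ℝ σ a).comp K)) := by
  have h1 := lim_diff (hσ.g.d2 a) hc hb
  have h2 := td_comp h1 (lim_base hc hA)
  have h3 := td_comp (tendsto_const_nhds (x := fderiv ℝ σ a) (f := l)) hA
  have h4 := h2.add h3
  have e : (fderiv ℝ (fderiv ℝ σ) a k).comp A = ((fderiv ℝ (fderiv ℝ σ) a).comp A).flip k := by
    ext x
    simp [hσ.symm a k]
  rw [e] at h4
  refine h4.congr fun i => ?_
  ext x
  simp [smul_sub]

end Pt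

theorem lim_pa {ι : Type*} {l : Filter ι} {c : ι → ℝ} {Ab : ι → (Fin d → ℝ) →L[ℝ] W}
    {A K : (Fin d → ℝ) →L[ℝ] W} (h : Tendsto (fun i => c i • (Ab i - A)) l (𝓝 K)) :
    Tendsto (fun i => c i • ((Ab i).prod (0 : (Fin d → ℝ) →L[ℝ] W) - A.prod 0)) l
      (𝓝 (K.prod (0 : (Fin d → ℝ) →L[ℝ] W))) := by
  refine (tendsto_pr h (tendsto_const_nhds (x := (0 : (Fin d → ℝ) →L[ℝ] W)))).congr fun i => ?_
  ext x <;> simp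

theorem lim_pb {ι : Type*} {l : Filter ι} {c : ι → ℝ} {Ab : ι → (Fin d → ℝ) →L[ℝ] W}
    {A K : (Fin d → ℝ) →L[ℝ] W} (h : Tendsto (fun i => c i • (Ab i - A)) l (𝓝 K)) :
    Tendsto (fun i => c i • ((0 : (Fin d → ℝ) →L[ℝ] W).prod (Ab i) -
      (0 : (Fin d → ℝ) →L[ℝ] W).prod A)) l (𝓝 ((0 : (Fin d → ℝ) →L[ℝ] W).prod K)) := by
  refine (tendsto_pr (tendsto_const_nhds (x := (0 : (Fin d → ℝ) →L[ℝ] W))) h).congr fun i => ?_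
  ext x <;> simp

theorem lin_exists [ProperSpace W] (RP : DelayedRoughPath d r γ) (hr : 0 < r) (hβ : 1 / 3 < β)
    (hβγ : β < γ) (hσ : C3b B σ) {M κ G : ℝ} {e y g : ℝ → W} {e' g' : ℝ → (Fin d → ℝ) →L[ℝ] W}
    (he : AllT RP β r r M e 0 e') (hy : SolP RP β σ κ e e' y) (hg : AllT RP β r r G g 0 g')
    (x : W) :
    ∃ Z κ', Z 0 = x ∧ LinP RP β σ κ' (pu y e) (pa (Yf σ y e)) (pb e') g g' Z := by
  have hM := he.nonneg hr
  have hG := hg.nonneg hr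
  obtain ⟨M', hM'⟩ : ∃ M', M' = max (M + G) (‖y 0‖ + ‖x‖) := ⟨_, rfl⟩
  have hM1 : M + G ≤ M' := hM' ▸ le_max_left _ _
  have hM2 : ‖y 0‖ + ‖x‖ ≤ M' := hM' ▸ le_max_right _ _
  obtain ⟨κ1, hκ1, hex⟩ := exists_sol RP hr hβ hβγ hσ M' (by linarith)
  obtain ⟨c, hcd⟩ : ∃ c : ℕ → ℝ, c = fun n : ℕ => (n:ℝ) + 1 := ⟨_, rfl⟩
  have hc1 : ∀ n, 1 ≤ c n := fun n => by rw [hcd]; simp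
  have hc0 : ∀ n, 0 < c n := fun n => by linarith [hc1 n]
  have hct : Tendsto c atTop atTop := by
    rw [hcd]; exact tendsto_atTop_add_const_right _ _ tendsto_natCast_atTop_atTop
  have hcU : Tendsto c (hyperfilter ℕ : Filter ℕ) atTop := hct.mono_left Nat.hyperfilter_le_atTop
  have hi1 : ∀ n, (c n)⁻¹ ≤ 1 := fun n => inv_le_one_of_one_le₀ (hc1 n)
  have hi0 : ∀ n, 0 < (c n)⁻¹ := fun n => inv_pos.2 (hc0 n)
  have hf : ∀ n, AllT RP β r r M' (fun τ => e τ + (c n)⁻¹ • g τ) 0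
      (fun τ => e' τ + (c n)⁻¹ • g' τ) := fun n => by
    refine ((he.add (hg.smul (c n)⁻¹)).congr (fun _ _ _ => rfl) (fun _ _ _ => by simp)
      (fun _ _ _ => rfl)).mono ?_
    rw [abs_of_pos (hi0 n)]
    nlinarith [hi1 n]
  have hx : ∀ n, ‖y 0 + (c n)⁻¹ • x‖ ≤ M' := fun n => by
    refine (norm_add_le _ _).trans ?_
    rw [norm_smul, Real.norm_eq_abs, abs_of_pos (hi0 n)]
    nlinarith [hi1 n, norm_nonneg x]
  choose w hw0 hw1 hw2 using fun n => hex _ _ (hf n) _ (hx n)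
  obtain ⟨C, hC1, hC⟩ := lip_sol RP hr hβ hβγ hσ M' (max κ κ1)
  have hN : ∀ n, AllT RP β r r ((c n)⁻¹ * G) (fun τ => (e τ + (c n)⁻¹ • g τ) - e τ) 0
      (fun τ => (e' τ + (c n)⁻¹ • g' τ) - e' τ) := fun n => by
    have := (hg.smul (c n)⁻¹)
    rw [abs_of_pos (hi0 n)] at this
    exact this.congr (fun _ _ _ => by simp) (fun _ _ _ => by simp) (fun _ _ _ => by simp)
  have hL := fun n => hC e _ y (w n) e' _ _ (he.mono (by linarith)) (hf n) (hN n)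
    (hy.mono (le_max_left _ _)) (SolP.mono ⟨hw1 n, hw2 n⟩ (le_max_right κ κ1))
  have hcc : ∀ n, |c n| * (C * (‖w n 0 - y 0‖ + (c n)⁻¹ * G)) = C * (‖x‖ + G) := fun n => by
    rw [hw0 n, add_sub_cancel_left, norm_smul, Real.norm_eq_abs, abs_of_pos (hi0 n),
      abs_of_pos (hc0 n)]
    have := (hc0 n).ne'
    field_simp
  have hA := fun n => (hcc n) ▸ ((hL n).1.smul (c n))
  have hD := fun n => (hcc n) ▸ ((hL n).2.smul (c n))
  have hlim : ∀ τ, ∃ z, 0 ≤ τ → τ ≤ r →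
      Tendsto (fun n => c n • (w n τ - y τ)) (hyperfilter ℕ : Filter ℕ) (𝓝 z) := by
    intro τ
    by_cases h : 0 ≤ τ ∧ τ ≤ r
    · obtain ⟨z, hz⟩ := ultra_lim (hyperfilter ℕ) (f := fun n => c n • (w n τ - y τ))
        (Eventually.of_forall fun n => ((hA n).bd hr h.1 h.2).1)
      exact ⟨z, fun _ _ => hz⟩
    · exact ⟨0, fun h1 h2 => absurd ⟨h1, h2⟩ h⟩
  choose Z hZ using hlim
  have hp : ∀ τ, 0 ≤ τ → τ ≤ r → Tendsto (fun n => c n • ((w n τ, e τ + (c n)⁻¹ • g τ) -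
      (y τ, e τ))) (hyperfilter ℕ : Filter ℕ) (𝓝 (Z τ, g τ)) := by
    intro τ h0 h1
    refine ((hZ τ h0 h1).prodMk_nhds (tendsto_const_nhds (x := g τ))).congr fun n => ?_
    ext
    · simp
    · simp [smul_smul, (hc0 n).ne']
  have hV : ∀ τ, 0 ≤ τ → τ ≤ r → Tendsto (fun n => c n • (Yf σ (w n) (fun τ => e τ + (c n)⁻¹ • g τ) τ
      - Yf σ y e τ)) (hyperfilter ℕ : Filter ℕ) (𝓝 (lm σ (pu y e) (pu Z g) τ)) :=
    fun τ h0 h1 => lim_diff (hσ.g.d1 _) hcU (hp τ h0 h1)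
  have h0' : ∀ τ, 0 ≤ τ → τ ≤ r → Tendsto (fun n => c n • (c0 σ (pu (w n) (fun τ => e τ + (c n)⁻¹ • g τ))
      (pa (Yf σ (w n) (fun τ => e τ + (c n)⁻¹ • g τ))) τ - c0 σ (pu y e) (pa (Yf σ y e)) τ))
      (hyperfilter ℕ : Filter ℕ)
      (𝓝 (l0 σ (pu y e) (pa (Yf σ y e)) (pu Z g) (pa (lm σ (pu y e) (pu Z g))) τ)) :=
    fun τ h0 h1 => lim_c0 hσ hcU (hp τ h0 h1) (lim_pa (hV τ h0 h1))
  have h1' : ∀ τ, 0 ≤ τ → τ ≤ r → Tendsto (fun n => c n • (c0 σ (pu (w n) (fun τ => e τ + (c n)⁻¹ • g τ))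
      (pb (fun τ => e' τ + (c n)⁻¹ • g' τ)) τ - c0 σ (pu y e) (pb e') τ))
      (hyperfilter ℕ : Filter ℕ)
      (𝓝 (l0 σ (pu y e) (pb e') (pu Z g) (pb g') τ)) := by
    intro τ h0 h1
    refine lim_c0 hσ hcU (hp τ h0 h1) (lim_pb ?_)
    refine (tendsto_const_nhds (x := g' τ)).congr fun n => ?_
    simp [smul_smul, (hc0 n).ne']
  refine ⟨Z, C * (‖x‖ + G), ?_, ?_, ?_⟩
  · refine tendsto_nhds_unique (hZ 0 le_rfl hr.le) ((tendsto_const_nhds (x := x)).congr fun n => ?_)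
    rw [hw0 n]
    simp [smul_smul, (hc0 n).ne']
  · exact AllT.limU hA hZ hV (fun τ _ _ => by simp)
  · exact Davie.limU (by linarith) hD hZ hV h0' h1'

end LinExist
end SDDE

namespace SDDE
open Set Filter Topology
set_option maxSynthPendingDepth 3

section Frechet

set_option linter.unusedSectionVars false
variable {d : ℕ} {r γ β : ℝ} {W : Type*} [NormedAddCommGroup W] [NormedSpace ℝ W]
variable {RP : DelayedRoughPath d r γ} {σ : W × W → (Fin d → ℝ) →L[ℝ] W} {B : ℝ}

theorem l0_eq_add {U V E : Type*} [NormedAddCommGroup U] [NormedSpace ℝ U]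
    [NormedAddCommGroup V] [NormedSpace ℝ V] [NormedAddCommGroup E] [NormedSpace ℝ E]
    {σ : U → E} {u k j i : ℝ → U} {u0 k0 j0 i0 : ℝ → V →L[ℝ] U} {τ : ℝ}
    (h : k τ = j τ + i τ) (h0 : k0 τ = j0 τ + i0 τ) :
    l0 σ u u0 k k0 τ = l0 σ u u0 j j0 τ + l0 σ u u0 i i0 τ := by
  simp only [l0]
  rw [h, h0]
  ext x
  simp
  abel_nf

set_option maxHeartbeats 1000000 in
theorem frechet [ProperSpace W] (RP : DelayedRoughPath d r γ) (hr : 0 < r) (hβ : 1 / 3 < β)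
    (hβγ : β < γ) (hσ : C3b B σ) {M κ : ℝ} (κ1 : ℝ) {e y : ℝ → W} {e' : ℝ → (Fin d → ℝ) →L[ℝ] W}
    (he : AllT RP β r r M e 0 e') (hy : SolP RP β σ κ e e' y) (ε : ℝ) (hε : 0 < ε) :
    ∃ δ > 0, ∀ (g w Z : ℝ → W) (g' : ℝ → (Fin d → ℝ) →L[ℝ] W) (G κ2 : ℝ),
      AllT RP β r r G g 0 g' → G ≤ δ →
      SolP RP β σ κ1 (fun τ => e τ + g τ) (fun τ => e' τ + g' τ) w →
      LinP RP β σ κ2 (pu y e) (pa (Yf σ y e)) (pb e') g g' Z →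
      Z 0 = w 0 - y 0 → ‖Z 0‖ ≤ G →
      AllT RP β r r (ε * G) (fun τ => w τ - y τ - Z τ)
        (fun τ => Yf σ w (fun τ => e τ + g τ) τ - Yf σ y e τ - lm σ (pu y e) (pu Z g) τ) 0 := by
  have hM := he.nonneg hr
  have hκ := hy.1.nonneg hr
  obtain ⟨C1, hC11, hC1⟩ := lip_sol RP hr hβ hβγ hσ (M + 1) (max κ κ1)
  have hu : AllT RP β r r (κ + M) (pu y e) (pa (Yf σ y e)) (pb e') := hy.1.pair he
  obtain ⟨C2, hC21, hC2⟩ := lin_est RP hr hβ hβγ hσ (κ + M)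
  obtain ⟨P, hP⟩ : ∃ P, P = 2 * C1 + 1 := ⟨_, rfl⟩
  have hP0 : 0 < P := by rw [hP]; linarith
  have hC20 : 0 < C2 := by linarith
  obtain ⟨κ0, hκ0, hR⟩ := hσ.remainder (V := Fin d → ℝ) (κ + M) (ε / (C2 * P)) (by positivity)
  refine ⟨min 1 (κ0 / P), lt_min one_pos (by positivity), ?_⟩
  intro g w Z g' G κ2 hg hGδ hw hZ hZ0 hZG
  have hG := hg.nonneg hr
  have hG1 : G ≤ 1 := hGδ.trans (min_le_left _ _)
  have hG2 : P * G ≤ κ0 := by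
    have := hGδ.trans (min_le_right _ _)
    rw [le_div_iff₀ hP0] at this
    linarith
  obtain ⟨f, hf⟩ : ∃ f : ℝ → W, f = fun τ => e τ + g τ := ⟨_, rfl⟩
  obtain ⟨f', hf'⟩ : ∃ f' : ℝ → (Fin d → ℝ) →L[ℝ] W, f' = fun τ => e' τ + g' τ := ⟨_, rfl⟩
  rw [← hf, ← hf'] at hw
  rw [← hf]
  have hfA : AllT RP β r r (M + 1) f 0 f' := by
    refine ((he.add hg).congr (fun τ _ _ => ?_) (fun _ _ _ => by simp)
      (fun τ _ _ => ?_)).mono (by linarith)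
    · rw [hf]
    · rw [hf']
  have hdA : AllT RP β r r G (fun τ => f τ - e τ) 0 (fun τ => f' τ - e' τ) :=
    hg.congr (fun _ _ _ => by simp [hf]) (fun _ _ _ => rfl) (fun _ _ _ => by simp [hf'])
  obtain ⟨L1, L2⟩ := hC1 e f y w e' f' G (he.mono (by linarith)) hfA hdA
    (hy.mono (le_max_left _ _)) (hw.mono (le_max_right _ _))
  have hkA : AllT RP β r r (P * G) (pu (fun τ => w τ - y τ) g)
      (pa (fun τ => Yf σ w f τ - Yf σ y e τ)) (pb g') := by
    refine (L1.pair hg).mono ?_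
    rw [← hZ0, hP]
    nlinarith
  obtain ⟨K, hK⟩ : ∃ K, K = pu (fun τ => w τ - y τ) g := ⟨_, rfl⟩
  obtain ⟨K0, hK0⟩ : ∃ K0, K0 = pa (fun τ => Yf σ w f τ - Yf σ y e τ) := ⟨_, rfl⟩
  have hRA := fun s t hs hst ht (hts : t - s ≤ r) => hR _ _ _ s t _ _ _ _ _ _ _
    (ell_nonneg hst β) hG2 (hu s t hs hst ht hts) (hkA s t hs hst ht hts)
  have E0 : (fun τ => pu y e τ + pu (fun τ => w τ - y τ) g τ) = pu w f := by
    funext τ; ext <;> simp [pu, hf]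
  have E1 : (fun τ => pa (Yf σ y e) τ + pa (fun τ => Yf σ w f τ - Yf σ y e τ) τ) = pa (Yf σ w f) := by
    funext τ; ext <;> simp [pa]
  have E2 : (fun τ => pb e' τ + pb g' τ) = pb f' := by
    funext τ; ext <;> simp [pb, hf']
  rw [E0, E1, E2] at hRA
  have hz : AllT RP β r r 0 (0 : ℝ → W) 0 0 := allT_zero
  have fin := (hC2 (pu y e) (pa (Yf σ y e)) (pb e') (fun τ => w τ - y τ - Z τ)
    (fun τ => Yf σ w f τ - Yf σ y e τ - lm σ (pu y e) (pu Z g) τ) 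
    (fun τ => c0 σ (pu w f) (pa (Yf σ w f)) τ - c0 σ (pu y e) (pa (Yf σ y e)) τ
      - l0 σ (pu y e) (pa (Yf σ y e)) (pu Z g) (pa (lm σ (pu y e) (pu Z g))) τ)
    (fun τ => c0 σ (pu w f) (pb f') τ - c0 σ (pu y e) (pb e') τ
      - l0 σ (pu y e) (pb e') (pu Z g) (pb g') τ)
    0 0 _ _ _ 0 (ε / (C2 * P) * (P * G)) (C1 * (‖w 0 - y 0‖ + G) + κ2)
    (C1 * (‖w 0 - y 0‖ + G) + κ2) hu hz hRA ?_ ?_ ?_ ?_ ?_).1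
  · refine fin.mono (le_of_eq ?_)
    rw [hZ0]
    simp
    field_simp
  · intro τ _ _
    have e1 : σ (pu y e τ + pu (fun τ => w τ - y τ) g τ) = σ (w τ, f τ) := by
      rw [congrFun E0 τ]; rfl
    have e2 : lm σ (pu y e) (pu (fun τ => w τ - y τ) g) τ = lm σ (pu y e) (pu Z g) τ +
        lm σ (pu y e) (pu (fun τ => w τ - y τ - Z τ) 0) τ := by
      simp only [lm]
      rw [← map_add]
      congr 1
      ext <;> simp [pu]
    simp only [e1, e2]
    simp only [Yf]
    show _ = _ + (_ - σ (y τ, e τ) - _)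
    abel
  · intro τ _ _
    rw [l0_eq_add (k := pu (fun τ => w τ - y τ) g)
      (j := pu Z g) (j0 := pa (lm σ (pu y e) (pu Z g)))
      (i := pu (fun τ => w τ - y τ - Z τ) 0)
      (i0 := pa (fun τ => Yf σ w f τ - Yf σ y e τ - lm σ (pu y e) (pu Z g) τ))]
    · abel
    · ext <;> simp [pu]
    · ext <;> simp [pa]
  · intro τ _ _
    rw [l0_eq_add (k := pu (fun τ => w τ - y τ) g)
      (j := pu Z g) (j0 := pb g')
      (i := pu (fun τ => w τ - y τ - Z τ) 0) (i0 := pb 0)]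
    · abel
    · ext <;> simp [pu]
    · ext <;> simp [pb]
  · exact (L1.sub hZ.1).congr (fun _ _ _ => rfl) (fun _ _ _ => rfl) (fun _ _ _ => by simp)
  · exact L2.sub hZ.2

end Frechet
end SDDE

namespace SDDE
open Set Filter Topology
set_option maxSynthPendingDepth 3

section Bridge

set_option linter.unusedSectionVars false
variable {d : ℕ} {r γ β : ℝ} {W : Type*} [NormedAddCommGroup W] [NormedSpace ℝ W]
variable {RP : DelayedRoughPath d r γ} {σ : W × W → (Fin d → ℝ) →L[ℝ] W} {B : ℝ}

theorem AllT.compose {M : ℝ} (hσ : C3b B σ) {u : ℝ → W × W}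
    {u0 u1 : ℝ → (Fin d → ℝ) →L[ℝ] W × W} (hu : AllT RP β r r M u u0 u1) :
    AllT RP β r r (B * (1 + M) ^ 2) (fun τ => σ (u τ)) (c0 σ u u0) (c0 σ u u1) := by
  intro s t hs hst ht hts
  have hl := ell_nonneg hst β
  exact (hu s t hs hst ht hts).toDI.compose hl hσ.g

theorem sigmaX_comp (p : W × W) (A : (Fin d → ℝ) →L[ℝ] W) :
    (sigmaX σ p).comp A = (fderiv ℝ σ p).comp (A.prod 0) := by
  ext x
  simp [sigmaX]

theorem sigmaY_comp (p : W × W) (A : (Fin d → ℝ) →L[ℝ] W) :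
    (sigmaY σ p).comp A = (fderiv ℝ σ p).comp ((0 : (Fin d → ℝ) →L[ℝ] W).prod A) := by
  ext x
  simp [sigmaY]

theorem sigma_add (p : W × W) (a b : W) :
    sigmaX σ p a + sigmaY σ p b = fderiv ℝ σ p (a, b) := by
  have : ((a, b) : W × W) = (a, 0) + (0, b) := by simp
  rw [this, map_add]
  simp [sigmaX, sigmaY]

/-- the coefficients of a solution on the first interval -/
theorem sol_coeff {ξ y : ℝ → W} {ξ' : ℝ → (Fin d → ℝ) →L[ℝ] W}
    (h : ∀ t ∈ Icc (-r) 0, y t = ξ t) (τ : ℝ) (h0 : 0 ≤ τ) (h1 : τ ≤ r) :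
    σ (y τ, y (τ - r)) = Yf σ y (fun τ => ξ (τ - r)) τ ∧
    solDeriv σ r ξ' y τ = Yf σ y (fun τ => ξ (τ - r)) τ ∧
    zeta0 σ r y (solDeriv σ r ξ' y) τ =
      c0 σ (pu y fun τ => ξ (τ - r)) (pa (Yf σ y fun τ => ξ (τ - r))) τ ∧
    (τ < r → zeta1 σ r y (solDeriv σ r ξ' y) τ =
      c0 σ (pu y fun τ => ξ (τ - r)) (pb fun τ => ξ' (τ - r)) τ) := by
  have e1 : y (τ - r) = ξ (τ - r) := h _ ⟨by linarith, by linarith⟩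
  have e2 : ¬ τ < 0 := not_lt.2 h0
  refine ⟨by simp only [Yf, e1], by simp only [solDeriv, if_neg e2, Yf, e1], ?_, fun h2 => ?_⟩
  · simp only [zeta0, sigmaX_comp, solDeriv, if_neg e2, e1, c0, pu, pa, Yf]
  · have e3 : τ - r < 0 := by linarith
    simp only [zeta1, sigmaY_comp, solDeriv, if_pos e3, e1, c0, pu, pb]

theorem IsSolOn.solP (hr : 0 < r) (hβ : 1 / 3 < β) (hβγ : β < γ) (hσ : C3b B σ)
    {ξ y : ℝ → W} {ξ' : ℝ → (Fin d → ℝ) →L[ℝ] W} {M : ℝ}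
    (he : AllT RP β r r M (fun τ => ξ (τ - r)) 0 (fun τ => ξ' (τ - r)))
    (h : IsSolOn RP σ 0 β ξ ξ' y) :
    ∃ κ, SolP RP β σ κ (fun τ => ξ (τ - r)) (fun τ => ξ' (τ - r)) y := by
  obtain ⟨h1, h2, h3⟩ := h
  have hβ0 : 0 < β := by linarith
  have hy0 : y 0 = ξ 0 := h1 0 ⟨by linarith, le_rfl⟩
  obtain ⟨K, hK1, hSK, hrK⟩ := exists_small_r RP hr.le hβ0 hβγ
  have hA := (ctrl_allT hβ0 hK1 hSK hrK h2).congr (n := y) (n0 := Yf σ y fun τ => ξ (τ - r))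
    (n1 := 0) (fun _ _ _ => rfl) (fun τ a b => (sol_coeff h1 τ a b).2.1) (fun _ _ _ => rfl)
  have hV := (hA.pair he).compose hσ
  obtain ⟨C, hC0, hC⟩ := davie_of_int (v := y) hr hβ hβγ hV
    (m := fun τ => σ (y τ, y (τ - r))) (ζ0 := zeta0 σ r y (solDeriv σ r ξ' y))
    (ζ1 := zeta1 σ r y (solDeriv σ r ξ' y))
    (fun τ a b => ⟨(sol_coeff (ξ' := ξ') h1 τ a b.le).1, (sol_coeff (ξ' := ξ') h1 τ a b.le).2.2.1,
      (sol_coeff h1 τ a b.le).2.2.2 b⟩)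
    (fun t ht0 ht1 => by simpa [hy0] using h3 t ⟨ht0, ht1⟩)
  exact ⟨max _ C, hA.mono (le_max_left _ _), hC.mono (le_max_right _ _)⟩

theorem SolP.congr {κ : ℝ} {e y w : ℝ → W} {e' : ℝ → (Fin d → ℝ) →L[ℝ] W}
    (h : SolP RP β σ κ e e' y) (hyw : ∀ τ, 0 ≤ τ → τ ≤ r → y τ = w τ) :
    SolP RP β σ κ e e' w := by
  have e1 : ∀ τ, 0 ≤ τ → τ ≤ r → Yf σ y e τ = Yf σ w e τ := fun τ a b => by
    simp only [Yf, hyw τ a b]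
  exact ⟨h.1.congr hyw e1 (fun _ _ _ => rfl), h.2.congr hyw e1
    (fun τ a b => by simp only [c0, pu, pa, e1 τ a b, hyw τ a b])
    (fun τ a b => by simp only [c0, pu, pb, hyw τ a b])⟩

theorem SolP.isSolOn (hr : 0 < r) (hβ : 1 / 3 < β) (hβγ : β < γ) {κ : ℝ}
    {ξ y : ℝ → W} {ξ' : ℝ → (Fin d → ℝ) →L[ℝ] W}
    (h : SolP RP β σ κ (fun τ => ξ (τ - r)) (fun τ => ξ' (τ - r)) y)
    (h1 : ∀ t ∈ Icc (-r) 0, y t = ξ t) : IsSolOn RP σ 0 β ξ ξ' y := by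
  have hβ0 : 0 < β := by linarith
  have hy0 : y 0 = ξ 0 := h1 0 ⟨by linarith, le_rfl⟩
  obtain ⟨K, hK1, hSK, hrK⟩ := exists_small_r RP hr.le hβ0 hβγ
  have hA := h.1.congr (n := y) (n0 := solDeriv σ r ξ' y)
    (n1 := 0) (fun _ _ _ => rfl) (fun τ a b => (sol_coeff h1 τ a b).2.1.symm) (fun _ _ _ => rfl)
  refine ⟨h1, (hA.ctrl hr hK1 hSK).1, fun t ht => ?_⟩
  have := h.2.hasInt hβ (h.1.nonneg hr)
    (m := fun τ => σ (y τ, y (τ - r))) (ζ0 := zeta0 σ r y (solDeriv σ r ξ' y))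
    (ζ1 := zeta1 σ r y (solDeriv σ r ξ' y))
    (fun τ a b => ⟨(sol_coeff (ξ' := ξ') h1 τ a b.le).1, (sol_coeff (ξ' := ξ') h1 τ a b.le).2.2.1,
      (sol_coeff h1 τ a b.le).2.2.2 b⟩) le_rfl ht.2
  simpa [hy0] using this

theorem solMap_spec [ProperSpace W] (RP : DelayedRoughPath d r γ) (hr : 0 < r) (hβ : 1 / 3 < β)
    (hβγ : β < γ) (hσ : C3b B σ) (M : ℝ) (hM : 0 ≤ M) :
    ∃ κ, 1 ≤ κ ∧ ∀ p : (ℝ → W) × (ℝ → (Fin d → ℝ) →L[ℝ] W),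
      AllT RP β r r M (fun τ => p.1 (τ - r)) 0 (fun τ => p.2 (τ - r)) →
      SolP RP β σ κ (fun τ => p.1 (τ - r)) (fun τ => p.2 (τ - r)) (solMap RP σ 0 β p).1 ∧
      (∀ t ∈ Icc (-r) 0, (solMap RP σ 0 β p).1 t = p.1 t) ∧
      (∀ τ, 0 ≤ τ → τ ≤ r → (solMap RP σ 0 β p).2 τ =
        Yf σ (solMap RP σ 0 β p).1 (fun τ => p.1 (τ - r)) τ) ∧
      solDeriv σ r p.2 (solMap RP σ 0 β p).1 = (solMap RP σ 0 β p).2 := by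
  obtain ⟨κ, hκ, H⟩ := exists_sol RP hr hβ hβγ hσ M hM
  refine ⟨κ, hκ, fun p hp => ?_⟩
  have hx : ‖p.1 0‖ ≤ M := by simpa using (hp.bd hr hr.le le_rfl).1
  obtain ⟨y, hy0, hy⟩ := H _ _ hp (p.1 0) hx
  have hy : SolP RP β σ κ (fun τ => p.1 (τ - r)) (fun τ => p.2 (τ - r)) y := hy
  have hex : ∃ y : ℝ → W, IsSolOn RP σ 0 β p.1 p.2 y := by
    refine ⟨fun τ => if τ ≤ 0 then p.1 τ else y τ, SolP.isSolOn hr hβ hβγ (κ := κ)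
      (hy.congr fun τ a b => ?_) fun t ht => by simp [ht.2]⟩
    by_cases h : τ ≤ 0
    · have : τ = 0 := le_antisymm h a
      subst this; simp [hy0]
    · simp [h]
  have e : solMap RP σ 0 β p = (hex.choose, solDeriv σ r p.2 hex.choose) := by
    unfold solMap; rw [dif_pos hex]
  have hs := hex.choose_spec
  rw [e]
  obtain ⟨κ', hκ'⟩ := hs.solP hr hβ hβγ hσ hp
  have hc0 : y 0 = hex.choose 0 := by rw [hy0, hs.1 0 ⟨by linarith, le_rfl⟩]
  exact ⟨hy.congr fun τ a b => SolP.unique hr hβ hβγ hσ hp hy hκ' hc0 a b, hs.1,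
    fun τ a b => (sol_coeff hs.1 τ a b).2.1, rfl⟩

theorem fderiv_PhiLin (hσ : C3b B σ) (a b c e a' b' c' e' : W) :
    fderiv ℝ (PhiLin σ) (a, b, c, e) (a', b', c', e') =
      fderiv ℝ (fderiv ℝ σ) (a, b) (a', b') (c, e) + fderiv ℝ σ (a, b) (c', e') := by
  have e1 : PhiLin σ = fun p : W × W × W × W => (fderiv ℝ σ (p.1, p.2.1)) p.2.2 := by
    funext p; exact sigma_add _ _ _
  have hA : HasFDerivAt (fun p : W × W × W × W => ((p.1, p.2.1) : W × W))
      ((ContinuousLinearMap.fst ℝ W (W × W × W)).prod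
        ((ContinuousLinearMap.fst ℝ W (W × W)).comp (ContinuousLinearMap.snd ℝ W (W × W × W))))
      (a, b, c, e) :=
    ((ContinuousLinearMap.fst ℝ W (W × W × W)).prod
        ((ContinuousLinearMap.fst ℝ W (W × W)).comp
          (ContinuousLinearMap.snd ℝ W (W × W × W)))).hasFDerivAt
  have hB : HasFDerivAt (fun p : W × W × W × W => p.2.2)
      ((ContinuousLinearMap.snd ℝ W (W × W)).comp (ContinuousLinearMap.snd ℝ W (W × W × W)))
      (a, b, c, e) :=
    ((ContinuousLinearMap.snd ℝ W (W × W)).comp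
      (ContinuousLinearMap.snd ℝ W (W × W × W))).hasFDerivAt
  have hD : HasFDerivAt (fderiv ℝ σ) (fderiv ℝ (fderiv ℝ σ) (a, b)) (a, b) :=
    (hσ.g.d2 _).hasFDerivAt
  have hC := HasFDerivAt.comp (a, b, c, e) (f := fun p : W × W × W × W => ((p.1, p.2.1) : W × W))
    (g := fderiv ℝ σ) hD hA
  have hF := (hC.clm_apply hB).fderiv
  simp only [Function.comp_def] at hF
  rw [e1, hF]
  simp
  abel_nf

theorem lin_coeff (hσ : C3b B σ) {ξ y q Z : ℝ → W} {ξ' q' : ℝ → (Fin d → ℝ) →L[ℝ] W}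
    (h : ∀ t ∈ Icc (-r) 0, y t = ξ t) (τ : ℝ) (h0 : 0 ≤ τ) (h1 : τ ≤ r) :
    linInt σ r ξ y Z q τ = lm σ (pu y fun τ => ξ (τ - r)) (pu Z fun τ => q (τ - r)) τ ∧
    zeta0lin σ r ξ y Z q (solDeriv σ r ξ' y)
        (fun τ => if τ < 0 then q' τ else linInt σ r ξ y Z q τ) τ =
      l0 σ (pu y fun τ => ξ (τ - r)) (pa (Yf σ y fun τ => ξ (τ - r)))
        (pu Z fun τ => q (τ - r))
        (pa (lm σ (pu y fun τ => ξ (τ - r)) (pu Z fun τ => q (τ - r)))) τ ∧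
    zeta1lin σ r ξ y Z q ξ' q' τ =
      l0 σ (pu y fun τ => ξ (τ - r)) (pb fun τ => ξ' (τ - r))
        (pu Z fun τ => q (τ - r)) (pb fun τ => q' (τ - r)) τ := by
  have e2 : ¬ τ < 0 := not_lt.2 h0
  have e1 : y (τ - r) = ξ (τ - r) := h _ ⟨by linarith, by linarith⟩
  have e3 : linInt σ r ξ y Z q τ = lm σ (pu y fun τ => ξ (τ - r)) (pu Z fun τ => q (τ - r)) τ :=
    sigma_add _ _ _
  refine ⟨e3, ?_, ?_⟩
  · apply ContinuousLinearMap.ext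
    intro x
    simp only [zeta0lin, if_neg e2, (sol_coeff (σ := σ) (ξ' := ξ') h τ h0 h1).2.1, e3]
    show fderiv ℝ (PhiLin σ) _ (_, _, _, _) = _
    rw [fderiv_PhiLin hσ]
    rfl
  · apply ContinuousLinearMap.ext
    intro x
    show fderiv ℝ (PhiLin σ) _ (_, _, _, _) = _
    rw [fderiv_PhiLin hσ]
    rfl

theorem LinP.isLinSolOn (hr : 0 < r) (hβ : 1 / 3 < β) (hβγ : β < γ) (hσ : C3b B σ) {κ : ℝ}
    {ξ y q Z : ℝ → W} {ξ' q' : ℝ → (Fin d → ℝ) →L[ℝ] W}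
    (h : ∀ t ∈ Icc (-r) 0, y t = ξ t) (hZ : ∀ t ∈ Icc (-r) 0, Z t = q t)
    (H : LinP RP β σ κ (pu y fun τ => ξ (τ - r)) (pa (Yf σ y fun τ => ξ (τ - r)))
      (pb fun τ => ξ' (τ - r)) (fun τ => q (τ - r)) (fun τ => q' (τ - r)) Z) :
    IsLinSolOn RP σ 0 β ξ q ξ' q' y Z := by
  have hβ0 : 0 < β := by linarith
  have hZ0 : Z 0 = q 0 := hZ 0 ⟨by linarith, le_rfl⟩
  obtain ⟨K, hK1, hSK, hrK⟩ := exists_small_r RP hr.le hβ0 hβγ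
  have hA := H.1.congr (n := Z) (n0 := fun τ => if τ < 0 then q' τ else linInt σ r ξ y Z q τ)
    (n1 := 0) (fun _ _ _ => rfl) (fun τ a b => by
      rw [if_neg (not_lt.2 a)]
      exact (lin_coeff (ξ' := ξ') (q' := q') hσ h τ a b).1.symm) (fun _ _ _ => rfl)
  refine ⟨hZ, (hA.ctrl hr hK1 hSK).1, fun t ht => ?_⟩
  have := H.2.hasInt hβ (H.1.nonneg hr)
    (m := linInt σ r ξ y Z q) (ζ0 := zeta0lin σ r ξ y Z q (solDeriv σ r ξ' y)
          (fun τ => if τ < 0 then q' τ else linInt σ r ξ y Z q τ))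
    (ζ1 := zeta1lin σ r ξ y Z q ξ' q')
    (fun τ a b => lin_coeff hσ h τ a b.le) le_rfl ht.2
  simpa [hZ0] using this

theorem LinP.congr {κ : ℝ} {u : ℝ → W × W} {u0 u1 : ℝ → (Fin d → ℝ) →L[ℝ] W × W}
    {g Z Z' : ℝ → W} {g' : ℝ → (Fin d → ℝ) →L[ℝ] W}
    (h : LinP RP β σ κ u u0 u1 g g' Z) (hZ : ∀ τ, 0 ≤ τ → τ ≤ r → Z τ = Z' τ) :
    LinP RP β σ κ u u0 u1 g g' Z' := by
  have e1 : ∀ τ, 0 ≤ τ → τ ≤ r → lm σ u (pu Z g) τ = lm σ u (pu Z' g) τ := fun τ a b => by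
    simp only [lm, pu, hZ τ a b]
  exact ⟨h.1.congr hZ e1 (fun _ _ _ => rfl), h.2.congr hZ e1
    (fun τ a b => by simp only [l0, pu, pa, e1 τ a b, hZ τ a b])
    (fun τ a b => by simp only [l0, pu, pb, hZ τ a b])⟩

end Bridge
end SDDE

namespace SDDE
open Set Filter Topology
set_option maxSynthPendingDepth 3

section Final

set_option linter.unusedSectionVars false
variable {d : ℕ} {r γ β : ℝ} {W : Type*} [NormedAddCommGroup W] [NormedSpace ℝ W]
variable {RP : DelayedRoughPath d r γ} {σ : W × W → (Fin d → ℝ) →L[ℝ] W} {B : ℝ}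

theorem IsControlled.lin {X : ℝ → Fin d → ℝ} {I : Set ℝ} {m n : ℝ → W}
    {m' n' : ℝ → (Fin d → ℝ) →L[ℝ] W} (a : ℝ) (h : IsControlled β X I m m')
    (k : IsControlled β X I n n') :
    IsControlled β X I (fun τ => m τ + a • n τ) (fun τ => m' τ + a • n' τ) := by
  obtain ⟨⟨C1, h1⟩, C2, h2⟩ := h
  obtain ⟨⟨C3, h3⟩, C4, h4⟩ := k
  refine ⟨⟨C1 + |a| * C3, fun s hs t ht => ?_⟩, C2 + |a| * C4, fun s hs t ht => ?_⟩
  · have e : (m' t + a • n' t) - (m' s + a • n' s) = (m' t - m' s) + a • (n' t - n' s) := by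
      rw [smul_sub]; abel
    simp only [e]
    refine (norm_add_le _ _).trans ?_
    rw [norm_smul, Real.norm_eq_abs, add_mul, mul_assoc]
    exact add_le_add (h1 s hs t ht) (mul_le_mul_of_nonneg_left (h3 s hs t ht) (abs_nonneg a))
  · have e : (m t + a • n t) - (m s + a • n s) - (m' s + a • n' s) (X t - X s) =
        (m t - m s - m' s (X t - X s)) + a • (n t - n s - n' s (X t - X s)) := by
      rw [smul_sub, smul_sub, _root_.add_apply, _root_.smul_apply]; abel
    simp only [e]
    refine (norm_add_le _ _).trans ?_
    rw [norm_smul, Real.norm_eq_abs, add_mul, mul_assoc]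
    exact add_le_add (h2 s hs t ht) (mul_le_mul_of_nonneg_left (h4 s hs t ht) (abs_nonneg a))

theorem isControlled_zero {X : ℝ → Fin d → ℝ} {I : Set ℝ} :
    IsControlled β X I (0 : ℝ → W) (0 : ℝ → (Fin d → ℝ) →L[ℝ] W) :=
  ⟨⟨0, fun s _ t _ => by simp⟩, 0, fun s _ t _ => by simp⟩

/-- the space of controlled initial paths -/
def ctrlSub (β : ℝ) (X : ℝ → Fin d → ℝ) (I : Set ℝ) (W : Type*) [NormedAddCommGroup W]
    [NormedSpace ℝ W] : Submodule ℝ ((ℝ → W) × (ℝ → (Fin d → ℝ) →L[ℝ] W)) where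
  carrier := {q | IsControlled β X I q.1 q.2}
  zero_mem' := isControlled_zero
  add_mem' := by
    intro p q hp hq
    have := IsControlled.lin 1 hp hq
    simp only [one_smul] at this
    exact this
  smul_mem' := by
    intro c q hq
    have := IsControlled.lin c (isControlled_zero (β := β) (X := X) (I := I) (W := W)) hq
    simp only [Pi.zero_apply, zero_add] at this
    exact this

theorem lin_of {S V : Type*} [AddCommGroup S] [Module ℝ S] [AddCommGroup V] [Module ℝ V]
    (F : S → V) (h : ∀ (p q : S) (a : ℝ), F (p + a • q) = F p + a • F q) :
    ∃ L : S →ₗ[ℝ] V, ∀ p, L p = F p := by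
  have h0 : F 0 = 0 := by
    have := h 0 0 1
    simpa using this
  exact ⟨{ toFun := F
           map_add' := fun p q => by simpa using h p q 1
           map_smul' := fun a q => by simpa [h0] using h 0 q a }, fun _ => rfl⟩

theorem exists_D [ProperSpace W] (RP : DelayedRoughPath d r γ) (hr : 0 < r) (hβ : 1 / 3 < β)
    (hβγ : β < γ) (hσ : C3b B σ) {M κ : ℝ} {e y : ℝ → W} {e' : ℝ → (Fin d → ℝ) →L[ℝ] W}
    (he : AllT RP β r r M e 0 e') (hy : SolP RP β σ κ e e' y) :
    ∃ D : ((ℝ → W) × (ℝ → (Fin d → ℝ) →L[ℝ] W)) →ₗ[ℝ] ((ℝ → W) × (ℝ → (Fin d → ℝ) →L[ℝ] W)),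
      ∀ q : (ℝ → W) × (ℝ → (Fin d → ℝ) →L[ℝ] W), IsControlled β RP.X (Icc (-r) 0) q.1 q.2 →
        (∃ κ', LinP RP β σ κ' (pu y e) (pa (Yf σ y e)) (pb e') (fun τ => q.1 (τ - r))
          (fun τ => q.2 (τ - r)) (D q).1) ∧
        (∀ t ∈ Icc (-r) 0, (D q).1 t = q.1 t) ∧
        ∀ τ, 0 ≤ τ → τ ≤ r →
          (D q).2 τ = lm σ (pu y e) (pu (D q).1 (fun τ => q.1 (τ - r))) τ := by
  have hβ0 : 0 < β := by linarith
  obtain ⟨K, hK1, hSK, hrK⟩ := exists_small_r RP hr.le hβ0 hβγ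
  have hu := hy.1.pair he
  have hex : ∀ q : ctrlSub β RP.X (Icc (-r) 0) W, ∃ Z : ℝ → W, ∃ κ', Z 0 = q.1.1 0 ∧
      LinP RP β σ κ' (pu y e) (pa (Yf σ y e)) (pb e') (fun τ => q.1.1 (τ - r))
          (fun τ => q.1.2 (τ - r)) Z := fun q =>
    lin_exists RP hr hβ hβγ hσ he hy (ctrl_shift hβ0 hK1 hSK hrK q.2) (q.1.1 0)
  choose Z κ' hZ0 hZ using hex
  have hlin : ∀ p q (a : ℝ) τ, 0 ≤ τ → τ ≤ r → Z (p + a • q) τ = Z p τ + a • Z q τ := by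
    intro p q a τ h0 h1
    refine LinP.unique (Z' := fun τ => Z p τ + a • Z q τ) hr hβ hβγ hσ hu ?_ ?_
      (hZ (p + a • q)) ((hZ p).lin a (hZ q)) ?_ h0 h1
    · intro τ _ _; simp
    · intro τ _ _; simp
    · simp only [hZ0]; simp
  obtain ⟨F, hF⟩ : ∃ F : ctrlSub β RP.X (Icc (-r) 0) W → (ℝ → W) × (ℝ → (Fin d → ℝ) →L[ℝ] W),
      F = fun q => (fun τ => if τ ∈ Icc (-r) 0 then q.1.1 τ else if τ ∈ Icc 0 r then Z q τ else 0,
        fun τ => if τ ∈ Icc 0 r then lm σ (pu y e) (pu (Z q) (fun τ => q.1.1 (τ - r))) τ else 0) :=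
    ⟨_, rfl⟩
  have F1 : ∀ q τ, 0 ≤ τ → τ ≤ r → Z q τ = (F q).1 τ := by
    intro q τ h0 h1
    rw [hF]
    by_cases h : τ ∈ Icc (-r) 0
    · have : τ = 0 := le_antisymm h.2 h0
      subst this
      simp [hZ0, hr.le]
    · simp only [if_neg h, if_pos (show τ ∈ Icc 0 r from ⟨h0, h1⟩)]
  obtain ⟨L, hL⟩ := lin_of F (by
    intro p q a
    apply Prod.ext
    · funext τ
      simp only [hF, Prod.fst_add, Prod.smul_fst, Pi.add_apply, Pi.smul_apply]
      by_cases h : τ ∈ Icc (-r) 0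
      · simp only [if_pos h]; rfl
      · by_cases h' : τ ∈ Icc 0 r
        · simp only [if_neg h, if_pos h']; exact hlin p q a τ h'.1 h'.2
        · simp only [if_neg h, if_neg h']; simp
    · funext τ
      simp only [hF, Prod.snd_add, Prod.smul_snd, Pi.add_apply, Pi.smul_apply]
      by_cases h' : τ ∈ Icc 0 r
      · simp only [if_pos h', lm]
        rw [← map_smul, ← map_add]
        congr 1
        exact Prod.ext (hlin p q a τ h'.1 h'.2) rfl
      · simp only [if_neg h']; simp)
  obtain ⟨D, hD⟩ := LinearMap.exists_extend L
  refine ⟨D, fun q hq => ?_⟩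
  have hDq : D q = F ⟨q, hq⟩ := by
    rw [← hL, ← hD]; rfl
  rw [hDq]
  refine ⟨⟨_, (hZ ⟨q, hq⟩).congr (F1 _)⟩, fun t ht => ?_, fun τ h0 h1 => ?_⟩
  · rw [hF]; simp only [if_pos ht]
  · have := F1 ⟨q, hq⟩ τ h0 h1
    have h' : τ ∈ Icc 0 r := ⟨h0, h1⟩
    simp only [lm, pu, ← this]
    rw [hF]
    simp only [if_pos h', lm, pu]

theorem main_aux [ProperSpace W] (RP : DelayedRoughPath d r γ) (hr : 0 < r) (hβ : 1 / 3 < β)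
    (hβγ : β < γ) (hσ : C3b B σ) (ξ : ℝ → W) (ξ' : ℝ → (Fin d → ℝ) →L[ℝ] W)
    (hξ : IsControlled β RP.X (Icc (-r) 0) ξ ξ') :
    ∃ D : ((ℝ → W) × (ℝ → (Fin d → ℝ) →L[ℝ] W)) →ₗ[ℝ] ((ℝ → W) × (ℝ → (Fin d → ℝ) →L[ℝ] W)),
      IsSolMapDerivAt RP σ 0 β (ξ, ξ') D ∧
        ∀ q : (ℝ → W) × (ℝ → (Fin d → ℝ) →L[ℝ] W),
          IsControlled β RP.X (Icc (-r) 0) q.1 q.2 →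
            IsLinSolOn RP σ 0 β ξ q.1 ξ' q.2 (solMap RP σ 0 β (ξ, ξ')).1 (D q).1 := by
  have hβ0 : 0 < β := by linarith
  obtain ⟨K, hK1, hSK, hrK⟩ := exists_small_r RP hr.le hβ0 hβγ
  have hK0 : 0 < 4 * K ^ 2 := by positivity
  have he := ctrl_shift hβ0 hK1 hSK hrK hξ
  obtain ⟨M, hM⟩ : ∃ M, M = 4 * K ^ 2 * cpNorm β RP.X (-r) 0 ξ ξ' := ⟨_, rfl⟩
  rw [← hM] at he
  have hM0 := he.nonneg hr
  obtain ⟨κ, hκ1, hsol⟩ := solMap_spec RP hr hβ hβγ hσ (M + 1) (by linarith)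
  obtain ⟨hy, hyξ, hy2, -⟩ := hsol (ξ, ξ') (he.mono (by linarith))
  obtain ⟨p, hp⟩ : ∃ p, p = solMap RP σ 0 β (ξ, ξ') := ⟨_, rfl⟩
  rw [← hp] at hy hyξ hy2 ⊢
  simp only at hy hyξ hy2
  obtain ⟨D, hD⟩ := exists_D RP hr hβ hβγ hσ he hy
  obtain ⟨C, hC1, hC⟩ := LinP.est RP hr hβ hβγ hσ (hy.1.pair he)
  refine ⟨D, ⟨⟨(4 + K) * (C * (2 * (4 * K ^ 2))), by positivity, fun q hq => ?_⟩,
    fun ε hε => ?_⟩, fun q hq => ?_⟩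
  · obtain ⟨⟨κ', hL⟩, hD0, hD2⟩ := hD q hq
    have hg := ctrl_shift hβ0 hK1 hSK hrK hq
    have h1 := (hC _ _ _ _ _ hg hL).1
    have hz : (D q).1 0 = q.1 0 := hD0 0 ⟨by linarith, le_rfl⟩
    have hz' : ‖(D q).1 0‖ ≤ 4 * K ^ 2 * cpNorm β RP.X (-r) 0 q.1 q.2 := by
      rw [hz]; simpa using (hg.bd hr hr.le le_rfl).1
    have h2 := (h1.congr (n := (D q).1) (n0 := (D q).2) (n1 := 0) (fun _ _ _ => rfl)
      (fun τ a b => (hD2 τ a b).symm) (fun _ _ _ => rfl)).ctrl hr hK1 hSK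
    refine h2.2.trans ?_
    rw [mul_assoc (4 + K), mul_assoc C]
    have h4 : (0:ℝ) ≤ 4 + K := by linarith
    have h5 : (0:ℝ) ≤ C := by linarith
    refine mul_le_mul_of_nonneg_left (mul_le_mul_of_nonneg_left ?_ h5) h4
    linarith
  · obtain ⟨ε', hε'⟩ : ∃ ε', ε' = ε / ((4 + K) * (4 * K ^ 2)) := ⟨_, rfl⟩
    have hε0 : 0 < ε' := by rw [hε']; positivity
    have hεe : (4 + K) * (ε' * (4 * K ^ 2)) = ε := by
      rw [hε']; field_simp
    obtain ⟨δ, hδ, hF⟩ := frechet RP hr hβ hβγ hσ κ he hy ε' hε0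
    refine ⟨min δ 1 / (4 * K ^ 2), by positivity, fun h hh hhδ => ?_⟩
    obtain ⟨G, hGd⟩ : ∃ G, G = 4 * K ^ 2 * cpNorm β RP.X (-r) 0 h.1 h.2 := ⟨_, rfl⟩
    have hG : G ≤ min δ 1 := by
      rw [hGd, mul_comm]; exact (le_div_iff₀ hK0).1 hhδ
    have hg := ctrl_shift hβ0 hK1 hSK hrK hh
    rw [← hGd] at hg
    have hsum : AllT RP β r r (M + 1) (fun τ => ((ξ, ξ') + h).1 (τ - r)) 0
        (fun τ => ((ξ, ξ') + h).2 (τ - r)) :=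
      ((he.add hg).mono (by linarith [hG.trans (min_le_right _ _)])).congr
        (fun _ _ _ => rfl) (fun _ _ _ => by simp) (fun _ _ _ => rfl)
    obtain ⟨hw, hwξ, hw2, -⟩ := hsol _ hsum
    obtain ⟨w, hwd⟩ : ∃ w, w = solMap RP σ 0 β ((ξ, ξ') + h) := ⟨_, rfl⟩
    rw [← hwd] at hw hwξ hw2 ⊢
    rw [← hp]
    obtain ⟨⟨κ', hL⟩, hD0, hD2⟩ := hD h hh
    have z0 : (0:ℝ) ∈ Icc (-r) 0 := ⟨by linarith, le_rfl⟩
    have hz : (D h).1 0 = h.1 0 := hD0 0 z0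
    have key := hF _ w.1 (D h).1 _ G κ' hg (hG.trans (min_le_left _ _)) hw hL
      (by rw [hz, hwξ 0 z0, hyξ 0 z0]; simp)
      (by rw [hz]; simpa using (hg.bd hr hr.le le_rfl).1)
    have h2 := (key.congr (n := (w - p - D h).1) (n0 := (w - p - D h).2) (n1 := 0)
      (fun _ _ _ => rfl) (fun τ a b => by
        simp only [Prod.snd_sub, Pi.sub_apply]
        rw [hw2 τ a b, hy2 τ a b, hD2 τ a b]; rfl) (fun _ _ _ => rfl)).ctrl hr hK1 hSK
    refine h2.2.trans (le_of_eq ?_)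
    rw [← hεe, hGd]; ring
  · obtain ⟨⟨κ', hL⟩, hD0, -⟩ := hD q hq
    exact hL.isLinSolOn hr hβ hβγ hσ hyξ hD0

end Final
end SDDE

open SDDE Set in
/-- the solution map of `dy_t = σ(y_t, y_{t-r}) d𝐗_t` is Fréchet
differentiable and the directional derivative `Z = Dy^ξ[ξ̃]` solves the linearized
rough delay equation
`Z_t = ξ̃_0 + ∫_0^t [σ_x(y^ξ_τ, ξ_{τ-r}) Z_τ + σ_y(y^ξ_τ, ξ_{τ-r}) ξ̃_{τ-r}] d𝐗_τ`
with `Z = ξ̃` on `[-r,0]` and Gubinelli derivative equal to the integrand. -/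
theorem solution_map_differentiable
    {d : ℕ} {r γ β : ℝ} (hr : 0 < r) (hγ1 : 1 / 3 < γ) (hγ2 : γ ≤ 1 / 2)
    (hβ1 : 1 / 3 < β) (hβγ : β < γ)
    {W : Type*} [NormedAddCommGroup W] [NormedSpace ℝ W] [FiniteDimensional ℝ W]
    (RP : DelayedRoughPath d r γ)
    (σ : W × W → (Fin d → ℝ) →L[ℝ] W) (hσ : CnBounded 3 σ) :
    ∀ (ξ : ℝ → W) (ξ' : ℝ → (Fin d → ℝ) →L[ℝ] W),
      IsControlled β RP.X (Icc (-r) 0) ξ ξ' →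
      ∃ D : ((ℝ → W) × (ℝ → (Fin d → ℝ) →L[ℝ] W)) →ₗ[ℝ]
          ((ℝ → W) × (ℝ → (Fin d → ℝ) →L[ℝ] W)),
        IsSolMapDerivAt RP σ 0 β (ξ, ξ') D ∧
          ∀ q : (ℝ → W) × (ℝ → (Fin d → ℝ) →L[ℝ] W),
            IsControlled β RP.X (Icc (-r) 0) q.1 q.2 →
              IsLinSolOn RP σ 0 β ξ q.1 ξ' q.2 (solMap RP σ 0 β (ξ, ξ')).1 (D q).1 := by
  have hP : ProperSpace W := FiniteDimensional.proper ℝ W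
  obtain ⟨B, -, hB⟩ := hσ.c3b
  exact fun ξ ξ' hξ => main_aux RP hr hβ1 hβγ hB ξ ξ' hξ
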